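/- (Razar's Theorem.) Let F = (P,Q) be a Keller map. If P is a rational polynomial and every fiber of P is irreducible, i.e. for every c ∈ ℂ the polynomial P − c is irreducible in ℂ[x,y], then F is invertible. -/

import Mathlib

open MvPolynomial Filter

/-- Evaluation of a bivariate polynomial at a point of `ℂ × ℂ`. -/
noncomputable def evalPoly (P : MvPolynomial (Fin 2) ℂ) (p : ℂ × ℂ) : ℂ :=
  MvPolynomial.eval ![p.1, p.2] P

/-- The polynomial map `ℂ² → ℂ²` given by a pair of polynomials. -/
noncomputable def polyMap (P Q : MvPolynomial (Fin 2) ℂ) (p : ℂ × ℂ) : ℂ × ℂ :=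
  (evalPoly P p, evalPoly Q p)

/-- `(P, Q)` is a Keller map: the Jacobian determinant is a nonzero constant. -/
def IsKeller (P Q : MvPolynomial (Fin 2) ℂ) : Prop :=
  ∃ c : ℂ, c ≠ 0 ∧
    pderiv 0 P * pderiv 1 Q - pderiv 1 P * pderiv 0 Q = MvPolynomial.C c

/-- `P` is a rational polynomial: away from finitely many values `c`, the fiber
`P = c` is homeomorphic to `ℂ` minus a finite set of points. -/
def IsRationalPoly (P : MvPolynomial (Fin 2) ℂ) : Prop :=
  ∃ S : Finset ℂ, ∀ c ∉ S, ∃ T : Finset ℂ,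
    Nonempty ({p : ℂ × ℂ // evalPoly P p = c} ≃ₜ {z : ℂ // z ∉ T})

/-- The polynomial map `(P, Q)` has a polynomial inverse. -/
def IsInvertible (P Q : MvPolynomial (Fin 2) ℂ) : Prop :=
  ∃ A B : MvPolynomial (Fin 2) ℂ,
    polyMap A B ∘ polyMap P Q = id ∧ polyMap P Q ∘ polyMap A B = id

/-- The non-proper value set of a map `F : ℂ² → ℂ²`. -/
def nonProperSet (F : ℂ × ℂ → ℂ × ℂ) : Set (ℂ × ℂ) :=
  {a | ∃ b : ℕ → ℂ × ℂ,
    Tendsto (fun i => ‖b i‖) atTop atTop ∧ Tendsto (fun i => F (b i)) atTop (nhds a)}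

namespace Razar
set_option autoImplicit false
set_option linter.unusedSectionVars false
open Polynomial

section
variable (k F : Type*) [Field k] [Field F] [Algebra k F] [Algebra k[X] F] [IsScalarTower k k[X] F]

/-- The subring of fractions of polynomials regular at the origin. -/
def regAtZero : Subalgebra k F where
  carrier := {f | ∃ p q : k[X], q.coeff 0 ≠ 0 ∧ f * algebraMap k[X] F q = algebraMap k[X] F p}
  mul_mem' := by
    rintro a b ⟨p, q, hq, h⟩ ⟨p', q', hq', h'⟩
    refine ⟨p * p', q * q', by simp [mul_coeff_zero, hq, hq'], ?_⟩
    rw [map_mul, map_mul, ← h, ← h']; ring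
  add_mem' := by
    rintro a b ⟨p, q, hq, h⟩ ⟨p', q', hq', h'⟩
    refine ⟨p * q' + p' * q, q * q', by simp [mul_coeff_zero, hq, hq'], ?_⟩
    rw [map_mul, map_add, map_mul, map_mul, ← h, ← h']; ring
  algebraMap_mem' := fun r => ⟨Polynomial.C r, 1, by simp, by
    rw [map_one, mul_one, IsScalarTower.algebraMap_apply k k[X] F]; rfl⟩

variable {k F}

local notation "u" => algebraMap k[X] F Polynomial.X

lemma mem_regAtZero {f : F} : f ∈ regAtZero k F ↔ ∃ p q : k[X], q.coeff 0 ≠ 0 ∧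
    f * algebraMap k[X] F q = algebraMap k[X] F p := Iff.rfl

lemma algebraMap_mem_regAtZero (p : k[X]) : algebraMap k[X] F p ∈ regAtZero k F :=
  ⟨p, 1, by simp, by simp⟩

variable [IsFractionRing k[X] F]

lemma regAtZero_inv_mem {p : k[X]} (hp : p.coeff 0 ≠ 0) :
    (algebraMap k[X] F p)⁻¹ ∈ regAtZero k F := by
  refine ⟨1, p, hp, ?_⟩
  rw [map_one, inv_mul_cancel₀]
  rw [Ne, IsFractionRing.to_map_eq_zero_iff]
  rintro rfl; simp at hp

lemma exists_eq_X_pow_mul {p : k[X]} (hp : p ≠ 0) :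
    ∃ (n : ℕ) (p' : k[X]), p'.coeff 0 ≠ 0 ∧ p = Polynomial.X ^ n * p' := by
  obtain ⟨p', hp', h⟩ := exists_eq_pow_rootMultiplicity_mul_and_not_dvd p hp 0
  refine ⟨_, p', ?_, by simpa using hp'⟩
  simpa [X_dvd_iff] using h

lemma uniformizer_ne_zero : u ≠ 0 := by
  rw [Ne, IsFractionRing.to_map_eq_zero_iff]; exact Polynomial.X_ne_zero

/-- Every nonzero fraction is a power of the uniformizer times a quotient of polynomials that do
not vanish at the origin. -/
lemma exists_zpow_mul {f : F} (hf : f ≠ 0) : ∃ (n : ℤ) (p q : k[X]), p.coeff 0 ≠ 0 ∧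
    q.coeff 0 ≠ 0 ∧ f = u ^ n * (algebraMap k[X] F p / algebraMap k[X] F q) := by
  obtain ⟨a, b, hb, rfl⟩ := IsFractionRing.div_surjective (A := k[X]) f
  have hb0 : b ≠ 0 := nonZeroDivisors.ne_zero hb
  have ha0 : a ≠ 0 := by rintro rfl; simp at hf
  obtain ⟨n, a', ha', rfl⟩ := exists_eq_X_pow_mul ha0
  obtain ⟨m, b', hb', rfl⟩ := exists_eq_X_pow_mul hb0
  refine ⟨n - m, a', b', ha', hb', ?_⟩
  rw [zpow_sub₀ uniformizer_ne_zero, map_mul, map_mul, map_pow, map_pow]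
  simp only [zpow_natCast]
  exact mul_div_mul_comm _ _ _ _

lemma exists_zpow_mul_unit {f : F} (hf : f ≠ 0) : ∃ (n : ℤ) (e : F), e ∈ regAtZero k F ∧
    e⁻¹ ∈ regAtZero k F ∧ e ≠ 0 ∧ f = u ^ n * e := by
  obtain ⟨n, p, q, hp, hq, rfl⟩ := exists_zpow_mul (k := k) hf
  refine ⟨n, _, ?_, ?_, ?_, rfl⟩
  · rw [div_eq_mul_inv]
    exact mul_mem (algebraMap_mem_regAtZero p) (regAtZero_inv_mem hq)
  · rw [inv_div, div_eq_mul_inv]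
    exact mul_mem (algebraMap_mem_regAtZero q) (regAtZero_inv_mem hp)
  · intro h; rw [h] at hf; simp at hf

lemma uniformizer_inv_notMem : u⁻¹ ∉ regAtZero k F := by
  rintro ⟨p, q, hq, h⟩
  rw [inv_mul_eq_iff_eq_mul₀ uniformizer_ne_zero, ← map_mul] at h
  have := IsFractionRing.injective k[X] F h
  rw [this] at hq; simp at hq

variable (k F) in
/-- The coordinate as an element of `regAtZero`. -/
noncomputable def unif : regAtZero k F := ⟨u, algebraMap_mem_regAtZero _⟩

lemma exists_associated {f : regAtZero k F} (hf : f ≠ 0) :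
    ∃ n : ℕ, Associated (unif k F ^ n) f := by
  obtain ⟨n, e, he, he', he0, h⟩ := exists_zpow_mul_unit (k := k)
    (show (f : F) ≠ 0 by simpa using hf)
  have hn : 0 ≤ n := by
    by_contra! hn
    apply uniformizer_inv_notMem (k := k) (F := F)
    obtain ⟨m, rfl⟩ : ∃ m : ℕ, n = -(m + 1) := ⟨(-n - 1).toNat, by omega⟩
    have : (u)⁻¹ = f * e⁻¹ * u ^ m := by
      rw [h]
      have := uniformizer_ne_zero (k := k) (F := F)
      rw [neg_add, zpow_add₀ this, zpow_neg, zpow_neg, zpow_natCast, zpow_one]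
      field_simp
    rw [this]
    exact mul_mem (mul_mem f.2 he') (pow_mem (unif k F).2 m)
  lift n to ℕ using hn
  refine ⟨n, ⟨⟨e, he⟩, ⟨e⁻¹, he'⟩, ?_, ?_⟩, ?_⟩
  · ext; simp [he0]
  · ext; simp [he0]
  · ext; simp [h, unif]

lemma not_isUnit_unif : ¬ IsUnit (unif k F) := by
  rintro ⟨⟨a, b, hab, hba⟩, rfl : a = _⟩
  apply uniformizer_inv_notMem (k := k) (F := F)
  have : u * b = 1 := congrArg Subtype.val hab
  rw [inv_eq_of_mul_eq_one_right this]
  exact b.2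

lemma unif_ne_zero : unif k F ≠ 0 := fun h =>
  uniformizer_ne_zero (k := k) (F := F) (congrArg Subtype.val h)

lemma irreducible_unif : Irreducible (unif k F) := by
  refine ⟨not_isUnit_unif, fun a b hab => ?_⟩
  have ha : a ≠ 0 := by rintro rfl; exact unif_ne_zero (by simpa using hab)
  have hb : b ≠ 0 := by rintro rfl; exact unif_ne_zero (by simpa using hab)
  obtain ⟨n, hn⟩ := exists_associated ha
  obtain ⟨m, hm⟩ := exists_associated hb
  rcases n with _ | n
  · left; simpa [associated_one_iff_isUnit, Associated.comm] using hn
  rcases m with _ | m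
  · right; simpa [associated_one_iff_isUnit, Associated.comm] using hm
  exfalso
  have h := hn.mul_mul hm
  rw [← hab] at h
  obtain ⟨v, hv⟩ := h
  apply not_isUnit_unif (k := k) (F := F)
  refine IsUnit.of_mul_eq_one (unif k F ^ (n + m) * v) ?_
  refine mul_left_cancel₀ (unif_ne_zero (k := k) (F := F)) ?_
  rw [mul_one]
  conv_rhs => rw [← hv]
  ring

instance : IsDiscreteValuationRing (regAtZero k F) :=
  IsDiscreteValuationRing.ofHasUnitMulPowIrreducibleFactorization
    ⟨unif k F, irreducible_unif, exists_associated⟩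

instance : IsFractionRing (regAtZero k F) F := by
  refine IsFractionRing.of_field _ _ fun z => ?_
  obtain ⟨a, b, -, rfl⟩ := IsFractionRing.div_surjective (A := k[X]) z
  exact ⟨⟨_, algebraMap_mem_regAtZero a⟩, ⟨_, algebraMap_mem_regAtZero b⟩, rfl⟩

lemma exists_sub_mem_span_unif (f : regAtZero k F) :
    ∃ a : k, unif k F ∣ f - algebraMap k (regAtZero k F) a := by
  obtain ⟨f, p, q, hq, h⟩ := f
  refine ⟨p.coeff 0 / q.coeff 0, ?_⟩
  have hq0 : algebraMap k[X] F q ≠ 0 := by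
    rw [Ne, IsFractionRing.to_map_eq_zero_iff]
    rintro rfl; simp at hq
  obtain ⟨r, hr⟩ : Polynomial.X ∣ p - Polynomial.C (p.coeff 0 / q.coeff 0) * q := by
    rw [X_dvd_iff]; simp [mul_coeff_zero, hq]
  refine ⟨⟨algebraMap k[X] F r * (algebraMap k[X] F q)⁻¹,
    mul_mem (algebraMap_mem_regAtZero r) (regAtZero_inv_mem hq)⟩, ?_⟩
  ext
  have := congrArg (algebraMap k[X] F) hr
  rw [map_sub, map_mul, map_mul, ← h] at this
  have hC : algebraMap k[X] F (Polynomial.C (p.coeff 0 / q.coeff 0)) =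
    algebraMap k F (p.coeff 0 / q.coeff 0) := by
    rw [IsScalarTower.algebraMap_apply k k[X] F]; rfl
  rw [hC] at this
  change f - algebraMap k F (p.coeff 0 / q.coeff 0) = u * _
  rw [← mul_assoc, ← this]
  field_simp

end

end Razar

namespace Razar
set_option autoImplicit false
set_option linter.unusedSectionVars false
open Polynomial

section
variable {k : Type*} [Field k]

/-- Polynomials as Laurent series. -/
noncomputable def polyLaurent (k : Type*) [Field k] : k[X] →+* LaurentSeries k :=
  (HahnSeries.ofPowerSeries ℤ k).comp Polynomial.coeToPowerSeries.ringHom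

lemma polyLaurent_injective : Function.Injective (polyLaurent k) :=
  HahnSeries.ofPowerSeries_injective.comp (Polynomial.coe_injective k)

lemma polyLaurent_X : polyLaurent k Polynomial.X = HahnSeries.single 1 1 := by
  simp [polyLaurent]

lemma polyLaurent_C (a : k) : polyLaurent k (Polynomial.C a) = HahnSeries.C a := by
  simp [polyLaurent]

lemma coeff_polyLaurent_of_neg (p : k[X]) {m : ℤ} (hm : m < 0) : (polyLaurent k p).coeff m = 0 := by
  change ((p : PowerSeries k) : LaurentSeries k).coeff m = 0
  rw [PowerSeries.coeff_coe, if_pos hm]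

lemma coeff_polyLaurent_zero (p : k[X]) : (polyLaurent k p).coeff 0 = p.coeff 0 := by
  change ((p : PowerSeries k) : LaurentSeries k).coeff 0 = _
  rw [PowerSeries.coeff_coe, if_neg (by simp)]
  simp

lemma order_polyLaurent {p : k[X]} (hp : p.coeff 0 ≠ 0) : (polyLaurent k p).order = 0 := by
  have h0 : polyLaurent k p ≠ 0 := by
    rw [Ne, map_eq_zero_iff _ polyLaurent_injective]; rintro rfl; simp at hp
  apply le_antisymm
  · exact HahnSeries.order_le_of_coeff_ne_zero (by rwa [coeff_polyLaurent_zero])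
  · by_contra! h
    exact mt HahnSeries.coeff_order_eq_zero.1 h0 (coeff_polyLaurent_of_neg p h)

variable (k) (F : Type*) [Field F] [Algebra k[X] F] [IsFractionRing k[X] F]

/-- Expansion of a rational function at the origin. -/
noncomputable def laurent : F →+* LaurentSeries k :=
  IsFractionRing.lift (A := k[X]) (polyLaurent_injective (k := k))

lemma laurent_algebraMap (p : k[X]) : laurent k F (algebraMap k[X] F p) = polyLaurent k p :=
  IsFractionRing.lift_algebraMap _ _

variable {k F} [Algebra k F] [IsScalarTower k k[X] F]
local notation "u" => algebraMap k[X] F Polynomial.X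

lemma laurent_u : laurent k F u = HahnSeries.single 1 1 := by
  rw [laurent_algebraMap, polyLaurent_X]

lemma laurent_u_zpow (n : ℤ) : laurent k F (u ^ n) = HahnSeries.single n 1 := by
  rw [map_zpow₀, laurent_u]; exact (RatFunc.single_zpow n).symm

lemma exists_eq_mul_of_coeff_laurent {f : F} {N : ℕ}
    (hf : ∀ m : ℤ, m < N → (laurent k F f).coeff m = 0) :
    ∃ g ∈ regAtZero k F, f = u ^ N * g := by
  rcases eq_or_ne f 0 with rfl | hf0
  · exact ⟨0, zero_mem _, by simp⟩
  obtain ⟨n, p, q, hp, hq, h⟩ := exists_zpow_mul (k := k) hf0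
  have hq' : algebraMap k[X] F q ≠ 0 := by
    rw [Ne, IsFractionRing.to_map_eq_zero_iff]; rintro rfl; simp at hq
  have h1 : laurent k F f * polyLaurent k q = HahnSeries.single n 1 * polyLaurent k p := by
    rw [← laurent_u_zpow (k := k) (F := F), ← laurent_algebraMap k F p, ← laurent_algebraMap k F q, ← map_mul,
      ← map_mul, h]
    congr 1
    field_simp
  have hl : laurent k F f ≠ 0 := by rwa [Ne, map_eq_zero]
  have hne (r : k[X]) (hr : r.coeff 0 ≠ 0) : polyLaurent k r ≠ 0 := by
    rw [Ne, map_eq_zero_iff _ polyLaurent_injective]; rintro rfl; simp at hr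
  have h2 := congrArg HahnSeries.order h1
  rw [HahnSeries.order_mul hl (hne q hq), HahnSeries.order_mul (by simp) (hne p hp),
    HahnSeries.order_single one_ne_zero, order_polyLaurent hp, order_polyLaurent hq] at h2
  have h3 : (N : ℤ) ≤ n := by
    by_contra! hn
    exact mt HahnSeries.coeff_order_eq_zero.1 hl (hf _ (by omega))
  obtain ⟨j, rfl⟩ : ∃ j : ℕ, n = N + j := ⟨(n - N).toNat, by omega⟩
  refine ⟨u ^ j * (algebraMap k[X] F p * (algebraMap k[X] F q)⁻¹), ?_, ?_⟩
  · exact mul_mem (pow_mem (algebraMap_mem_regAtZero _) _)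
      (mul_mem (algebraMap_mem_regAtZero p) (regAtZero_inv_mem hq))
  · rw [h, zpow_add₀ uniformizer_ne_zero, zpow_natCast, zpow_natCast]
    ring

variable {K : Type*} [Field K] [Algebra F K] [Algebra k K] [IsScalarTower k F K]
variable [FiniteDimensional F K]

local notation "U" => algebraMap F K u

lemma exists_uniformizer_pow_mul_mem (z : K) :
    ∃ M : ℕ, U ^ M * z ∈ integralClosure (regAtZero k F) K := by
  have : IsAlgebraic (regAtZero k F) z :=
    (IsFractionRing.isAlgebraic_iff (regAtZero k F) F K).2 (Algebra.IsAlgebraic.isAlgebraic z)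
  obtain ⟨y, hy, hi⟩ := this.exists_integral_multiple
  obtain ⟨n, e, he⟩ := exists_associated hy
  refine ⟨n, ?_⟩
  have h1 : IsIntegral (regAtZero k F) ((↑e⁻¹ : regAtZero k F) • (y • z)) := hi.smul _
  rw [← he, smul_smul] at h1
  have h2 : (↑e⁻¹ : regAtZero k F) * (unif k F ^ n * ↑e) = unif k F ^ n := by
    rw [mul_comm, mul_assoc, Units.mul_inv, mul_one]
  rw [h2, Algebra.smul_def, map_pow] at h1
  exact h1

lemma uniformizer_mem : U ∈ integralClosure (regAtZero k F) K :=
  (integralClosure (regAtZero k F) K).algebraMap_mem (unif k F)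

lemma uniformizer_ne_zero' : U ≠ 0 := by
  rw [Ne, map_eq_zero]; exact uniformizer_ne_zero

end
end Razar

namespace Razar
set_option autoImplicit false
set_option linter.unusedSectionVars false
open Polynomial

section
variable {k F K : Type*} [Field k] [Field F] [Algebra k[X] F] [IsFractionRing k[X] F]
  [Algebra k F] [IsScalarTower k k[X] F] [Field K] [Algebra F K] [Algebra k K] [IsScalarTower k F K]
  [FiniteDimensional F K]
local notation "u" => algebraMap k[X] F Polynomial.X
local notation "U" => algebraMap F K u

lemma exists_laurent_eq_of_coeff {f : LaurentSeries k} (N : ℕ)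
    (hN : ∀ m : ℤ, m < -N → f.coeff m = 0) (hf : ∀ m : ℤ, 0 < m → f.coeff m = 0) :
    ∃ p : k[X], f = laurent k F (aeval (u)⁻¹ p) := by
  refine ⟨∑ i ∈ Finset.range (N + 1), Polynomial.C (f.coeff (-i)) * Polynomial.X ^ i, ?_⟩
  rw [map_sum, map_sum]
  have h (i : ℕ) : laurent k F (aeval (u)⁻¹ (Polynomial.C (f.coeff (-i)) * Polynomial.X ^ i)) =
      HahnSeries.single (-i : ℤ) (f.coeff (-i)) := by
    have hC : aeval (u)⁻¹ (Polynomial.C (f.coeff (-i))) =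
        algebraMap k[X] F (Polynomial.C (f.coeff (-i))) := by
      rw [Polynomial.aeval_C, IsScalarTower.algebraMap_apply k k[X] F]; rfl
    rw [map_mul, hC, map_pow, Polynomial.aeval_X, map_mul, laurent_algebraMap, polyLaurent_C, ← zpow_natCast,
      ← zpow_neg_one, ← zpow_mul, laurent_u_zpow]
    ext m
    simp [HahnSeries.coeff_single]
  simp_rw [h]
  ext m
  rw [HahnSeries.coeff_sum]
  simp only [HahnSeries.coeff_single]
  by_cases hm : m < -N
  · rw [hN m hm, Finset.sum_eq_zero]
    intro i hi
    rw [Finset.mem_range] at hi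
    exact if_neg (by omega)
  by_cases hm' : 0 < m
  · rw [hf m hm', Finset.sum_eq_zero]
    intro i hi
    exact if_neg (by omega)
  rw [Finset.sum_eq_single (-m).toNat]
  · rw [if_pos (by omega)]; congr; omega
  · intro i hi hne
    exact if_neg (by omega)
  · intro hi
    rw [Finset.mem_range] at hi; omega

/-- If `S` contains the maximal order at infinity and a lattice spanned by powers of a primitive
element over the polynomials in `u⁻¹`, but `S` is not everything, there is a nonzero linear
functional which is polynomial on the lattice and small at infinity. -/
lemma exists_functional (pb : PowerBasis F K) {S : Submodule k K} (hS : S < ⊤)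
    (hA : ∀ i j : ℕ, U⁻¹ ^ i * pb.gen ^ j ∈ S)
    (hO : ∀ z ∈ integralClosure (regAtZero k F) K, z ∈ S) :
    ∃ Λ : K →ₗ[F] F, Λ ≠ 0 ∧ (∀ i : Fin pb.dim, ∃ p : k[X], Λ (pb.gen ^ (i : ℕ)) = aeval (u)⁻¹ p) ∧
      ∀ z ∈ integralClosure (regAtZero k F) K, ∃ f ∈ regAtZero k F, Λ z = u ^ 2 * f := by
  obtain ⟨φ, hφ0, hφ⟩ := S.exists_le_ker_of_lt_top hS
  replace hφ : ∀ z ∈ S, φ z = 0 := fun z hz => hφ hz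
  have hU0 : U ≠ 0 := uniformizer_ne_zero'
  have hbdd (z : K) : BddBelow (Function.support fun m : ℤ => φ (U ^ (1 - m) * z)) := by
    obtain ⟨M, hM⟩ := exists_uniformizer_pow_mul_mem (k := k) (F := F) z
    refine ⟨1 - M, fun m hm => ?_⟩
    by_contra! hlt
    apply hm
    apply hφ
    apply hO
    obtain ⟨j, hj⟩ : ∃ j : ℕ, 1 - m = j + M := ⟨(1 - m - M).toNat, by omega⟩
    rw [hj, zpow_add₀ hU0, zpow_natCast, zpow_natCast, mul_assoc]
    exact mul_mem (pow_mem uniformizer_mem _) hM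
  let ψ : K →+ LaurentSeries k :=
    { toFun := fun z => HahnSeries.ofSuppBddBelow _ (hbdd z)
      map_zero' := by ext m; simp
      map_add' := fun a b => by ext m; simp [mul_add] }
  have hψ (z : K) (m : ℤ) : (ψ z).coeff m = φ (U ^ (1 - m) * z) := rfl
  have hψu (z : K) : ψ (U * z) = HahnSeries.single 1 1 * ψ z := by
    ext m
    rw [hψ, HahnSeries.coeff_single_mul, one_mul, hψ, ← mul_assoc, ← zpow_add_one₀ hU0]
    congr 3
    ring
  have hψp (p : k[X]) : ∀ z : K, ψ (algebraMap F K (algebraMap k[X] F p) * z) =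
      polyLaurent k p * ψ z := by
    induction p using Polynomial.induction_on with
    | C a =>
      intro z
      ext m
      have : algebraMap F K (algebraMap k[X] F (Polynomial.C a)) = algebraMap k K a := by
        rw [IsScalarTower.algebraMap_apply k F K, IsScalarTower.algebraMap_apply k k[X] F]; rfl
      rw [this, ← Algebra.smul_def, polyLaurent_C, HahnSeries.C_mul_eq_smul, HahnSeries.coeff_smul,
        hψ, hψ, mul_smul_comm, map_smul]
    | add p q hp hq => intro z; rw [map_add, map_add, map_add, add_mul, add_mul, map_add, hp, hq]
    | monomial n a h =>
      intro z
      rw [pow_succ, ← mul_assoc, map_mul (algebraMap k[X] F), map_mul (algebraMap F K), mul_assoc, h, hψu,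
        map_mul (polyLaurent k) _ Polynomial.X, polyLaurent_X, mul_assoc]
  have hψF (f : F) (z : K) : ψ (f • z) = laurent k F f * ψ z := by
    obtain ⟨a, b, hb, rfl⟩ := IsFractionRing.div_surjective (A := k[X]) f
    have hb0 : algebraMap k[X] F b ≠ 0 := by
      rw [Ne, IsFractionRing.to_map_eq_zero_iff]; exact nonZeroDivisors.ne_zero hb
    have h1 : laurent k F (algebraMap k[X] F b) ≠ 0 := by rwa [Ne, map_eq_zero]
    apply mul_left_cancel₀ h1
    rw [← mul_assoc, ← map_mul (laurent k F), mul_div_cancel₀ _ hb0, laurent_algebraMap, ← hψp,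
      laurent_algebraMap, ← hψp, Algebra.smul_def, ← mul_assoc, ← map_mul (algebraMap F K), mul_div_cancel₀ _ hb0]
  have hpoly (j : ℕ) : ∃ p : k[X], ψ (pb.gen ^ j) = laurent k F (aeval (u)⁻¹ p) := by
    obtain ⟨N, hN⟩ := hbdd (pb.gen ^ j)
    refine exists_laurent_eq_of_coeff N.natAbs (fun m hm => ?_) (fun m hm => ?_)
    · by_contra h
      have := hN (show m ∈ Function.support _ from h)
      omega
    · rw [hψ]
      apply hφ
      obtain ⟨i, rfl⟩ : ∃ i : ℕ, m = 1 + i := ⟨(m - 1).toNat, by omega⟩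
      rw [show (1 : ℤ) - (1 + i) = -i by ring, zpow_neg, zpow_natCast, ← inv_pow]
      exact hA i j
  choose g hg using hpoly
  let Λ : K →ₗ[F] F := pb.basis.constr F fun i => aeval (u)⁻¹ (g i)
  have hΛ (i : Fin pb.dim) : Λ (pb.gen ^ (i : ℕ)) = aeval (u)⁻¹ (g i) := by
    rw [← pb.basis_eq_pow, Module.Basis.constr_basis]
  have hΛψ (z : K) : laurent k F (Λ z) = ψ z := by
    rw [← pb.basis.sum_repr z, map_sum, map_sum, map_sum]
    refine Finset.sum_congr rfl fun i _ => ?_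
    rw [map_smul, hψF, smul_eq_mul, map_mul, pb.basis_eq_pow, hΛ, hg]
  refine ⟨Λ, ?_, fun i => ⟨_, hΛ i⟩, fun z hz => ?_⟩
  · rintro h
    apply hφ0
    ext z
    have := hψ z 1
    rw [← hΛψ, h] at this
    simpa using this.symm
  · apply exists_eq_mul_of_coeff_laurent
    intro m hm
    rw [hΛψ, hψ]
    apply hφ
    apply hO
    obtain ⟨j, hj⟩ : ∃ j : ℕ, 1 - m = j := ⟨(1 - m).toNat, by push_cast at hm; omega⟩
    rw [hj, zpow_natCast]
    exact mul_mem (pow_mem uniformizer_mem _) hz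

end
end Razar

namespace Razar
set_option autoImplicit false
set_option linter.unusedSectionVars false
open Polynomial

section Newton
variable {k F K : Type*} [Field k] [CharZero k] [Field F] [Algebra k F] [Field K] [Algebra F K]
  [FiniteDimensional F K] [Algebra.IsSeparable F K]

/-- If the traces of all powers of `w` are divisible by `u`, then so are the lower coefficients of
a monic relation for `w` of degree `[K : F]`. -/
lemma exists_pow_finrank_eq (S : Subalgebra k F) {u : F} (hu : u ∈ S) {w : K}
    (hw : ∀ i : ℕ, 0 < i → ∃ f ∈ S, Algebra.trace F K (w ^ i) = u * f) :
    ∃ c : ℕ → F, (∀ j, c j ∈ S) ∧ w ^ Module.finrank F K =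
      algebraMap F K u * ∑ j ∈ Finset.range (Module.finrank F K), algebraMap F K (c j) * w ^ j := by
  classical
  have aux {L : Type _} [Field L] {j : L} (hj : j ≠ 0) (a b c : L) :
      a * (b * c) = j * (b * (j⁻¹ * (a * c))) := by field_simp
  set n := Module.finrank F K with hn
  let E := AlgebraicClosure F
  let v : (K →ₐ[F] E) → E := fun σ => σ w
  let e : ℕ → E := fun j => MvPolynomial.aeval v (MvPolynomial.esymm (K →ₐ[F] E) F j)
  have hp (i : ℕ) : MvPolynomial.aeval v (MvPolynomial.psum (K →ₐ[F] E) F i) =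
      algebraMap F E (Algebra.trace F K (w ^ i)) := by
    rw [trace_eq_sum_embeddings (E := E), MvPolynomial.psum, map_sum]
    simp [v]
  have key (j : ℕ) : (∃ f ∈ S, e j = algebraMap F E f) ∧
      (0 < j → ∃ f ∈ S, e j = algebraMap F E (u * f)) := by
    induction j using Nat.strong_induction_on with
    | _ j ih =>
      rcases Nat.eq_zero_or_pos j with rfl | hj
      · refine ⟨⟨1, one_mem _, by simp [e]⟩, by simp⟩
      suffices h : ∃ f ∈ S, e j = algebraMap F E (u * f) by
        obtain ⟨f, hf, h⟩ := h
        exact ⟨⟨u * f, mul_mem hu hf, h⟩, fun _ => ⟨f, hf, h⟩⟩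
      have h1 := congrArg (MvPolynomial.aeval v) (MvPolynomial.mul_esymm_eq_sum (K →ₐ[F] E) F j)
      have h2 (a : ℕ × ℕ) : ∃ f ∈ S, a ∈ (Finset.HasAntidiagonal.antidiagonal j).filter (fun a => a.1 < j) →
          MvPolynomial.aeval v ((-1) ^ a.1 * MvPolynomial.esymm (K →ₐ[F] E) F a.1 *
            MvPolynomial.psum (K →ₐ[F] E) F a.2) = algebraMap F E (u * f) := by
        by_cases ha : a ∈ (Finset.HasAntidiagonal.antidiagonal j).filter (fun a => a.1 < j)
        swap
        · exact ⟨0, zero_mem _, fun h => absurd h ha⟩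
        rw [Finset.mem_filter, Finset.HasAntidiagonal.mem_antidiagonal] at ha
        obtain ⟨⟨f, hf, hfe⟩, -⟩ := ih a.1 ha.2
        obtain ⟨g, hg, hge⟩ := hw a.2 (by omega)
        refine ⟨(-1) ^ a.1 * f * g, mul_mem (mul_mem (pow_mem (neg_mem (one_mem _)) _) hf) hg,
          fun _ => ?_⟩
        rw [map_mul, map_mul, hp, hge, show MvPolynomial.aeval v (MvPolynomial.esymm _ F a.1) = _
          from hfe]
        simp only [map_mul, map_pow, map_neg, map_one]
        ring
      choose f hf hfe using h2
      rw [map_mul, map_natCast, map_mul, map_sum, Finset.sum_congr rfl (fun a ha => hfe a ha),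
        ← map_sum, ← Finset.mul_sum] at h1
      have hj0 : (j : k) ≠ 0 := by exact_mod_cast hj.ne'
      refine ⟨algebraMap k F (j : k)⁻¹ * ((-1) ^ (j + 1) *
        ∑ a ∈ (Finset.HasAntidiagonal.antidiagonal j).filter (fun a => a.1 < j), f a),
        mul_mem (S.algebraMap_mem _) (mul_mem (pow_mem (neg_mem (one_mem _)) _)
          (sum_mem fun a _ => hf a)), ?_⟩
      have : CharZero F := charZero_of_injective_algebraMap (algebraMap k F).injective
      have : CharZero E := charZero_of_injective_algebraMap (algebraMap F E).injective
      have hj1 : (j : E) ≠ 0 := by exact_mod_cast hj.ne'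
      apply mul_left_cancel₀ hj1
      change (j : E) * e j = _ at h1
      rw [h1]
      simp only [map_mul, map_pow, map_neg, map_one, map_inv₀, map_natCast]
      exact aux hj1 _ _ _
  choose f hf hfe using fun j => (key j).1
  choose g hg hge using fun j : ℕ => (key (j + 1)).2 j.succ_pos
  have hcard : Multiset.card (Finset.univ.val.map v) = n := by
    rw [Multiset.card_map]
    change Fintype.card (K →ₐ[F] E) = n
    rw [hn]
    exact AlgHom.card F K E
  obtain ⟨σ⟩ : Nonempty (K →ₐ[F] E) := ⟨IsAlgClosed.lift⟩
  have h := Multiset.prod_X_sub_X_eq_sum_esymm (Finset.univ.val.map v)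
  apply_fun Polynomial.eval (σ w) at h
  rw [Polynomial.eval_multiset_prod, Multiset.prod_eq_zero, hcard, Polynomial.eval_finsetSum,
    Finset.sum_range_succ'] at h
  swap
  · simp only [Multiset.map_map, Multiset.mem_map]
    exact ⟨σ, by simp, by simp [v]⟩
  have hes (j : ℕ) : (Finset.univ.val.map v).esymm j = e j :=
    (MvPolynomial.aeval_esymm_eq_multiset_esymm _ _ _ _).symm
  simp only [Polynomial.eval_mul, Polynomial.eval_pow, Polynomial.eval_neg, Polynomial.eval_one,
    Polynomial.eval_C, Polynomial.eval_X, hes, hge] at h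
  refine ⟨fun j => (-1) ^ (n - 1 - j) * g (n - 1 - j),
    fun j => mul_mem (pow_mem (neg_mem (one_mem _)) _) (hg _), ?_⟩
  apply (show Function.Injective σ from σ.toRingHom.injective)
  rw [map_mul, map_sum, ← Finset.sum_range_reflect, Finset.mul_sum]
  have h0 : e 0 = 1 := by simp [e]
  rw [h0, pow_zero, one_mul, one_mul, Nat.sub_zero, add_comm] at h
  rw [map_pow, eq_neg_of_add_eq_zero_left h.symm, ← Finset.sum_neg_distrib]
  refine Finset.sum_congr rfl fun j hj => ?_
  rw [Finset.mem_range] at hj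
  beta_reduce
  rw [show n - 1 - (n - 1 - j) = j by omega, show n - (j + 1) = n - 1 - j by omega]
  simp only [map_mul, map_pow, AlgHom.commutes, map_neg, map_one]
  ring

end Newton
end Razar

namespace Razar
set_option autoImplicit false
set_option linter.unusedSectionVars false
open Polynomial

section Dedekind
open scoped nonZeroDivisors

lemma exists_add_mul_eq_one {R K : Type*} [CommRing R] [IsDedekindDomain R] [Field K] [Algebra R K]
    [IsFractionRing R K] (h : K) : ∃ a b c d : R, algebraMap R K c = h * algebraMap R K a ∧
      algebraMap R K d = h * algebraMap R K b ∧ a + d = 1 := by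
  let I : FractionalIdeal R⁰ K := 1 + FractionalIdeal.spanSingleton R⁰ h
  have h1 : (1 : K) ∈ I := (le_sup_left : (1 : FractionalIdeal R⁰ K) ≤ 1 ⊔ _)
    (FractionalIdeal.one_mem_one R⁰)
  have hh : h ∈ I := (le_sup_right : FractionalIdeal.spanSingleton R⁰ h ≤ 1 ⊔ _)
    (FractionalIdeal.mem_spanSingleton_self R⁰ h)
  have hI : I ≠ 0 := by
    intro h0
    rw [h0, FractionalIdeal.mem_zero_iff] at h1
    exact one_ne_zero h1
  have hmul : (1 : K) ∈ I * I⁻¹ := by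
    rw [mul_inv_cancel₀ hI]; exact FractionalIdeal.one_mem_one R⁰
  rw [show I * I⁻¹ = I⁻¹ + FractionalIdeal.spanSingleton R⁰ h * I⁻¹ by
    change (1 + _) * _ = _; rw [add_mul, one_mul], ← FractionalIdeal.mem_coe,
    FractionalIdeal.coe_add, Submodule.add_eq_sup, Submodule.mem_sup] at hmul
  obtain ⟨z, hz, w, hw, hzw⟩ := hmul
  rw [FractionalIdeal.mem_coe] at hz hw
  rw [FractionalIdeal.mem_singleton_mul] at hw
  obtain ⟨t, ht, rfl⟩ := hw
  rw [FractionalIdeal.mem_inv_iff hI] at hz ht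
  obtain ⟨a, ha⟩ := (FractionalIdeal.mem_one_iff R⁰).1 (hz 1 h1)
  obtain ⟨b, hb⟩ := (FractionalIdeal.mem_one_iff R⁰).1 (ht 1 h1)
  obtain ⟨c, hc⟩ := (FractionalIdeal.mem_one_iff R⁰).1 (hz h hh)
  obtain ⟨d, hd⟩ := (FractionalIdeal.mem_one_iff R⁰).1 (ht h hh)
  rw [mul_one] at ha hb
  refine ⟨a, b, c, d, by rw [hc, ha, mul_comm], by rw [hd, hb, mul_comm], ?_⟩
  apply IsFractionRing.injective R K
  rw [map_add, ha, hd, map_one, ← hzw, mul_comm]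

end Dedekind

section
variable {k F K : Type*} [Field k] [CharZero k] [Field F] [Algebra k[X] F] [IsFractionRing k[X] F]
  [Algebra k F] [IsScalarTower k k[X] F] [Field K] [Algebra F K] [Algebra k K] [IsScalarTower k F K]
  [FiniteDimensional F K] [Algebra.IsSeparable F K]
local notation "u" => algebraMap k[X] F Polynomial.X
local notation "U" => algebraMap F K u
local notation "𝒪" => integralClosure (regAtZero k F) K

instance : IsDedekindDomain 𝒪 := integralClosure.isDedekindDomain (regAtZero k F) F K
instance : IsFractionRing 𝒪 K := integralClosure.isFractionRing_of_finite_extension F K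
instance : Module.Finite (regAtZero k F) 𝒪 := IsIntegralClosure.finite (regAtZero k F) F K 𝒪

/-- Elements of the maximal ideals of the order at infinity contain the uniformizer. -/
lemma uniformizer_mem_of_isMaximal (M : Ideal 𝒪) [M.IsMaximal] :
    (⟨U, uniformizer_mem⟩ : 𝒪) ∈ M := by
  have h := Ideal.isMaximal_comap_of_isIntegral_of_isMaximal (R := regAtZero k F) M
  have h2 := IsLocalRing.eq_maximalIdeal h
  have : unif k F ∈ IsLocalRing.maximalIdeal (regAtZero k F) := not_isUnit_unif
  rw [← h2, Ideal.mem_comap] at this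
  exact this

lemma mem_of_trace {h : K}
    (ht : ∀ z ∈ 𝒪, ∃ f ∈ regAtZero k F, Algebra.trace F K (h * z) = u * f) :
    h ∈ 𝒪 ∧ ∃ w ∈ 𝒪, h ^ Module.finrank F K = U * w := by
  have hpow : ∀ w : K, w ∈ 𝒪 → (∃ b ∈ 𝒪, w = h * b) →
      ∃ v ∈ 𝒪, w ^ Module.finrank F K = U * v := by
    rintro w hw ⟨b, hb, rfl⟩
    obtain ⟨c, hc, hce⟩ := exists_pow_finrank_eq (regAtZero k F) (algebraMap_mem_regAtZero Polynomial.X)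
      (w := h * b) (fun i hi => by
        obtain ⟨j, rfl⟩ := Nat.exists_eq_add_of_lt hi
        rw [zero_add, pow_succ', mul_assoc]
        exact ht _ (mul_mem hb (pow_mem hw _)))
    refine ⟨_, sum_mem fun j _ => mul_mem ?_ (pow_mem hw _), hce⟩
    exact (𝒪).algebraMap_mem ⟨c j, hc j⟩
  obtain ⟨a, b, c, d, hc, hd, hsum⟩ := exists_add_mul_eq_one (R := 𝒪) h
  have ha : IsUnit a := by
    by_contra hna
    obtain ⟨M, hM, haM⟩ := exists_max_ideal_of_mem_nonunits hna
    obtain ⟨v, hv, hve⟩ := hpow d d.2 ⟨b, b.2, hd⟩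
    have h1 : d ^ Module.finrank F K ∈ M := by
      have : d ^ Module.finrank F K = ⟨U, uniformizer_mem⟩ * ⟨v, hv⟩ := Subtype.ext hve
      rw [this]
      exact M.mul_mem_right _ (uniformizer_mem_of_isMaximal M)
    have h2 := hM.isPrime.mem_of_pow_mem _ h1
    exact hM.ne_top ((Ideal.eq_top_iff_one M).2 (hsum ▸ M.add_mem haM h2))
  have hh : h ∈ 𝒪 := by
    obtain ⟨a, rfl⟩ := ha
    have h3 : h = algebraMap 𝒪 K (c * ↑a⁻¹) := by
      rw [map_mul, hc, mul_assoc, ← map_mul, Units.mul_inv, map_one, mul_one]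
    rw [h3]
    exact (c * ↑a⁻¹ : 𝒪).2
  exact ⟨hh, hpow h hh ⟨1, one_mem _, by rw [mul_one]⟩⟩

lemma coeff_minpolyDiv_mem {A : Subring K} {y : K} (hy : y ∈ A)
    (hA : ∀ i, algebraMap F K ((minpoly F y).coeff i) ∈ A) (i : ℕ) :
    (minpolyDiv F y).coeff i ∈ A := by
  have h (j : ℕ) : ∀ i, (minpolyDiv F y).natDegree < i + j → (minpolyDiv F y).coeff i ∈ A := by
    induction j with
    | zero => intro i hi; rw [Polynomial.coeff_eq_zero_of_natDegree_lt (show _ < i from hi)]; exact zero_mem _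
    | succ j ih =>
      intro i hi
      rw [coeff_minpolyDiv]
      exact add_mem (hA _) (mul_mem (ih _ (by omega)) hy)
  exact h ((minpolyDiv F y).natDegree + 1) i (by omega)

/-- If an affine ring `A` and the order at infinity do not span `K` then there is a differential of
the first kind. -/
lemma exists_differential (pb : PowerBasis F K) {A : Subalgebra k K} (hx : U⁻¹ ∈ A)
    (hy : pb.gen ∈ A) (hmin : ∀ i, algebraMap F K ((minpoly F pb.gen).coeff i) ∈ A)
    (hne : ¬ ∀ z : K, ∃ a ∈ A, ∃ b ∈ 𝒪, z = a + b) :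
    ∃ g ∈ A, g ≠ 0 ∧
      (∃ w ∈ 𝒪, (U⁻¹ * g / aeval pb.gen (derivative (minpoly F pb.gen))) ^ Module.finrank F K =
        U * w) := by
  let f' := aeval pb.gen (derivative (minpoly F pb.gen))
  have hf' : f' ≠ 0 :=
    (Algebra.IsSeparable.isSeparable F pb.gen).aeval_derivative_ne_zero (minpoly.aeval _ _)
  let S : Submodule k K := Subalgebra.toSubmodule A ⊔
    Subalgebra.toSubmodule ((𝒪).restrictScalars k)
  have hS : S < ⊤ := by
    rw [lt_top_iff_ne_top]
    intro h
    apply hne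
    intro z
    have : z ∈ S := h ▸ Submodule.mem_top
    obtain ⟨a, ha, b, hb, h⟩ := Submodule.mem_sup.1 this
    exact ⟨a, ha, b, hb, h.symm⟩
  obtain ⟨Λ, hΛ, hp, hO⟩ := exists_functional pb hS
    (fun i j => Submodule.mem_sup_left (show _ ∈ A from mul_mem (pow_mem hx i) (pow_mem hy j)))
    (fun z hz => Submodule.mem_sup_right hz)
  choose p hp using hp
  let g' : K := ∑ i, algebraMap F K (aeval (u)⁻¹ (p i)) * pb.basis.traceDual i
  have hΛg (z : K) : Λ z = Algebra.trace F K (g' * z) := by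
    have : Λ = (Algebra.traceForm F K g') := by
      refine pb.basis.ext fun j => ?_
      rw [Algebra.traceForm_apply, pb.basis_eq_pow, hp, ← pb.basis_eq_pow, Finset.sum_mul, map_sum]
      simp_rw [mul_assoc, ← Algebra.smul_def, map_smul, Module.Basis.trace_traceDual_mul]
      simp
    rw [this, Algebra.traceForm_apply]
  have hg'0 : g' ≠ 0 := by
    rintro h
    apply hΛ
    ext z
    rw [hΛg, h]; simp
  refine ⟨f' * g', ?_, mul_ne_zero hf' hg'0, ?_⟩
  · rw [Finset.mul_sum]
    refine sum_mem fun i _ => ?_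
    rw [Module.Basis.traceDual_powerBasis_eq, mul_div_assoc', mul_div_cancel₀ _ hf']
    refine mul_mem ?_ (coeff_minpolyDiv_mem (A := A.toSubring) hy hmin i)
    have : algebraMap F K (aeval (u)⁻¹ (p i)) = aeval (U)⁻¹ (p i) := by
      rw [← map_inv₀ (algebraMap F K), Polynomial.aeval_algebraMap_apply]
    rw [this]
    exact Algebra.adjoin_le (Set.singleton_subset_iff.2 hx) (Polynomial.aeval_mem_adjoin_singleton k _)
  · have := (mem_of_trace (k := k) (F := F) (h := U⁻¹ * g') fun z hz => ?_).2
    · rwa [← mul_assoc, mul_comm (U⁻¹) f', mul_assoc, mul_div_cancel_left₀ _ hf']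
    · obtain ⟨f, hf, h⟩ := hO z hz
      refine ⟨f, hf, ?_⟩
      rw [← map_inv₀ (algebraMap F K), mul_assoc, ← Algebra.smul_def, map_smul, ← hΛg, h, smul_eq_mul]
      have := uniformizer_ne_zero (k := k) (F := F)
      field_simp

end
end Razar

namespace Razar
set_option autoImplicit false
set_option linter.unusedSectionVars false
open Polynomial

section Length
variable (k : Type*) {O : Type*} [Field k] [CommRing O] [IsDomain O] [Algebra k O]

/-- The codimension over the base field of a principal ideal. -/
noncomputable def codim (s : O) : ℕ∞ := Module.length k (O ⧸ Ideal.span {s})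

open scoped Pointwise in
lemma codim_mul (s : O) {t : O} (ht : t ≠ 0) : codim k (s * t) = codim k s + codim k t := by
  have := Module.length_eq_add_of_exact ((Ideal.mulQuot t (Ideal.span {s})).restrictScalars k)
    ((Ideal.quotOfMul t (Ideal.span {s})).restrictScalars k)
    (Ideal.mulQuot_injective (Ideal.span {s}) (mem_nonZeroDivisors_of_ne_zero ht))
    (Ideal.quotOfMul_surjective (Ideal.span {s}))
    (Ideal.exact_mulQuot_quotOfMul (Ideal.span {s}))
  have h2 : t • Ideal.span {s} = Ideal.span {s * t} := by
    rw [← Submodule.singleton_set_smul]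
    simp [← Ideal.submodule_span_eq, Submodule.set_smul_span, mul_comm]
  rw [h2] at this
  exact this

lemma codim_one : codim k (1 : O) = 0 := by
  rw [codim, Module.length_eq_zero_iff, Ideal.span_singleton_one]
  infer_instance

lemma codim_pow {s : O} (hs : s ≠ 0) (n : ℕ) : codim k (s ^ n) = n * codim k s := by
  induction n with
  | zero => simp [codim_one]
  | succ n ih => rw [pow_succ, codim_mul k _ hs, ih]; push_cast; ring

lemma codim_ne_zero {s : O} (hs : ¬ IsUnit s) : codim k s ≠ 0 := by
  rw [codim, Ne, Module.length_eq_zero_iff, Ideal.Quotient.subsingleton_iff,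
    Ideal.span_singleton_eq_top]
  exact hs

lemma codim_le_of_dvd {s t : O} (h : s ∣ t) : codim k s ≤ codim k t := by
  have hle : Ideal.span {t} ≤ Ideal.span {s} := Ideal.span_singleton_le_span_singleton.2 h
  exact Module.length_le_of_surjective (Ideal.Quotient.factorₐ k hle).toLinearMap
    (Ideal.Quotient.factor_surjective hle)

end Length

section Local
variable {k K : Type*} [Field k] [Field K] [Algebra k K] {A O : Subalgebra k K}

lemma exists_mem_of_codim_le (hsum : ∀ z : K, ∃ a ∈ A, ∃ b ∈ O, z = a + b) {p q : O}
    (hq : q ≠ 0) (hpq : codim k p ≤ codim k q) (hfin : codim k q ≠ ⊤) :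
    ∃ f ∈ A, f ≠ 0 ∧ ∃ c : O, (q : K) * f = p * c := by
  have hq' : (q : K) ≠ 0 := by simpa using hq
  let V : Submodule k K := Subalgebra.toSubmodule A ⊓
    (Subalgebra.toSubmodule O).comap (LinearMap.mulLeft k (q : K))
  let m : V →ₗ[k] O :=
    { toFun := fun f => ⟨q * f, f.2.2⟩
      map_add' := fun f g => by ext; simp [mul_add]
      map_smul' := fun c f => by ext; simp }
  let α : V →ₗ[k] O ⧸ Ideal.span {q} := (Ideal.Quotient.mkₐ k (Ideal.span {q})).toLinearMap ∘ₗ m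
  let β : V →ₗ[k] O ⧸ Ideal.span {p} := (Ideal.Quotient.mkₐ k (Ideal.span {p})).toLinearMap ∘ₗ m
  have hα : Function.Surjective α := by
    intro z
    obtain ⟨z, rfl⟩ := Ideal.Quotient.mk_surjective z
    obtain ⟨a, ha, b, hb, h⟩ := hsum ((z : K) / q)
    have h2 : (q : K) * a = z - q * b := by
      rw [div_eq_iff hq'] at h; rw [h]; ring
    refine ⟨⟨a, ha, ?_⟩, ?_⟩
    · change (q : K) * a ∈ O
      rw [h2]
      exact sub_mem z.2 (mul_mem q.2 hb)
    · change Ideal.Quotient.mk _ _ = Ideal.Quotient.mk _ _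
      rw [Ideal.Quotient.eq, Ideal.mem_span_singleton]
      refine ⟨⟨-b, neg_mem hb⟩, ?_⟩
      ext
      change (q : K) * a - z = q * -b
      rw [h2]; ring
  have h1 : (1 : K) ∈ V := ⟨one_mem A, by
    change (q : K) * 1 ∈ O
    rw [mul_one]; exact q.2⟩
  have hk : Nontrivial (LinearMap.ker α) := by
    refine ⟨⟨0, ⟨⟨1, h1⟩, ?_⟩, ?_⟩⟩
    · change Ideal.Quotient.mk _ _ = 0
      rw [Ideal.Quotient.eq_zero_iff_mem, Ideal.mem_span_singleton]
      refine ⟨1, ?_⟩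
      ext
      simp [m]
    · intro h
      have h' : (0 : K) = 1 := congrArg (fun x : LinearMap.ker α => ((x : V) : K)) h
      exact zero_ne_one h'
  have hlen : Module.length k V = Module.length k (LinearMap.ker α) + codim k q :=
    Module.length_eq_add_of_exact (LinearMap.ker α).subtype α (Submodule.injective_subtype _) hα
      (LinearMap.exact_subtype_ker_map α)
  have hninj : ¬ Function.Injective β := by
    intro hinj
    have h2 : Module.length k V ≤ codim k p := Module.length_le_of_injective β hinj
    have h3 : 1 ≤ Module.length k (LinearMap.ker α) := Order.one_le_iff_pos.2 Module.length_pos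
    have h4 : 1 + codim k q ≤ codim k q :=
      calc 1 + codim k q ≤ _ := add_le_add_left h3 _
        _ = _ := hlen.symm
        _ ≤ _ := h2.trans hpq
    lift codim k q to ℕ using hfin with e
    norm_cast at h4
    omega
  rw [← LinearMap.ker_eq_bot, Submodule.eq_bot_iff] at hninj
  push Not at hninj
  obtain ⟨f, hf, hf0⟩ := hninj
  refine ⟨f, f.2.1, by simpa using hf0, ?_⟩
  change Ideal.Quotient.mk _ _ = 0 at hf
  rw [Ideal.Quotient.eq_zero_iff_mem, Ideal.mem_span_singleton] at hf
  obtain ⟨c, hc⟩ := hf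
  exact ⟨c, congrArg Subtype.val hc⟩

lemma isUnit_or_isUnit_one_sub (hsum : ∀ z : K, ∃ a ∈ A, ∃ b ∈ O, z = a + b)
    (hinter : ∀ a ∈ A, a ∈ O → ∃ c : k, a = algebraMap k K c)
    (hunit : ∀ a ∈ A, a⁻¹ ∈ A → ∃ c : k, a = algebraMap k K c)
    (hfin : ∀ s : O, s ≠ 0 → codim k s ≠ ⊤) (s : O) : IsUnit s ∨ IsUnit (1 - s) := by
  by_contra! hn
  obtain ⟨hs, ht⟩ := hn
  set t := 1 - s with hts
  have hs0 : s ≠ 0 := by rintro rfl; simp [hts] at ht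
  have ht0 : t ≠ 0 := by
    intro h
    have h1 : s = 1 := (sub_eq_zero.1 h).symm
    exact hs (h1 ▸ isUnit_one)
  obtain ⟨a, ha⟩ := ENat.ne_top_iff_exists.1 (hfin s hs0)
  obtain ⟨b, hb⟩ := ENat.ne_top_iff_exists.1 (hfin t ht0)
  have ha0 : a ≠ 0 := by rintro rfl; exact codim_ne_zero k hs ha.symm
  have hb0 : b ≠ 0 := by rintro rfl; exact codim_ne_zero k ht hb.symm
  have hcop : IsCoprime (s ^ b) (t ^ a) := IsCoprime.pow ⟨1, 1, by rw [hts]; ring⟩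
  have hp0 : s ^ b ≠ 0 := pow_ne_zero _ hs0
  have hq0 : t ^ a ≠ 0 := pow_ne_zero _ ht0
  have hpq : codim k (s ^ b) = codim k (t ^ a) := by
    rw [codim_pow k hs0, codim_pow k ht0, ← ha, ← hb, mul_comm]
  obtain ⟨f, hf, hf0, c, hc⟩ := exists_mem_of_codim_le hsum hq0 hpq.le (hfin _ hq0)
  obtain ⟨g, hg, hg0, d, hd⟩ := exists_mem_of_codim_le hsum hp0 hpq.ge (hfin _ hp0)
  have hp0' : ((s ^ b : O) : K) ≠ 0 := fun h => hp0 (Subtype.ext h)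
  have hq0' : ((t ^ a : O) : K) ≠ 0 := fun h => hq0 (Subtype.ext h)
  have hfg : f * g = c * d := by
    apply mul_left_cancel₀ (mul_ne_zero hp0' hq0')
    linear_combination ((s ^ b : O) : K) * g * hc + ((s ^ b : O) : K) * c * hd
  obtain ⟨e, he⟩ := hinter (f * g) (mul_mem hf hg) (hfg ▸ mul_mem c.2 d.2)
  have he0 : algebraMap k K e ≠ 0 := he ▸ mul_ne_zero hf0 hg0
  have hfinv : f⁻¹ ∈ A := by
    have h1 : f⁻¹ = g * algebraMap k K e⁻¹ := by
      rw [map_inv₀, eq_mul_inv_iff_mul_eq₀ he0, ← he]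
      field_simp
    rw [h1]
    exact mul_mem hg (A.algebraMap_mem _)
  obtain ⟨r, rfl⟩ := hunit f hf hfinv
  have hdvd : s ^ b ∣ t ^ a := by
    refine ⟨c * algebraMap k O r⁻¹, Subtype.ext ?_⟩
    change ((t ^ a : O) : K) = ((s ^ b : O) : K) * (c * algebraMap k K r⁻¹)
    rw [map_inv₀, ← mul_assoc, ← hc, mul_assoc, mul_inv_cancel₀ hf0, mul_one]
  have h1 : IsUnit (s ^ b) := hcop.isUnit_of_dvd' dvd_rfl hdvd
  exact hs ((isUnit_pow_iff hb0).1 h1)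

end Local
end Razar

namespace Razar
set_option autoImplicit false
set_option linter.unusedSectionVars false
open Polynomial

lemma exists_coeff_minpoly_eq {R F K : Type*} [CommRing R] [IsDomain R] [IsIntegrallyClosed R] [Field F]
    [Field K] [Algebra F K] (ψ : R →+* F) (hinj : Function.Injective ψ)
    (hfrac : ∀ z : F, ∃ a b : R, z = ψ a / ψ b) {f : K}
    (hf : ((algebraMap F K).comp ψ).IsIntegralElem f) (i : ℕ) :
    ∃ r, (minpoly F f).coeff i = ψ r := by
  let _ := ψ.toAlgebra
  let _ := ((algebraMap F K).comp ψ).toAlgebra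
  have : IsScalarTower R F K := IsScalarTower.of_algebraMap_eq fun _ => rfl
  have : FaithfulSMul R F := (faithfulSMul_iff_algebraMap_injective R F).2 hinj
  have : IsFractionRing R F := IsFractionRing.of_field _ _ fun z => by
    obtain ⟨a, b, h⟩ := hfrac z
    exact ⟨a, b, h⟩
  have h2 : IsIntegral R f := hf
  rw [minpoly.isIntegrallyClosed_eq_field_fractions' F h2, Polynomial.coeff_map]
  exact ⟨_, rfl⟩

section
variable {k F K : Type*} [Field k] [CharZero k] [Field F] [Algebra k[X] F] [IsFractionRing k[X] F]
  [Algebra k F] [IsScalarTower k k[X] F] [Field K] [Algebra F K] [Algebra k K] [IsScalarTower k F K]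
  [FiniteDimensional F K] [Algebra.IsSeparable F K]
local notation "u" => algebraMap k[X] F Polynomial.X
local notation "U" => algebraMap F K u
local notation "𝒪" => integralClosure (regAtZero k F) K

lemma uniformizer_pow_mul_aeval_inv (p : k[X]) :
    u ^ p.natDegree * aeval (u)⁻¹ p = algebraMap k[X] F p.reverse := by
  have hu := uniformizer_ne_zero (k := k) (F := F)
  let _ : Invertible (u)⁻¹ := invertibleOfNonzero (inv_ne_zero hu)
  have h := Polynomial.eval₂_reverse_mul_pow (algebraMap k F) (u)⁻¹ p
  rw [invOf_eq_inv, inv_inv, ← Polynomial.aeval_def, ← Polynomial.aeval_def,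
    Polynomial.aeval_algebraMap_apply, Polynomial.aeval_X_left_apply] at h
  rw [← h, mul_comm, mul_assoc, ← mul_pow, inv_mul_cancel₀ hu, one_pow, mul_one]

lemma eq_C_of_aeval_inv_mem {p : k[X]} (hp : aeval (u)⁻¹ p ∈ regAtZero k F) :
    p.natDegree = 0 := by
  obtain ⟨r, q, hq, h⟩ := hp
  by_contra hd
  have h1 : Polynomial.X ^ p.natDegree * r = p.reverse * q := by
    apply IsFractionRing.injective k[X] F
    rw [map_mul, map_mul, map_pow, ← h, ← uniformizer_pow_mul_aeval_inv, mul_assoc]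
  have h2 := congrArg (Polynomial.coeff · 0) h1
  simp only [mul_coeff_zero, Polynomial.coeff_X_pow, coeff_zero_reverse, if_neg (Ne.symm hd), zero_mul] at h2
  rcases mul_eq_zero.1 h2.symm with h3 | h3
  · rw [Polynomial.leadingCoeff_eq_zero] at h3
    simp [h3] at hd
  · exact hq h3

lemma aeval_inv_injective : Function.Injective (aeval (R := k) (u)⁻¹) := by
  rw [injective_iff_map_eq_zero]
  intro p hp
  have h := uniformizer_pow_mul_aeval_inv (F := F) p
  rw [hp, mul_zero, eq_comm, IsFractionRing.to_map_eq_zero_iff] at h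
  simpa using h

lemma exists_eq_aeval_inv_div (z : F) :
    ∃ a b : k[X], z = aeval (u)⁻¹ a / aeval (u)⁻¹ b := by
  have hu := uniformizer_ne_zero (k := k) (F := F)
  have key (p : k[X]) : ∃ a : k[X], ∃ n : ℕ, u ^ n * aeval (u)⁻¹ a = algebraMap k[X] F p := by
    induction p using Polynomial.induction_on' with
    | add p q hp hq =>
      obtain ⟨a, n, ha⟩ := hp
      obtain ⟨b, m, hb⟩ := hq
      refine ⟨Polynomial.X ^ m * a + Polynomial.X ^ n * b, n + m, ?_⟩
      rw [map_add (algebraMap k[X] F), ← ha, ← hb, map_add, map_mul, map_mul, map_pow, map_pow,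
        Polynomial.aeval_X]
      generalize aeval (u)⁻¹ a = α
      generalize aeval (u)⁻¹ b = β
      simp only [inv_pow]
      field_simp
      ring
    | monomial n c =>
      refine ⟨Polynomial.C c, n, ?_⟩
      rw [Polynomial.aeval_C, ← Polynomial.C_mul_X_pow_eq_monomial, map_mul, map_pow, mul_comm,
        IsScalarTower.algebraMap_apply k k[X] F]
      rfl
  obtain ⟨a, b, -, rfl⟩ := IsFractionRing.div_surjective (A := k[X]) z
  obtain ⟨a', n, ha⟩ := key a
  obtain ⟨b', m, hb⟩ := key b
  refine ⟨Polynomial.X ^ m * a', Polynomial.X ^ n * b', ?_⟩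
  rw [← ha, ← hb, map_mul, map_mul, map_pow, map_pow, Polynomial.aeval_X]
  generalize aeval (u)⁻¹ a' = α
  generalize aeval (u)⁻¹ b' = β
  simp only [inv_pow]
  field_simp

lemma eq_algebraMap_of_mem {A : Subalgebra k K}
    (hInt : ∀ a ∈ A, (aeval (R := k) (U)⁻¹).toRingHom.IsIntegralElem a)
    (hunit : ∀ a ∈ A, a⁻¹ ∈ A → ∃ c : k, a = algebraMap k K c) {a : K} (ha : a ∈ A) (haO : a ∈ 𝒪) :
    ∃ c : k, a = algebraMap k K c := by
  have h1 (i : ℕ) : ∃ c : k, (minpoly F a).coeff i = algebraMap k F c := by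
    obtain ⟨p, hp⟩ := exists_coeff_minpoly_eq (aeval (R := k) (u)⁻¹).toRingHom
      aeval_inv_injective exists_eq_aeval_inv_div (f := a) (by
        convert hInt a ha using 1
        refine Polynomial.ringHom_ext (fun x => ?_) ?_
        · simp [← IsScalarTower.algebraMap_apply]
        · simp) i
    have hmem : (minpoly F a).coeff i ∈ regAtZero k F := by
      rw [minpoly.isIntegrallyClosed_eq_field_fractions' F (show IsIntegral (regAtZero k F) a from haO),
        Polynomial.coeff_map]
      exact ((minpoly (regAtZero k F) a).coeff i).2
    rw [hp] at hmem
    have h0 := eq_C_of_aeval_inv_mem hmem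
    rw [hp, Polynomial.eq_C_of_natDegree_eq_zero h0]
    exact ⟨p.coeff 0, Polynomial.aeval_C _ _⟩
  have hl : minpoly F a ∈ Polynomial.lifts (algebraMap k F) := by
    rw [Polynomial.lifts_iff_coeff_lifts]
    intro i
    obtain ⟨c, hc⟩ := h1 i
    exact ⟨c, hc.symm⟩
  obtain ⟨G, hG⟩ := (Polynomial.mem_lifts _).1 hl
  have halg : IsAlgebraic k a := by
    refine ⟨G, ?_, ?_⟩
    · rintro rfl
      rw [Polynomial.map_zero] at hG
      exact minpoly.ne_zero (Algebra.IsIntegral.isIntegral (R := F) a) hG.symm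
    · rw [← Polynomial.aeval_map_algebraMap F, hG, minpoly.aeval]
  exact hunit a ha (A.inv_mem_of_algebraic (x := ⟨a, ha⟩) halg)

lemma finite_quotient_uniformizer :
    Module.Finite k ((𝒪).restrictScalars k ⧸ Ideal.span {(⟨U, uniformizer_mem⟩ : (𝒪).restrictScalars k)}) := by
  obtain ⟨S, hS⟩ := (inferInstance : Module.Finite (regAtZero k F) 𝒪)
  classical
  let q := Ideal.Quotient.mkₐ k (Ideal.span {(⟨U, uniformizer_mem⟩ : (𝒪).restrictScalars k)})
  refine ⟨S.image (fun s : 𝒪 => q s), ?_⟩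
  rw [eq_top_iff]
  rintro z -
  obtain ⟨z, rfl⟩ := Ideal.Quotient.mkₐ_surjective k _ z
  have hz : (show 𝒪 from z) ∈ Submodule.span (regAtZero k F) (S : Set 𝒪) := hS ▸ Submodule.mem_top
  let q' : 𝒪 → _ := fun s => q s
  change q' z ∈ _
  generalize (show 𝒪 from z) = z at hz
  induction hz using Submodule.span_induction with
  | mem x hx => exact Submodule.subset_span (Finset.mem_image_of_mem q' hx)
  | zero => exact (show q' 0 = 0 from map_zero q) ▸ zero_mem _
  | add x y _ _ hx hy => exact (show q' (x + y) = q' x + q' y from map_add q x y) ▸ add_mem hx hy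
  | smul a x _ hx =>
    obtain ⟨c, b, hb⟩ := exists_sub_mem_span_unif a
    have : q' (a • x) = c • q' x := by
      have hb' := congrArg Subtype.val (sub_eq_iff_eq_add.1 hb)
      have h2 := congrArg (algebraMap F K) hb'
      simp only [MulMemClass.coe_mul, AddMemClass.coe_add, map_add, map_mul] at h2
      let x' : (𝒪).restrictScalars k := x
      let v : (𝒪).restrictScalars k := (b • x : 𝒪)
      let t : (𝒪).restrictScalars k := ⟨U, uniformizer_mem⟩
      have e1 : q' (a • x) = q (c • x' + t * v) := by
        refine congrArg q (Subtype.ext ?_)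
        have e3 : ((a • x : 𝒪) : K) = algebraMap F K a * (x : K) := Algebra.smul_def a (x : K)
        have e4 : (v : K) = algebraMap F K b * (x : K) := Algebra.smul_def b (x : K)
        have e5 : ((c • x' + t * v : (𝒪).restrictScalars k) : K) = c • (x : K) + U * v := rfl
        rw [e3, e5, e4, h2, Algebra.smul_def, IsScalarTower.algebraMap_apply k F K]
        change (U * _ + algebraMap F K (algebraMap k F c)) * _ = _
        ring
      have e2 : q t = 0 := Ideal.Quotient.eq_zero_iff_mem.2 (Ideal.mem_span_singleton_self t)
      rw [e1, map_add, map_mul, e2, zero_mul, add_zero, map_smul]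
    exact this ▸ Submodule.smul_mem _ _ hx

lemma codim_ne_top (s : (𝒪).restrictScalars k) (hs : s ≠ 0) : codim k s ≠ ⊤ := by
  let t : (𝒪).restrictScalars k := ⟨U, uniformizer_mem⟩
  have ht0 : t ≠ 0 := fun h => uniformizer_ne_zero' (k := k) (F := F) (congrArg Subtype.val h)
  have hs' : (s : K) ≠ 0 := fun h => hs (Subtype.ext h)
  obtain ⟨M, hM⟩ := exists_uniformizer_pow_mul_mem (k := k) (F := F) (s : K)⁻¹
  have hdvd : s ∣ t ^ M := by
    refine ⟨⟨_, hM⟩, Subtype.ext ?_⟩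
    change U ^ M = s * (U ^ M * (s : K)⁻¹)
    field_simp
  refine ne_top_of_le_ne_top ?_ (codim_le_of_dvd k hdvd)
  rw [codim_pow k ht0]
  have := finite_quotient_uniformizer (k := k) (F := F) (K := K)
  have h2 : codim k t ≠ ⊤ := Module.length_ne_top
  lift codim k t to ℕ using h2 with e
  exact ENat.natCast_ne_top (M * e)

lemma isLocalRing_of_sum {A : Subalgebra k K} (hsum : ∀ z : K, ∃ a ∈ A, ∃ b ∈ 𝒪, z = a + b)
    (hInt : ∀ a ∈ A, (aeval (R := k) (U)⁻¹).toRingHom.IsIntegralElem a)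
    (hunit : ∀ a ∈ A, a⁻¹ ∈ A → ∃ c : k, a = algebraMap k K c) : IsLocalRing 𝒪 :=
  IsLocalRing.of_isUnit_or_isUnit_one_sub_self fun s =>
    isUnit_or_isUnit_one_sub (O := (𝒪).restrictScalars k) hsum
      (fun _ ha haO => eq_algebraMap_of_mem hInt hunit ha haO) hunit codim_ne_top s

end
end Razar

namespace Razar
set_option autoImplicit false
set_option linter.unusedSectionVars false
open Polynomial

section Uniformizer
variable {k K : Type*} [Field k] [CharZero k] [Field K] [Algebra k K]

/-- `O` is a discrete valuation ring of `K` with uniformizer `π`. -/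
structure IsUniformizer (O : Subalgebra k K) (π : K) : Prop where
  mem : π ∈ O
  ne_zero : π ≠ 0
  inv_notMem : π⁻¹ ∉ O
  exists_eq : ∀ z : K, z ≠ 0 → ∃ n : ℤ, ∃ ε ∈ O, ε⁻¹ ∈ O ∧ ε ≠ 0 ∧ z = π ^ n * ε

namespace IsUniformizer
variable {O : Subalgebra k K} {π : K} (h : IsUniformizer O π)
include h

lemma zpow_mem {n : ℤ} (hn : 0 ≤ n) : π ^ n ∈ O := by
  lift n to ℕ using hn
  rw [zpow_natCast]
  exact pow_mem h.mem n

lemma zpow_mul_mem_mono {n m : ℤ} (hnm : n ≤ m) {z : K} (hz : π ^ n * z ∈ O) : π ^ m * z ∈ O := by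
  have : π ^ m * z = π ^ (m - n) * (π ^ n * z) := by
    rw [← mul_assoc, ← zpow_add₀ h.ne_zero, sub_add_cancel]
  rw [this]
  exact mul_mem (h.zpow_mem (by omega)) hz

lemma nonneg_of_mem {n : ℤ} {ε : K} (he : ε⁻¹ ∈ O) (he0 : ε ≠ 0) (hz : π ^ n * ε ∈ O) : 0 ≤ n := by
  by_contra hn
  apply h.inv_notMem
  have h1 : π ^ n * 1 ∈ O := by
    have : π ^ n * 1 = (π ^ n * ε) * ε⁻¹ := by field_simp
    rw [this]; exact mul_mem hz he
  have := h.zpow_mul_mem_mono (show n ≤ -1 by omega) h1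
  rwa [mul_one, zpow_neg_one] at this

lemma div_mem {a : K} (ha : a ∈ O) (ha' : a⁻¹ ∉ O) : a / π ∈ O := by
  rcases eq_or_ne a 0 with rfl | ha0
  · simp
  obtain ⟨n, ε, he, he', he0, rfl⟩ := h.exists_eq a ha0
  have hn : 0 < n := by
    by_contra hn
    apply ha'
    rw [mul_inv, ← zpow_neg]
    exact mul_mem (h.zpow_mem (by omega)) he'
  have : π ^ n * ε / π = π ^ (n - 1) * ε := by
    rw [zpow_sub_one₀ h.ne_zero]; ring
  rw [this]
  exact mul_mem (h.zpow_mem (by omega)) he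

lemma add_unit {x y : K} (hx : x ∈ O) (hx' : x⁻¹ ∈ O) (hx0 : x ≠ 0) (hy : y / π ∈ O) :
    (x + y)⁻¹ ∈ O ∧ x + y ≠ 0 := by
  have hyO : y ∈ O := by
    have : y = π * (y / π) := by rw [mul_div_cancel₀ _ h.ne_zero]
    rw [this]; exact mul_mem h.mem hy
  have key : ¬ (x + y) / π ∈ O := by
    intro hxy
    apply h.inv_notMem
    have : π⁻¹ = x⁻¹ * ((x + y) / π - y / π) := by
      have := h.ne_zero
      field_simp
      ring
    rw [this]
    exact mul_mem hx' (sub_mem hxy hy)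
  constructor
  · by_contra hn
    exact key (h.div_mem (add_mem hx hyO) hn)
  · intro h0
    rw [h0, zero_div] at key
    exact key (zero_mem O)

variable {D : Derivation k K K}

lemma logDeriv_eq (n : ℤ) {ε : K} (he0 : ε ≠ 0) :
    D (π ^ n * ε) / (π ^ n * ε) = n * (D π / π) + D ε / ε := by
  have h0 := h.ne_zero
  have h1 : D (π ^ n) = n * π ^ n * (D π / π) := by
    rw [Derivation.leibniz_zpow]
    simp only [zsmul_eq_mul, smul_eq_mul]
    rw [zpow_sub_one₀ h0]; ring
  rw [D.leibniz, h1]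
  simp only [smul_eq_mul]
  have := zpow_ne_zero n h0
  field_simp
  ring

/-- The exact effect of a derivation on orders. -/
lemma exists_order_derivation (hfin : ∃ N : ℤ, ∀ z ∈ O, π ^ N * D z ∈ O)
    (hres : ∀ ε ∈ O, ∃ G : k[X], aeval ε G / π ∈ O ∧ (aeval ε (derivative G))⁻¹ ∈ O ∧
      aeval ε (derivative G) ≠ 0)
    {Q : K} (hQ : Q ≠ 0) (hDQ : D Q = 1) :
    ∃ C : ℤ, ∀ n : ℤ, n ≠ 0 → ∀ ε ∈ O, ε⁻¹ ∈ O → ε ≠ 0 →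
      ∃ η ∈ O, η⁻¹ ∈ O ∧ η ≠ 0 ∧ D (π ^ n * ε) = π ^ (n - C) * η := by
  have h0 := h.ne_zero
  obtain ⟨N, hN⟩ := hfin
  obtain ⟨m, q, hq, hq', hq0, hQm⟩ := h.exists_eq Q hQ
  have hbdd : ∀ C : ℤ, (∀ f : K, f ≠ 0 → π ^ C * (D f / f) ∈ O) → m ≤ C := by
    intro C hC
    have := hC Q hQ
    rw [hDQ, hQm, one_div, mul_inv, ← zpow_neg, ← mul_assoc, ← zpow_add₀ h0] at this
    have := h.nonneg_of_mem (by rwa [inv_inv]) (inv_ne_zero hq0) this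
    omega
  have hex : ∃ C : ℤ, ∀ f : K, f ≠ 0 → π ^ C * (D f / f) ∈ O := by
    refine ⟨N + 1, fun f hf => ?_⟩
    obtain ⟨n, ε, he, he', he0, rfl⟩ := h.exists_eq f hf
    rw [h.logDeriv_eq n he0, mul_add]
    refine add_mem ?_ ?_
    · have : π ^ (N + 1) * (n * (D π / π)) = n * (π ^ N * D π) := by
        rw [zpow_add_one₀ h0]; field_simp
      rw [this]
      exact mul_mem (intCast_mem O n) (hN _ h.mem)
    · have : π ^ (N + 1) * (D ε / ε) = π * (π ^ N * D ε) * ε⁻¹ := by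
        rw [zpow_add_one₀ h0]; field_simp
      rw [this]
      exact mul_mem (mul_mem h.mem (hN _ he)) he'
  obtain ⟨C, hC, hmin⟩ := Int.exists_least_of_bdd ⟨m, hbdd⟩ hex
  have hunit : ∀ ε ∈ O, π ^ C * D ε / π ∈ O := by
    intro ε he
    obtain ⟨G, hG, hG', hG0⟩ := hres ε he
    have hDG : D (aeval ε G) = aeval ε (derivative G) * D ε := by
      rw [Derivation.map_aeval]; rfl
    rcases eq_or_ne (aeval ε G) 0 with hz | hz
    · rw [hz, map_zero, eq_comm, mul_eq_zero] at hDG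
      rw [hDG.resolve_left hG0]; simp
    · have h1 := hC _ hz
      rw [hDG] at h1
      have h2 := mul_mem (mul_mem h1 hG) hG'
      convert h2 using 1
      field_simp
  have hη : π ^ C * (D π / π) ∈ O := hC π h0
  have hηπ : ¬ π ^ C * (D π / π) / π ∈ O := by
    intro h1
    have : C ≤ C - 1 := hmin _ fun f hf => by
      obtain ⟨n, ε, he, he', he0, rfl⟩ := h.exists_eq f hf
      rw [h.logDeriv_eq n he0, mul_add, zpow_sub_one₀ h0]
      refine add_mem ?_ ?_
      · convert mul_mem (intCast_mem O n) h1 using 1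
        ring
      · convert mul_mem (hunit ε he) he' using 1
        ring
    omega
  have hη' : (π ^ C * (D π / π))⁻¹ ∈ O := by
    by_contra hn
    exact hηπ (h.div_mem hη hn)
  refine ⟨C, fun n hn ε he he' he0 => ?_⟩
  have hnK : (n : K) ≠ 0 := by
    have : (n : K) = algebraMap k K n := by simp
    rw [this, Ne, map_eq_zero]
    exact_mod_cast hn
  have hninv : (n : K)⁻¹ ∈ O := by
    have : (n : K)⁻¹ = algebraMap k K (n : k)⁻¹ := by simp
    rw [this]; exact O.algebraMap_mem _
  have hη0 : π ^ C * (D π / π) ≠ 0 := by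
    intro hz
    rw [hz, zero_div] at hηπ
    exact hηπ (zero_mem O)
  have h1 := h.add_unit (x := n * (π ^ C * (D π / π))) (y := π ^ C * D ε / ε)
    (mul_mem (intCast_mem O n) hη) (by rw [mul_inv]; exact mul_mem hninv hη') (mul_ne_zero hnK hη0)
    (by convert mul_mem (hunit ε he) he' using 1; ring)
  refine ⟨(n * (π ^ C * (D π / π)) + π ^ C * D ε / ε) * ε, mul_mem (add_mem (mul_mem (intCast_mem O n) hη) ?_) he,
    by rw [mul_inv]; exact mul_mem h1.1 he', mul_ne_zero h1.2 he0, ?_⟩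
  · convert mul_mem (mul_mem (hunit ε he) he') h.mem using 1
    field_simp
  · have h2 := h.logDeriv_eq (D := D) n he0
    rw [div_eq_iff (mul_ne_zero (zpow_ne_zero _ h0) he0)] at h2
    rw [h2, zpow_sub₀ h0]
    have := zpow_ne_zero C h0
    field_simp

lemma exists_iterate_eq_zero (hfin : ∃ N : ℤ, ∀ z ∈ O, π ^ N * D z ∈ O)
    (hres : ∀ ε ∈ O, ∃ G : k[X], aeval ε G / π ∈ O ∧ (aeval ε (derivative G))⁻¹ ∈ O ∧
      aeval ε (derivative G) ≠ 0) {A : Subalgebra k K}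
    (hinter : ∀ a ∈ A, a ∈ O → ∃ c : k, a = algebraMap k K c) (hD : ∀ a ∈ A, D a ∈ A)
    {Q : K} (hQ : Q ∈ A) (hDQ : D Q = 1) {a : K} (ha : a ∈ A) : ∃ N : ℕ, D^[N] a = 0 := by
  have h0 := h.ne_zero
  have hconst {a : K} (ha : a ∈ A) (haO : a ∈ O) : D a = 0 := by
    obtain ⟨c, rfl⟩ := hinter a ha haO
    exact D.map_algebraMap c
  have hQ0 : Q ≠ 0 := by rintro rfl; simp at hDQ
  obtain ⟨C, hC⟩ := h.exists_order_derivation hfin hres hQ0 hDQ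
  have hneg {z : K} (hz : z ∉ O) : ∃ n : ℤ, n < 0 ∧ ∃ ε ∈ O, ε⁻¹ ∈ O ∧ ε ≠ 0 ∧ z = π ^ n * ε := by
    obtain ⟨n, ε, he, he', he0, rfl⟩ := h.exists_eq z (by rintro rfl; exact hz (zero_mem O))
    refine ⟨n, ?_, ε, he, he', he0, rfl⟩
    by_contra hn
    exact hz (mul_mem (h.zpow_mem (by omega)) he)
  have hC0 : C < 0 := by
    obtain ⟨m, hm, ε, he, he', he0, hQm⟩ := hneg (z := Q) fun hQO => by
      rw [hconst hQ hQO] at hDQ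
      exact zero_ne_one hDQ
    obtain ⟨η, hη, hη', hη0, hD⟩ := hC m hm.ne ε he he' he0
    rw [← hQm, hDQ] at hD
    have h1 : π ^ (C - m) * 1 = η := by
      rw [hD, ← mul_assoc, ← zpow_add₀ h0]; simp
    have h2 : π ^ (m - C) * 1 = η⁻¹ := by
      rw [← h1, mul_one, mul_one, ← zpow_neg]; congr 1; ring
    have h3 := h.nonneg_of_mem (by simp) one_ne_zero (h1 ▸ hη)
    have h4 := h.nonneg_of_mem (by simp) one_ne_zero (h2 ▸ hη')
    omega
  have key (j : ℕ) : ∀ a ∈ A, π ^ (j : ℤ) * a ∈ O → ∃ N : ℕ, D^[N] a = 0 := by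
    induction j with
    | zero => intro a ha haO; exact ⟨1, hconst ha (by simpa using haO)⟩
    | succ j ih =>
      intro a ha haO
      by_cases hO : a ∈ O
      · exact ⟨1, hconst ha hO⟩
      obtain ⟨n, hn, ε, he, he', he0, rfl⟩ := hneg hO
      obtain ⟨η, hη, hη', hη0, hDa⟩ := hC n hn.ne ε he he' he0
      obtain ⟨N, hN⟩ := ih _ (hD _ ha) (by
        rw [hDa, ← mul_assoc, ← zpow_add₀ h0]
        rw [← mul_assoc, ← zpow_add₀ h0] at haO
        have := h.nonneg_of_mem he' he0 haO
        exact mul_mem (h.zpow_mem (by push_cast at this; omega)) hη)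
      exact ⟨N + 1, hN⟩
  rcases eq_or_ne a 0 with rfl | ha0
  · exact ⟨0, rfl⟩
  obtain ⟨n, ε, he, he', he0, rfl⟩ := h.exists_eq a ha0
  refine key n.natAbs _ ha ?_
  rw [← mul_assoc, ← zpow_add₀ h0]
  exact mul_mem (h.zpow_mem (by omega)) he

end IsUniformizer
end Uniformizer
end Razar

namespace Razar
set_option autoImplicit false
set_option linter.unusedSectionVars false
open Polynomial

lemma exists_separable_mod {k O : Type*} [Field k] [CharZero k] [CommRing O] [Algebra k O] (M : Ideal O)
    [hM : M.IsMaximal] [Module.Finite k (O ⧸ M)] (ε : O) :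
    ∃ G : k[X], aeval ε G ∈ M ∧ aeval ε (derivative G) ∉ M := by
  have hae (G : k[X]) : aeval (Ideal.Quotient.mkₐ k M ε) G = Ideal.Quotient.mkₐ k M (aeval ε G) :=
    Polynomial.aeval_algHom_apply _ _ _
  have hInt : IsIntegral k (Ideal.Quotient.mkₐ k M ε) := IsIntegral.of_finite k _
  refine ⟨minpoly k (Ideal.Quotient.mkₐ k M ε), ?_, fun h2 => ?_⟩
  · have h1 := minpoly.aeval k (Ideal.Quotient.mkₐ k M ε)
    rw [hae] at h1
    exact Ideal.Quotient.eq_zero_iff_mem.1 h1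
  · have h3 : aeval (Ideal.Quotient.mkₐ k M ε) (derivative (minpoly k (Ideal.Quotient.mkₐ k M ε))) = 0 := by
      rw [hae]; exact Ideal.Quotient.eq_zero_iff_mem.2 h2
    let _ : Field (O ⧸ M) := Ideal.Quotient.field M
    exact (minpoly.irreducible hInt).separable.aeval_derivative_ne_zero (minpoly.aeval k _) h3

section
variable {k F K : Type*} [Field k] [CharZero k] [Field F] [Algebra k[X] F] [IsFractionRing k[X] F]
  [Algebra k F] [IsScalarTower k k[X] F] [Field K] [Algebra F K] [Algebra k K] [IsScalarTower k F K]
  [FiniteDimensional F K] [Algebra.IsSeparable F K]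
local notation "u" => algebraMap k[X] F Polynomial.X
local notation "U" => algebraMap F K u
local notation "𝒪" => integralClosure (regAtZero k F) K

lemma isUnit_of_inv_mem {z : 𝒪} (hz : IsUnit z) : (z : K)⁻¹ ∈ 𝒪 := by
  obtain ⟨z, rfl⟩ := hz
  have : ((z : 𝒪) : K)⁻¹ = ((z⁻¹ : 𝒪ˣ) : 𝒪) := by
    rw [inv_eq_iff_eq_inv]
    apply eq_inv_of_mul_eq_one_left
    rw [← MulMemClass.coe_mul, Units.mul_inv]; rfl
  rw [this]
  exact ((z⁻¹ : 𝒪ˣ) : 𝒪).2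

lemma exists_isUniformizer (hloc : IsLocalRing 𝒪) :
    ∃ π : K, IsUniformizer ((𝒪).restrictScalars k) π ∧ ∀ z : 𝒪, ¬ IsUnit z → (z : K) / π ∈ 𝒪 := by
  have hU0 : (⟨U, uniformizer_mem⟩ : 𝒪) ≠ 0 := fun h =>
    uniformizer_ne_zero' (k := k) (F := F) (congrArg Subtype.val h)
  have hnf : ¬ IsField 𝒪 := by
    intro hf
    have h1 := uniformizer_mem_of_isMaximal (IsLocalRing.maximalIdeal 𝒪)
    rw [IsLocalRing.isField_iff_maximalIdeal_eq.1 hf, Ideal.mem_bot] at h1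
    exact hU0 h1
  have : IsDiscreteValuationRing 𝒪 :=
    ((IsDiscreteValuationRing.TFAE 𝒪 hnf).out 0 2 rfl rfl).2 (inferInstance : IsDedekindDomain 𝒪)
  obtain ⟨π, hπ⟩ := IsDiscreteValuationRing.exists_irreducible 𝒪
  have hπ0 : (π : K) ≠ 0 := fun h => hπ.ne_zero (Subtype.ext h)
  have hrep (z : 𝒪) (hz : z ≠ 0) : ∃ n : ℕ, ∃ ε ∈ 𝒪, ε⁻¹ ∈ 𝒪 ∧ ε ≠ 0 ∧ (z : K) = π ^ n * ε := by
    obtain ⟨n, e, rfl⟩ := IsDiscreteValuationRing.eq_unit_mul_pow_irreducible hz hπ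
    refine ⟨n, (e : 𝒪), (e : 𝒪).2, isUnit_of_inv_mem e.isUnit, fun h => e.ne_zero (Subtype.ext h), ?_⟩
    simp [mul_comm]
  refine ⟨π, ⟨π.2, hπ0, fun h => ?_, fun z hz => ?_⟩, fun z hz => ?_⟩
  · apply hπ.not_isUnit
    refine IsUnit.of_mul_eq_one (⟨(π : K)⁻¹, h⟩ : 𝒪) (Subtype.ext ?_)
    exact mul_inv_cancel₀ hπ0
  · obtain ⟨a, b, hb, rfl⟩ := IsFractionRing.div_surjective (A := 𝒪) z
    have hb0 : b ≠ 0 := nonZeroDivisors.ne_zero hb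
    have ha0 : a ≠ 0 := by rintro rfl; simp at hz
    obtain ⟨n, ε, he, he', he0, ha⟩ := hrep a ha0
    obtain ⟨m, δ, hd, hd', hd0, hb⟩ := hrep b hb0
    refine ⟨n - m, ε * δ⁻¹, mul_mem he hd', ?_, mul_ne_zero he0 (inv_ne_zero hd0), ?_⟩
    · rw [mul_inv, inv_inv]
      exact mul_mem he' hd
    · change (a : K) / b = _
      rw [ha, hb, zpow_sub₀ hπ0, zpow_natCast, zpow_natCast]
      field_simp
  · have hz' : z ∈ IsLocalRing.maximalIdeal 𝒪 := hz
    rw [hπ.maximalIdeal_eq, Ideal.mem_span_singleton] at hz'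
    obtain ⟨c, rfl⟩ := hz'
    rw [MulMemClass.coe_mul, mul_div_cancel_left₀ _ hπ0]
    exact c.2

lemma exists_separable_residue (hloc : IsLocalRing 𝒪) (ε : 𝒪) : ∃ G : k[X], ¬ IsUnit (aeval ε G) ∧
    IsUnit (aeval ε (derivative G)) := by
  let M := IsLocalRing.maximalIdeal 𝒪
  have hfin := finite_quotient_uniformizer (k := k) (F := F) (K := K)
  have hMf : Module.Finite k (𝒪 ⧸ M) := by
    have hle : Ideal.span {(⟨U, uniformizer_mem⟩ : 𝒪)} ≤ M :=
      (Ideal.span_singleton_le_iff_mem _).2 (uniformizer_mem_of_isMaximal M)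
    have : Module.Finite k (𝒪 ⧸ Ideal.span {(⟨U, uniformizer_mem⟩ : 𝒪)}) := hfin
    exact Module.Finite.of_surjective (Ideal.Quotient.factorₐ k hle).toLinearMap
      (Ideal.Quotient.factor_surjective hle)
  obtain ⟨G, hG, hG'⟩ := exists_separable_mod (k := k) M ε
  exact ⟨G, hG, not_not.1 hG'⟩

lemma exists_uniformizer_pow_mul_derivation_mem (D : Derivation k K K) :
    ∃ M : ℕ, ∀ z ∈ 𝒪, U ^ M * D z ∈ 𝒪 := by
  obtain ⟨S, hS⟩ := (inferInstance : Module.Finite (regAtZero k F) 𝒪)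
  choose N hN using fun z : K => exists_uniformizer_pow_mul_mem (k := k) (F := F) (D z)
  have mono {n m : ℕ} (hnm : n ≤ m) {z : K} (hz : U ^ n * z ∈ 𝒪) : U ^ m * z ∈ 𝒪 := by
    obtain ⟨d, rfl⟩ := Nat.exists_eq_add_of_le' hnm
    rw [pow_add, mul_assoc]
    exact mul_mem (pow_mem uniformizer_mem d) hz
  let M := N U + S.sup fun z => N z
  have hD (a : regAtZero k F) : U ^ M * D (algebraMap F K a) ∈ 𝒪 := by
    obtain ⟨p, q, hq, hpq⟩ := a.2
    have hq0 : algebraMap k[X] F q ≠ 0 := by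
      rw [Ne, IsFractionRing.to_map_eq_zero_iff]; rintro rfl; simp at hq
    have hmem {f : F} (hf : f ∈ regAtZero k F) : algebraMap F K f ∈ 𝒪 := (𝒪).algebraMap_mem ⟨f, hf⟩
    have hDp (p : k[X]) : D (algebraMap F K (algebraMap k[X] F p)) =
        algebraMap F K (algebraMap k[X] F (derivative p)) * D U := by
      have hp (p : k[X]) : algebraMap F K (algebraMap k[X] F p) = aeval U p := by
        rw [Polynomial.aeval_algebraMap_apply, Polynomial.aeval_algebraMap_apply, Polynomial.aeval_X_left_apply]
      rw [hp p, hp (derivative p), Derivation.map_aeval]; rfl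
    have h1 : D (algebraMap F K (a * algebraMap k[X] F q)) = D (algebraMap F K (algebraMap k[X] F p)) :=
      congrArg (fun f => D (algebraMap F K f)) hpq
    rw [map_mul, D.leibniz, hDp q, hDp p, smul_eq_mul, smul_eq_mul] at h1
    have hq0' : algebraMap F K (algebraMap k[X] F q) ≠ 0 := by rwa [Ne, map_eq_zero]
    have h2 : U ^ M * D (algebraMap F K a) = (algebraMap F K (algebraMap k[X] F (derivative p)) -
        algebraMap F K a * algebraMap F K (algebraMap k[X] F (derivative q))) *
        algebraMap F K (algebraMap k[X] F q)⁻¹ * (U ^ M * D U) := by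
      rw [map_inv₀]
      field_simp
      linear_combination h1
    rw [h2]
    exact mul_mem (mul_mem (sub_mem (hmem (algebraMap_mem_regAtZero _)) (mul_mem (hmem a.2)
      (hmem (algebraMap_mem_regAtZero _)))) (hmem (regAtZero_inv_mem hq))) (mono (by omega) (hN U))
  refine ⟨M, fun z hz => ?_⟩
  have hz' : (⟨z, hz⟩ : 𝒪) ∈ Submodule.span (regAtZero k F) (S : Set 𝒪) := hS ▸ Submodule.mem_top
  suffices h : ∀ z : 𝒪, z ∈ Submodule.span (regAtZero k F) (S : Set 𝒪) → U ^ M * D z ∈ 𝒪 from h _ hz'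
  intro z hz
  induction hz using Submodule.span_induction with
  | mem x hx =>
    exact mono ((Finset.le_sup (f := fun z : 𝒪 => N z) hx).trans (Nat.le_add_left _ _)) (hN x)
  | zero => simp
  | add x y _ _ hx hy =>
    rw [AddMemClass.coe_add, map_add, mul_add]; exact add_mem hx hy
  | smul a x _ hx =>
    have h3 : ((a • x : 𝒪) : K) = algebraMap F K a * (x : K) := Algebra.smul_def a (x : K)
    rw [h3, D.leibniz, smul_eq_mul, smul_eq_mul, mul_add, mul_left_comm, mul_left_comm _ (x : K)]
    exact add_mem (mul_mem ((𝒪).algebraMap_mem a) hx) (mul_mem x.2 (hD a))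

/-- The dichotomy: either there is a differential of the first kind, or the derivation is locally
nilpotent. -/
theorem exists_differential_or_nilpotent (pb : PowerBasis F K) {A : Subalgebra k K} (hx : U⁻¹ ∈ A)
    (hy : pb.gen ∈ A) (hmin : ∀ i, algebraMap F K ((minpoly F pb.gen).coeff i) ∈ A)
    (hInt : ∀ a ∈ A, (aeval (R := k) (U)⁻¹).toRingHom.IsIntegralElem a)
    (hunit : ∀ a ∈ A, a⁻¹ ∈ A → ∃ c : k, a = algebraMap k K c)
    (D : Derivation k K K) (hD : ∀ a ∈ A, D a ∈ A) {Q : K} (hQ : Q ∈ A) (hDQ : D Q = 1) :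
    (∃ g ∈ A, g ≠ 0 ∧ ∃ w ∈ 𝒪,
      (U⁻¹ * g / aeval pb.gen (derivative (minpoly F pb.gen))) ^ Module.finrank F K = U * w) ∨
    ∀ a ∈ A, ∃ N : ℕ, D^[N] a = 0 := by
  by_cases hsum : ∀ z : K, ∃ a ∈ A, ∃ b ∈ 𝒪, z = a + b
  swap
  · exact .inl (exists_differential pb hx hy hmin hsum)
  right
  have hloc := isLocalRing_of_sum hsum hInt hunit
  obtain ⟨π, hπ, hdiv⟩ := exists_isUniformizer (k := k) (F := F) (K := K) hloc
  intro a ha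
  refine hπ.exists_iterate_eq_zero ?_ ?_ (fun a ha haO => eq_algebraMap_of_mem hInt hunit ha haO)
    hD hQ hDQ ha
  · obtain ⟨M, hM⟩ := exists_uniformizer_pow_mul_derivation_mem (F := F) D
    obtain ⟨n, ε, he, he', he0, h⟩ := hπ.exists_eq (U ^ M) (pow_ne_zero _ uniformizer_ne_zero')
    refine ⟨n, fun z hz => ?_⟩
    have h2 : π ^ n * D z = ε⁻¹ * (U ^ M * D z) := by rw [h]; field_simp
    rw [h2]
    exact mul_mem he' (hM z hz)
  · intro ε he
    obtain ⟨G, hG, hG'⟩ := exists_separable_residue (k := k) hloc ⟨ε, he⟩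
    have hc (G : k[X]) : ((aeval (⟨ε, he⟩ : 𝒪) G : 𝒪) : K) = aeval ε G :=
      (Polynomial.aeval_algHom_apply ((𝒪).restrictScalars k).val _ _).symm
    refine ⟨G, ?_, ?_, ?_⟩
    · rw [← hc]; exact hdiv _ hG
    · rw [← hc]; exact isUnit_of_inv_mem hG'
    · rw [← hc]; exact fun h => hG'.ne_zero (Subtype.ext h)

end
end Razar

namespace Razar
set_option autoImplicit false
open Polynomial Topology
open scoped Polynomial.Bivariate
open Polynomial.Bivariate (swap)

/-- Partial derivative of a bivariate polynomial with respect to the inner variable. -/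
noncomputable def dx : Derivation ℂ ℂ[X][Y] ℂ[X][Y] :=
  Derivation.mk' ((swap (R := ℂ)).toLinearMap ∘ₗ
    (((derivative : ℂ[X][Y] →ₗ[ℂ[X]] ℂ[X][Y])).restrictScalars ℂ) ∘ₗ (swap (R := ℂ)).toLinearMap)
    (fun a b => by
      simp [derivative_mul, Bivariate.swap_swap_apply]
      ring)

/-- Partial derivative of a bivariate polynomial with respect to the outer variable. -/
noncomputable def dy : Derivation ℂ ℂ[X][Y] ℂ[X][Y] :=
  Derivation.mk' ((derivative : ℂ[X][Y] →ₗ[ℂ[X]] ℂ[X][Y]).restrictScalars ℂ)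
    (fun a b => by simp [derivative_mul]; ring)

lemma dy_apply (f : ℂ[X][Y]) : dy f = derivative f := rfl

lemma dx_apply (f : ℂ[X][Y]) : dx f = swap (derivative (swap f)) := rfl

lemma dx_C (a : ℂ[X]) : dx (Polynomial.C a) = Polynomial.C (derivative a) := by
  rw [dx_apply, Bivariate.swap_C, derivative_map, Bivariate.swap_map_C]

lemma dx_Y : dx (Polynomial.X : ℂ[X][Y]) = 0 := by
  rw [dx_apply, Bivariate.swap_Y]; simp

/-- Evaluation of a bivariate polynomial as a function on `ℂ × ℂ`. -/
noncomputable def ev (f : ℂ[X][Y]) (z : ℂ × ℂ) : ℂ := f.evalEval z.1 z.2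

@[simp] lemma ev_add (f g : ℂ[X][Y]) (z) : ev (f + g) z = ev f z + ev g z := by simp [ev]
@[simp] lemma ev_sub (f g : ℂ[X][Y]) (z) : ev (f - g) z = ev f z - ev g z := by simp [ev]
@[simp] lemma ev_mul (f g : ℂ[X][Y]) (z) : ev (f * g) z = ev f z * ev g z := by simp [ev]
@[simp] lemma ev_pow (f : ℂ[X][Y]) (n : ℕ) (z) : ev (f ^ n) z = ev f z ^ n := by simp [ev]
@[simp] lemma ev_one (z) : ev 1 z = 1 := by simp [ev]
@[simp] lemma ev_zero (z) : ev 0 z = 0 := by simp [ev]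
@[simp] lemma ev_X (z) : ev Polynomial.X z = z.2 := by simp [ev]
@[simp] lemma ev_C (a : ℂ[X]) (z) : ev (Polynomial.C a) z = a.eval z.1 := by rw [ev, evalEval_C]

/-- The linear form with given coefficients. -/
noncomputable def lin (a b : ℂ) : ℂ × ℂ →L[ℂ] ℂ :=
  a • ContinuousLinearMap.fst ℂ ℂ ℂ + b • ContinuousLinearMap.snd ℂ ℂ ℂ

@[simp] lemma lin_apply (a b : ℂ) (v : ℂ × ℂ) : lin a b v = a * v.1 + b * v.2 := by simp [lin]

lemma hasStrictFDerivAt_ev (f : ℂ[X][Y]) (z : ℂ × ℂ) :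
    HasStrictFDerivAt (ev f) (lin (ev (dx f) z) (ev (dy f) z)) z := by
  induction f using Polynomial.induction_on' with
  | add f g hf hg =>
    have : ev (f + g) = ev f + ev g := by ext; simp
    rw [this]
    refine (hf.add hg).congr_fderiv ?_
    ext <;> simp
  | monomial n a =>
    have h1 : HasStrictFDerivAt (fun z : ℂ × ℂ => a.eval z.1)
        (a.derivative.eval z.1 • ContinuousLinearMap.fst ℂ ℂ ℂ) z :=
      (a.hasStrictDerivAt z.1).comp_hasStrictFDerivAt z hasStrictFDerivAt_fst
    have h2 : HasStrictFDerivAt (fun z : ℂ × ℂ => z.2 ^ n)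
        ((n * z.2 ^ (n - 1)) • ContinuousLinearMap.snd ℂ ℂ ℂ) z :=
      (hasStrictDerivAt_pow n z.2).comp_hasStrictFDerivAt z hasStrictFDerivAt_snd
    have : ev (monomial n a) = fun z => a.eval z.1 * z.2 ^ n := by
      ext z; rw [← Polynomial.C_mul_X_pow_eq_monomial]; simp
    rw [this]
    refine (h1.mul h2).congr_fderiv ?_
    rw [← Polynomial.C_mul_X_pow_eq_monomial, Derivation.leibniz, Derivation.leibniz, Derivation.leibniz_pow,
      Derivation.leibniz_pow, dx_Y, dx_C, dy_apply, dy_apply]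
    have hn : ev (n : ℂ[X][Y]) z = n := by simp [ev]
    ext <;> simp [nsmul_eq_mul, hn]; ring

lemma continuous_ev (f : ℂ[X][Y]) : Continuous (ev f) :=
  continuous_iff_continuousAt.2 fun z => (hasStrictFDerivAt_ev f z).hasFDerivAt.continuousAt

end Razar

namespace Razar
set_option autoImplicit false
open Polynomial Topology
open scoped Polynomial.Bivariate

/-- The linear automorphism of `ℂ × ℂ` given by an invertible `2 × 2` matrix. -/
noncomputable def linEquiv (a b c d : ℂ) (h : a * d - b * c ≠ 0) : (ℂ × ℂ) ≃L[ℂ] (ℂ × ℂ) :=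
  ContinuousLinearEquiv.equivOfInverse ((lin a b).prod (lin c d))
    ((lin (d / (a * d - b * c)) (-b / (a * d - b * c))).prod
      (lin (-c / (a * d - b * c)) (a / (a * d - b * c))))
    (fun v => by
      have := mul_inv_cancel₀ h
      ext <;> simp [div_eq_mul_inv]
      · linear_combination v.1 * this
      · linear_combination v.2 * this)
    (fun v => by
      have := mul_inv_cancel₀ h
      ext <;> simp [div_eq_mul_inv]
      · linear_combination v.1 * this
      · linear_combination v.2 * this)

lemma linEquiv_symm_apply (a b c d : ℂ) (h : a * d - b * c ≠ 0) (v : ℂ × ℂ) :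
    (linEquiv a b c d h).symm v =
      (d / (a * d - b * c) * v.1 + -b / (a * d - b * c) * v.2,
        -c / (a * d - b * c) * v.1 + a / (a * d - b * c) * v.2) := by
  change ((lin _ _).prod (lin _ _)) v = _
  simp

/-- Jacobian determinant of a pair of bivariate polynomials. -/
noncomputable def jac (U V : ℂ[X][Y]) : ℂ[X][Y] := dx U * dy V - dy U * dx V

lemma exists_local_curve (U V : ℂ[X][Y]) (z₀ : ℂ × ℂ) (hJ : ev (jac U V) z₀ ≠ 0) :
    ∃ γ : ℂ → ℂ × ℂ, γ (ev V z₀) = z₀ ∧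
      (∀ᶠ z in 𝓝 z₀, ev U z = ev U z₀ → γ (ev V z) = z) ∧
      ∀ᶠ v in 𝓝 (ev V z₀), ev U (γ v) = ev U z₀ ∧ ev V (γ v) = v ∧
        HasDerivAt γ (-ev (dy U) (γ v) / ev (jac U V) (γ v),
          ev (dx U) (γ v) / ev (jac U V) (γ v)) v := by
  have key : ∀ z, ∀ h : ev (jac U V) z ≠ 0, HasStrictFDerivAt (fun z => (ev U z, ev V z))
      (linEquiv (ev (dx U) z) (ev (dy U) z) (ev (dx V) z) (ev (dy V) z)
        (by simpa [jac] using h) : ℂ × ℂ →L[ℂ] ℂ × ℂ) z := fun z h =>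
    (hasStrictFDerivAt_ev U z).prodMk (hasStrictFDerivAt_ev V z)
  set e := (key z₀ hJ).toOpenPartialHomeomorph with he
  have hecoe : ∀ z, e z = (ev U z, ev V z) := fun z => rfl
  have hz₀ : z₀ ∈ e.source := (key z₀ hJ).mem_toOpenPartialHomeomorph_source
  have hw₀ : (ev U z₀, ev V z₀) ∈ e.target := e.map_source hz₀
  have hι : Continuous (fun v : ℂ => (ev U z₀, v)) := by fun_prop
  refine ⟨fun v => e.symm (ev U z₀, v), ?_, ?_, ?_⟩
  · exact e.left_inv hz₀
  · filter_upwards [e.eventually_left_inverse hz₀] with z hz h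
    rw [← h]; exact hz
  · have h1 : ∀ᶠ w in 𝓝 (ev U z₀, ev V z₀), w ∈ e.target := e.open_target.mem_nhds hw₀
    have h2 : ∀ᶠ w in 𝓝 (ev U z₀, ev V z₀), ev (jac U V) (e.symm w) ≠ 0 := by
      have hc : ContinuousAt (fun w => ev (jac U V) (e.symm w)) (ev U z₀, ev V z₀) :=
        (continuous_ev _).continuousAt.comp (e.continuousAt_symm hw₀)
      refine hc.eventually_ne ?_
      have : e.symm (ev U z₀, ev V z₀) = z₀ := e.left_inv hz₀
      rwa [this]
    have h3 := (hι.tendsto (ev V z₀)).eventually (h1.and h2)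
    filter_upwards [h3] with v hv
    obtain ⟨hv1, hv2⟩ := hv
    have hr := e.right_inv hv1
    rw [hecoe, Prod.ext_iff] at hr
    refine ⟨hr.1, hr.2, ?_⟩
    have hd := e.hasFDerivAt_symm hv1 (key _ hv2).hasFDerivAt
    have hd2 := hd.comp_hasDerivAt v ((hasDerivAt_const v (ev U z₀)).prodMk (hasDerivAt_id v))
    refine hd2.congr_deriv ?_
    change (linEquiv _ _ _ _ _).symm (0, 1) = _
    rw [linEquiv_symm_apply]
    simp [jac]

end Razar

namespace Razar
set_option autoImplicit false
open Polynomial Topology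
open scoped Polynomial.Bivariate

/-- The fiber of a bivariate polynomial. -/
def fib (P : ℂ[X][Y]) (c : ℂ) : Set (ℂ × ℂ) := {z | ev P z = c}

/-- `h` is, near `p`, a primitive of the form `g dQ` on the fiber `P = c`. -/
def IsPrim (P Q g : ℂ[X][Y]) (c : ℂ) (h : ℂ × ℂ → ℂ) (p : ℂ × ℂ) : Prop :=
  ∃ H : ℂ → ℂ, ∀ᶠ z in 𝓝[fib P c] p, h z = H (ev Q z) ∧ HasDerivAt H (ev g z) (ev Q z)

section
variable {P Q g : ℂ[X][Y]} {c : ℂ}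

lemma exists_curve_fib (hJ : jac P Q = 1) {p : ℂ × ℂ} (hp : p ∈ fib P c) :
    ∃ γ : ℂ → ℂ × ℂ, γ (ev Q p) = p ∧ (∀ᶠ z in 𝓝[fib P c] p, γ (ev Q z) = z) ∧
      ∀ᶠ v in 𝓝 (ev Q p), γ v ∈ fib P c ∧ ev Q (γ v) = v ∧
        HasDerivAt γ (-ev (dy P) (γ v), ev (dx P) (γ v)) v := by
  obtain ⟨γ, h1, h2, h3⟩ := exists_local_curve P Q p (by simp [hJ])
  have hp' : ev P p = c := hp
  refine ⟨γ, h1, ?_, ?_⟩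
  · rw [eventually_nhdsWithin_iff]
    filter_upwards [h2] with z hz hzc
    exact hz (by rw [hp']; exact hzc)
  · filter_upwards [h3] with v hv
    refine ⟨hv.1.trans hp', hv.2.1, ?_⟩
    simpa [hJ] using hv.2.2

lemma exists_isPrim (hJ : jac P Q = 1) (g : ℂ[X][Y]) {p : ℂ × ℂ} (hp : p ∈ fib P c) :
    ∃ h, IsPrim P Q g c h p := by
  obtain ⟨γ, h1, h2, h3⟩ := exists_curve_fib hJ hp
  obtain ⟨r, hr, hball⟩ := Metric.eventually_nhds_iff_ball.1 h3
  have hd : DifferentiableOn ℂ (fun v => ev g (γ v)) (Metric.ball (ev Q p) r) := fun v hv =>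
    ((hasStrictFDerivAt_ev g (γ v)).hasFDerivAt.comp_hasDerivAt v
      (hball v hv).2.2).differentiableAt.differentiableWithinAt
  obtain ⟨H, hH⟩ := (convex_ball (ev Q p) r).exists_forall_hasDerivWithinAt hd
  refine ⟨fun z => H (ev Q z), H, ?_⟩
  have hQ : ∀ᶠ z in 𝓝[fib P c] p, ev Q z ∈ Metric.ball (ev Q p) r :=
    ((continuous_ev Q).continuousAt.eventually (Metric.ball_mem_nhds _ hr)).filter_mono
      nhdsWithin_le_nhds
  filter_upwards [h2, hQ] with z hz hzQ
  refine ⟨rfl, ?_⟩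
  have := (hH _ hzQ).hasDerivAt (Metric.isOpen_ball.mem_nhds hzQ)
  rwa [hz] at this

lemma IsPrim.sub_eventually_eq (hJ : jac P Q = 1) {h₁ h₂ : ℂ × ℂ → ℂ} {p : ℂ × ℂ}
    (hp : p ∈ fib P c) (H₁ : IsPrim P Q g c h₁ p) (H₂ : IsPrim P Q g c h₂ p) :
    ∀ᶠ z in 𝓝[fib P c] p, h₁ z - h₂ z = h₁ p - h₂ p := by
  obtain ⟨γ, h1, h2, h3⟩ := exists_curve_fib hJ hp
  obtain ⟨K₁, hK₁⟩ := H₁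
  obtain ⟨K₂, hK₂⟩ := H₂
  have hγ : Tendsto γ (𝓝 (ev Q p)) (𝓝[fib P c] p) := by
    rw [tendsto_nhdsWithin_iff]
    refine ⟨?_, h3.mono fun v hv => hv.1⟩
    have := h3.self_of_nhds.2.2.continuousAt.tendsto
    rwa [h1] at this
  obtain ⟨r, hr, hball⟩ := Metric.eventually_nhds_iff_ball.1 (h3.and (hγ.eventually (hK₁.and hK₂)))
  have hconst : ∀ v ∈ Metric.ball (ev Q p) r, K₁ v - K₂ v = K₁ (ev Q p) - K₂ (ev Q p) := by
    intro v hv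
    have hder : ∀ v ∈ Metric.ball (ev Q p) r, HasDerivAt (fun v => K₁ v - K₂ v) 0 v := by
      intro v hv
      obtain ⟨⟨_, hQ, _⟩, ⟨_, hd1⟩, ⟨_, hd2⟩⟩ := hball v hv
      rw [hQ] at hd1 hd2
      exact (hd1.fun_sub hd2).congr_deriv (sub_self _)
    exact (convex_ball _ _).is_const_of_fderivWithin_eq_zero (𝕜 := ℂ)
      (fun v hv => (hder v hv).differentiableAt.differentiableWithinAt)
      (fun v hv => by
        rw [fderivWithin_of_isOpen Metric.isOpen_ball hv]
        ext; simp [(hder v hv).deriv]) hv (Metric.mem_ball_self hr)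
  have hQ : ∀ᶠ z in 𝓝[fib P c] p, ev Q z ∈ Metric.ball (ev Q p) r :=
    ((continuous_ev Q).continuousAt.eventually (Metric.ball_mem_nhds _ hr)).filter_mono
      nhdsWithin_le_nhds
  filter_upwards [hK₁, hK₂, hQ] with z hz1 hz2 hzQ
  rw [hz1.1, hz2.1, (hK₁.self_of_nhdsWithin hp).1, (hK₂.self_of_nhdsWithin hp).1, hconst _ hzQ]

lemma IsPrim.congr {h₁ h₂ : ℂ × ℂ → ℂ} {p : ℂ × ℂ} (H₁ : IsPrim P Q g c h₁ p)
    (h : ∀ᶠ z in 𝓝[fib P c] p, h₂ z - h₁ z = h₂ p - h₁ p) : IsPrim P Q g c h₂ p := by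
  obtain ⟨K, hK⟩ := H₁
  refine ⟨fun q => K q + (h₂ p - h₁ p), ?_⟩
  filter_upwards [h, hK] with z hz hz2
  refine ⟨?_, hz2.2.add_const _⟩
  rw [← hz2.1, ← hz]; ring

lemma IsPrim.eventually {h : ℂ × ℂ → ℂ} {p : ℂ × ℂ} (H : IsPrim P Q g c h p) :
    ∀ᶠ z in 𝓝[fib P c] p, IsPrim P Q g c h z := by
  obtain ⟨K, hK⟩ := H
  filter_upwards [eventually_eventually_nhdsWithin.2 hK] with z hz
  exact ⟨K, hz⟩

lemma IsPrim.hasDerivAt {h : ℂ × ℂ → ℂ} {β : ℂ → ℂ × ℂ} {β' : ℂ × ℂ} {x : ℂ}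
    (H : IsPrim P Q g c h (β x)) (hβ : HasDerivAt β β' x) (hf : ∀ᶠ x' in 𝓝 x, β x' ∈ fib P c) :
    HasDerivAt (fun x => h (β x))
      (ev g (β x) * (ev (dx Q) (β x) * β'.1 + ev (dy Q) (β x) * β'.2)) x := by
  obtain ⟨K, hK⟩ := H
  have ht : Tendsto β (𝓝 x) (𝓝[fib P c] (β x)) :=
    tendsto_nhdsWithin_iff.2 ⟨hβ.continuousAt, hf⟩
  have hQ : HasDerivAt (fun x => ev Q (β x)) _ x :=
    (hasStrictFDerivAt_ev Q (β x)).hasFDerivAt.comp_hasDerivAt x hβ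
  have h1 := (hK.self_of_nhdsWithin hf.self_of_nhds).2.comp x hQ
  refine (h1.congr_of_eventuallyEq ?_).congr_deriv (by simp)
  filter_upwards [ht.eventually hK] with x' hx'
  exact hx'.1

lemma IsPrim.of_branch (hJ : jac P Q = 1) {h : ℂ × ℂ → ℂ} {p : ℂ × ℂ} (hp : p ∈ fib P c)
    (hy : ev (dy P) p ≠ 0) {H : ℂ → ℂ}
    (hH : ∀ᶠ z in 𝓝[fib P c] p, h z = H z.1 ∧ HasDerivAt H (-ev g z / ev (dy P) z) z.1) :
    IsPrim P Q g c h p := by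
  obtain ⟨γ, h1, h2, h3⟩ := exists_curve_fib hJ hp
  have hQ : Tendsto (ev Q) (𝓝[fib P c] p) (𝓝 (ev Q p)) :=
    (continuous_ev Q).continuousAt.tendsto.mono_left nhdsWithin_le_nhds
  have hy' : ∀ᶠ z in 𝓝[fib P c] p, ev (dy P) z ≠ 0 :=
    ((continuous_ev _).continuousAt.eventually_ne hy).filter_mono nhdsWithin_le_nhds
  refine ⟨fun q => H (γ q).1, ?_⟩
  filter_upwards [hH, h2, hQ.eventually h3, hy'] with z hz hγz hz3 hyz
  refine ⟨by rw [hγz]; exact hz.1, ?_⟩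
  have hd := hz3.2.2
  rw [hγz] at hd
  have hd1 : HasDerivAt (fun q => (γ q).1) (-ev (dy P) z) (ev Q z) := by
    exact (ContinuousLinearMap.fst ℂ ℂ ℂ).hasFDerivAt.comp_hasDerivAt _ hd
  have h4 : HasDerivAt H (-ev g z / ev (dy P) z) (γ (ev Q z)).1 := by rw [hγz]; exact hz.2
  refine (HasDerivAt.comp (h₂ := H) (h := fun q => (γ q).1) _ h4 hd1).congr_deriv ?_
  field_simp

end

end Razar

namespace Razar
set_option autoImplicit false
open Topology

/-- The bundle with discrete fibers whose sections are the solutions of a Čech cocycle condition. -/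
def cocycleCore {B ι A : Type*} [TopologicalSpace B] [AddCommGroup A] [TopologicalSpace A]
    [DiscreteTopology A] (U : ι → Set B) (hU : ∀ i, IsOpen (U i)) (idx : B → ι)
    (hidx : ∀ b, b ∈ U (idx b)) (H : ι → B → A)
    (hH : ∀ i j, ∀ b ∈ U i, b ∈ U j → ∀ᶠ b' in 𝓝 b, H i b' - H j b' = H i b - H j b) :
    FiberBundleCore ι B A where
  baseSet := U
  isOpen_baseSet := hU
  indexAt := idx
  mem_baseSet_at := hidx
  coordChange i j b v := v + (H i b - H j b)
  coordChange_self i b _ v := by simp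
  continuousOn_coordChange i j := by
    rintro ⟨b, v⟩ ⟨⟨hi, hj⟩, -⟩
    have h1 : ∀ᶠ p : B × A in 𝓝 (b, v), H i p.1 - H j p.1 = H i b - H j b :=
      (continuous_fst.tendsto (b, v)).eventually (hH i j b hi hj)
    have h2 : ContinuousAt (fun p : B × A => p.2 + (H i b - H j b)) (b, v) :=
      (continuous_of_discreteTopology (f := fun a : A => a + (H i b - H j b))).comp
        continuous_snd |>.continuousAt
    refine (h2.congr ?_).continuousWithinAt
    filter_upwards [h1] with p hp
    rw [hp]
  coordChange_comp i j k b _ v := by abel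

/-- On a simply connected space, locally defined functions which differ by locally constant
functions can be glued up to locally constant functions. -/
lemma exists_glue {B ι A : Type*} [TopologicalSpace B] [SimplyConnectedSpace B]
    [LocallyPathConnectedSpace B] [AddCommGroup A] [TopologicalSpace A]
    [DiscreteTopology A] (U : ι → Set B) (hU : ∀ i, IsOpen (U i)) (idx : B → ι)
    (hidx : ∀ b, b ∈ U (idx b)) (H : ι → B → A)
    (hH : ∀ i j, ∀ b ∈ U i, b ∈ U j → ∀ᶠ b' in 𝓝 b, H i b' - H j b' = H i b - H j b) :
    ∃ h : B → A, ∀ i, ∀ b ∈ U i, ∀ᶠ b' in 𝓝 b, h b' - H i b' = h b - H i b := by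
  let Z := cocycleCore U hU idx hidx H hH
  have cov : IsCoveringMap Z.proj := FiberBundle.isCoveringMap (F := A) (E := Z.Fiber)
  obtain ⟨b₀⟩ : Nonempty B := inferInstance
  obtain ⟨s, ⟨-, hs⟩, -⟩ := cov.existsUnique_continuousMap_lifts (ContinuousMap.id B) b₀
    (⟨b₀, (0 : A)⟩ : Z.TotalSpace) rfl
  have hs1 : ∀ b, (s b).1 = b := fun b => congrFun hs b
  let v : ι → B → A := fun i b => (Z.localTriv i (s b)).2
  let w : B → A := fun b => (s b).2
  have hv : ∀ i, ∀ b ∈ U i, ∀ᶠ b' in 𝓝 b, v i b' = v i b := by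
    intro i b hb
    have h1 : s b ∈ (Z.localTriv i).source := by
      rw [Z.mem_localTriv_source, hs1]; exact hb
    have h2 : ContinuousAt (v i) b :=
      continuous_snd.continuousAt.comp
        (((Z.localTriv i).continuousAt h1).comp s.continuous.continuousAt)
    have : {v i b} ∈ 𝓝 (v i b) := by simp
    exact h2.eventually this
  have hvh : ∀ i, ∀ b ∈ U i, v i b = (v (idx b) b + H (idx b) b) - H i b := by
    intro i b hb
    have e : ∀ j, v j b = w b + (H (idx b) b - H j b) := by
      intro j
      have : v j b = w b + (H (idx (s b).1) (s b).1 - H j (s b).1) := rfl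
      rw [this, hs1]
    rw [e i, e (idx b)]; abel
  refine ⟨fun b => v (idx b) b + H (idx b) b, fun i b hb => ?_⟩
  filter_upwards [hv i b hb, (hU i).mem_nhds hb] with b' hb' hbU
  rw [← hvh i b' hbU, ← hvh i b hb, hb']

end Razar

namespace Razar
set_option autoImplicit false
open Topology Set MeasureTheory

lemma tendsto_ray {Ω : Set ℂ} {R C δ : ℝ} (hR : 0 < R) (hδ : 0 < δ)
    (hnorm : ∀ x ∈ Ω, R < ‖x‖) (hray : ∀ x ∈ Ω, ∀ s : ℝ, 1 ≤ s → (s : ℂ) * x ∈ Ω)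
    {f H : ℂ → ℂ} (hf : ContinuousOn f Ω)
    (hb : ∀ x ∈ Ω, ‖f x‖ ≤ C * ‖x‖ ^ (-1 - δ)) (hH : ∀ x ∈ Ω, HasDerivAt H (f x) x)
    {x : ℂ} (hx : x ∈ Ω) :
    ∃ L, Tendsto (fun s : ℝ => H (s * x)) atTop (𝓝 L) ∧ ‖L - H x‖ ≤ C / δ * ‖x‖ ^ (-δ) := by
  have hx0 : 0 < ‖x‖ := hR.trans (hnorm x hx)
  have hder : ∀ s ∈ Ici (1 : ℝ), HasDerivAt (fun s : ℝ => H (s * x)) (x * f (s * x)) s := by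
    intro s hs
    have h1 : HasDerivAt (fun s : ℝ => (s : ℂ) * x) x s := by
      simpa using (hasDerivAt_id s).ofReal_comp.mul_const x
    have := HasDerivAt.comp (h₂ := H) (h := fun s : ℝ => (s : ℂ) * x) s (hH _ (hray x hx s hs)) h1
    exact this.congr_deriv (mul_comm _ _)
  have hbd : ∀ s ∈ Ioi (1 : ℝ), ‖x * f (s * x)‖ ≤ C * ‖x‖ ^ (-δ) * s ^ (-1 - δ) := by
    intro s hs
    have hs1 : (1 : ℝ) < s := hs
    have hs0 : 0 < s := by linarith
    rw [norm_mul]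
    calc ‖x‖ * ‖f (s * x)‖ ≤ ‖x‖ * (C * ‖(s : ℂ) * x‖ ^ (-1 - δ)) := by
          gcongr; exact hb _ (hray x hx s hs1.le)
      _ = C * ‖x‖ ^ (-δ) * s ^ (-1 - δ) := by
          rw [norm_mul, Complex.norm_real, Real.norm_of_nonneg hs0.le,
            Real.mul_rpow hs0.le hx0.le]
          have : ‖x‖ ^ (-δ) = ‖x‖ * ‖x‖ ^ (-1 - δ) := by
            rw [← Real.rpow_one_add' hx0.le (by linarith)]; ring_nf
          rw [this]; ring
  have hint0 : IntegrableOn (fun s : ℝ => C * ‖x‖ ^ (-δ) * s ^ (-1 - δ)) (Ioi 1) :=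
    (integrableOn_Ioi_rpow_of_lt (by linarith) one_pos).const_mul _
  have hcont : ContinuousOn (fun s : ℝ => x * f (s * x)) (Ioi 1) := by
    refine continuousOn_const.mul (hf.comp (by fun_prop) ?_)
    intro s hs
    exact hray x hx s (le_of_lt hs)
  have hInt : IntegrableOn (fun s : ℝ => x * f (s * x)) (Ioi 1) := by
    refine Integrable.mono' hint0 (hcont.aestronglyMeasurable measurableSet_Ioi) ?_
    exact (ae_restrict_iff' measurableSet_Ioi).2 (Eventually.of_forall hbd)
  have ht := tendsto_limUnder_of_hasDerivAt_of_integrableOn_Ioi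
    (fun s hs => hder s (Ioi_subset_Ici_self hs)) hInt
  refine ⟨_, ht, ?_⟩
  have h1 := integral_Ioi_of_hasDerivAt_of_tendsto
    ((hder 1 (by simp)).continuousAt.continuousWithinAt) (fun s hs => hder s (Ioi_subset_Ici_self hs)) hInt ht
  simp only [Complex.ofReal_one, one_mul] at h1
  rw [← h1]
  refine (norm_integral_le_of_norm_le hint0
    ((ae_restrict_iff' measurableSet_Ioi).2 (Eventually.of_forall hbd))).trans (le_of_eq ?_)
  rw [integral_const_mul, integral_Ioi_rpow_of_lt (by linarith) one_pos]
  rw [Real.one_rpow, show -1 - δ + 1 = -δ by ring]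
  field_simp

/-- A holomorphic function on a conical convex domain with enough decay has a primitive which
tends to zero along rays. -/
lemma exists_primitive_decay {Ω : Set ℂ} (hΩ : Convex ℝ Ω) (hΩo : IsOpen Ω) {R C δ : ℝ}
    (hR : 0 < R) (hδ : 0 < δ)
    (hnorm : ∀ x ∈ Ω, R < ‖x‖) (hray : ∀ x ∈ Ω, ∀ s : ℝ, 1 ≤ s → (s : ℂ) * x ∈ Ω)
    {f : ℂ → ℂ} (hf : DifferentiableOn ℂ f Ω)
    (hb : ∀ x ∈ Ω, ‖f x‖ ≤ C * ‖x‖ ^ (-1 - δ)) :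
    ∃ H : ℂ → ℂ, (∀ x ∈ Ω, HasDerivAt H (f x) x) ∧
      (∀ x ∈ Ω, Tendsto (fun s : ℝ => H (s * x)) atTop (𝓝 0)) ∧
      ∀ x ∈ Ω, ‖H x‖ ≤ C / δ * ‖x‖ ^ (-δ) := by
  obtain ⟨H, hH'⟩ := hΩ.exists_forall_hasDerivWithinAt hf
  have hH : ∀ x ∈ Ω, HasDerivAt H (f x) x := fun x hx => (hH' x hx).hasDerivAt (hΩo.mem_nhds hx)
  rcases Ω.eq_empty_or_nonempty with rfl | ⟨x₀, hx₀⟩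
  · exact ⟨H, by simp⟩
  obtain ⟨L, hL, -⟩ := tendsto_ray hR hδ hnorm hray hf.continuousOn hb hH hx₀
  have hC : 0 ≤ C := by
    have h1 := (norm_nonneg _).trans (hb x₀ hx₀)
    have h2 : 0 < ‖x₀‖ ^ (-1 - δ) := Real.rpow_pos_of_pos (hR.trans (hnorm x₀ hx₀)) _
    exact nonneg_of_mul_nonneg_left h1 h2
  have hdiff : ∀ x ∈ Ω, Tendsto (fun s : ℝ => H (s * x) - H (s * x₀)) atTop (𝓝 0) := by
    intro x hx
    have hlim : Tendsto (fun s : ℝ => C * R ^ (-1 - δ) * ‖x - x₀‖ * s ^ (-δ)) atTop (𝓝 0) := by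
      simpa using (tendsto_rpow_neg_atTop hδ).const_mul (C * R ^ (-1 - δ) * ‖x - x₀‖)
    refine squeeze_zero_norm' ?_ hlim
    filter_upwards [eventually_ge_atTop (1 : ℝ)] with s hs
    have hs0 : 0 < s := by linarith
    have hseg : ∀ z ∈ segment ℝ ((s : ℂ) * x₀) (s * x), z ∈ Ω ∧ s * R ≤ ‖z‖ := by
      rintro z ⟨a, b, ha, hb', hab, rfl⟩
      have hw : a • x₀ + b • x ∈ Ω := hΩ hx₀ hx ha hb' hab
      have : a • ((s : ℂ) * x₀) + b • ((s : ℂ) * x) = s * (a • x₀ + b • x) := by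
        simp only [Complex.real_smul]; ring
      rw [this]
      refine ⟨hray _ hw s hs, ?_⟩
      rw [norm_mul, Complex.norm_real, Real.norm_of_nonneg hs0.le]
      gcongr
      exact (hnorm _ hw).le
    have := (convex_segment (𝕜 := ℝ) ((s : ℂ) * x₀) (s * x)).norm_image_sub_le_of_norm_hasDerivWithin_le
      (C := C * (s * R) ^ (-1 - δ))
      (fun z hz => (hH z (hseg z hz).1).hasDerivWithinAt) (fun z hz => by
        refine (hb z (hseg z hz).1).trans ?_
        gcongr C * ?_
        exact Real.rpow_le_rpow_of_nonpos (by positivity) (hseg z hz).2 (by linarith))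
      (left_mem_segment _ _ _) (right_mem_segment _ _ _)
    refine this.trans (le_of_eq ?_)
    rw [← mul_sub, norm_mul, Complex.norm_real, Real.norm_of_nonneg hs0.le,
      Real.mul_rpow hs0.le hR.le]
    have : s ^ (-δ) = s * s ^ (-1 - δ) := by
      rw [← Real.rpow_one_add' hs0.le (by linarith)]; ring_nf
    rw [this]; ring
  have hlim : ∀ x ∈ Ω, Tendsto (fun s : ℝ => H (s * x)) atTop (𝓝 L) := fun x hx => by
    simpa using (hdiff x hx).add hL
  refine ⟨fun x => H x - L, fun x hx => (hH x hx).sub_const L, fun x hx => ?_, fun x hx => ?_⟩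
  · simpa using (hlim x hx).sub_const L
  · obtain ⟨L', hL', hbd⟩ := tendsto_ray hR hδ hnorm hray hf.continuousOn hb hH hx
    rw [tendsto_nhds_unique hL' (hlim x hx)] at hbd
    rwa [norm_sub_rev]

/-- The half plane at distance `R` from the origin in direction `ζ`. -/
def halfPlane (ζ : ℂ) (R : ℝ) : Set ℂ := {x | R < (x * (starRingEnd ℂ) ζ).re}

lemma isOpen_halfPlane (ζ : ℂ) (R : ℝ) : IsOpen (halfPlane ζ R) :=
  isOpen_lt continuous_const (by fun_prop)

lemma convex_halfPlane (ζ : ℂ) (R : ℝ) : Convex ℝ (halfPlane ζ R) := by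
  refine convex_halfSpace_gt (f := fun x : ℂ => (x * (starRingEnd ℂ) ζ).re) ⟨?_, ?_⟩ R
  · intro x y; simp [add_mul]
  · intro c x; simp
    ring

lemma norm_lt_of_mem_halfPlane {ζ : ℂ} (hζ : ‖ζ‖ = 1) {R : ℝ} {x : ℂ} (hx : x ∈ halfPlane ζ R) :
    R < ‖x‖ := by
  have h1 : R < (x * (starRingEnd ℂ) ζ).re := hx
  refine h1.trans_le ((Complex.re_le_norm _).trans ?_)
  rw [norm_mul, RCLike.norm_conj, hζ, mul_one]

lemma ray_mem_halfPlane {ζ : ℂ} {R : ℝ} (hR : 0 < R) {x : ℂ} (hx : x ∈ halfPlane ζ R) (s : ℝ)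
    (hs : 1 ≤ s) : (s : ℂ) * x ∈ halfPlane ζ R := by
  have h1 : R < (x * (starRingEnd ℂ) ζ).re := hx
  change R < ((s : ℂ) * x * (starRingEnd ℂ) ζ).re
  rw [mul_assoc, Complex.re_ofReal_mul]
  nlinarith

lemma mem_halfPlane_self {R : ℝ} (hR : 0 < R) {x : ℂ} (hx : R < ‖x‖) :
    ‖x / ‖x‖‖ = 1 ∧ x ∈ halfPlane (x / ‖x‖) R := by
  have h0 : (‖x‖ : ℂ) ≠ 0 := by
    rw [Complex.ofReal_ne_zero]; linarith
  constructor
  · simp only [norm_div, Complex.norm_real, norm_norm]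
    exact div_self (by linarith)
  · change R < (x * (starRingEnd ℂ) (x / ‖x‖)).re
    have : x * (starRingEnd ℂ) (x / ‖x‖) = (‖x‖ : ℝ) := by
      rw [map_div₀, Complex.conj_ofReal, ← mul_div_assoc, Complex.mul_conj,
        Complex.normSq_eq_norm_sq]
      field_simp
      push_cast; ring
    rw [this, Complex.ofReal_re]; exact hx

end Razar

namespace Razar
set_option autoImplicit false
open Polynomial Topology
open scoped Polynomial.Bivariate

/-- The polynomial in the outer variable cutting out the fiber `P = c` over the point `x`. -/
noncomputable def spec (P : ℂ[X][Y]) (c x : ℂ) : ℂ[X] :=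
  (P - Polynomial.C (Polynomial.C c)).map (evalRingHom x)

section
variable {P : ℂ[X][Y]} {c : ℂ}

lemma eval_spec (x y : ℂ) : (spec P c x).eval y = ev P (x, y) - c := by
  rw [spec, Polynomial.eval_map, ← coe_eval₂RingHom, map_sub]
  simp [ev, eval₂_evalRingHom]

lemma isRoot_spec_iff {x y : ℂ} : (spec P c x).IsRoot y ↔ (x, y) ∈ fib P c := by
  rw [IsRoot, eval_spec, sub_eq_zero]; rfl

lemma eval_derivative_spec (x y : ℂ) : (spec P c x).derivative.eval y = ev (dy P) (x, y) := by
  rw [spec, derivative_map, derivative_sub, derivative_C, sub_zero, Polynomial.eval_map, dy_apply, ev,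
    eval₂_evalRingHom]

lemma monic_spec (hm : (P - Polynomial.C (Polynomial.C c)).Monic) (x : ℂ) : (spec P c x).Monic :=
  hm.map _

lemma natDegree_spec (hm : (P - Polynomial.C (Polynomial.C c)).Monic) (x : ℂ) :
    (spec P c x).natDegree = (P - Polynomial.C (Polynomial.C c)).natDegree :=
  hm.natDegree_map _

lemma exists_root_bound (hm : (P - Polynomial.C (Polynomial.C c)).Monic) :
    ∃ B : ℂ → ℝ, Continuous B ∧ ∀ z ∈ fib P c, ‖z.2‖ ≤ B z.1 := by
  refine ⟨fun x => ∑ i ∈ Finset.range (P - Polynomial.C (Polynomial.C c)).natDegree,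
    ‖((P - Polynomial.C (Polynomial.C c)).coeff i).eval x‖ + 1, by fun_prop, ?_⟩
  rintro ⟨x, y⟩ hz
  have hs := monic_spec hm x
  have h1 := (isRoot_spec_iff.2 hz).norm_lt_cauchyBound hs.ne_zero
  have h1' : ‖y‖ ≤ (cauchyBound (spec P c x) : ℝ) := by exact_mod_cast h1.le
  refine h1'.trans ?_
  rw [cauchyBound, hs.leadingCoeff, nnnorm_one, div_one, natDegree_spec hm, NNReal.coe_add,
    NNReal.coe_one]
  have : (Finset.range (P - Polynomial.C (Polynomial.C c)).natDegree).sup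
      (fun i => ‖(spec P c x).coeff i‖₊) ≤
      ∑ i ∈ Finset.range (P - Polynomial.C (Polynomial.C c)).natDegree,
        ‖(spec P c x).coeff i‖₊ :=
    Finset.sup_le fun i hi => Finset.single_le_sum (f := fun i => ‖(spec P c x).coeff i‖₊)
      (fun _ _ => zero_le) hi
  refine add_le_add_left ((NNReal.coe_le_coe.2 this).trans (le_of_eq ?_)) 1
  push_cast
  refine Finset.sum_congr rfl fun i _ => ?_
  rw [spec, Polynomial.coeff_map]; rfl

lemma isClosed_fib : IsClosed (fib P c) := isClosed_eq (continuous_ev P) continuous_const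

lemma isProperMap_fib_fst (hm : (P - Polynomial.C (Polynomial.C c)).Monic) :
    IsProperMap (fun z : fib P c => z.1.1) := by
  rw [isProperMap_iff_isCompact_preimage]
  refine ⟨by fun_prop, fun K hK => ?_⟩
  obtain ⟨B, hB, hb⟩ := exists_root_bound hm
  obtain ⟨M, hM⟩ := hK.bddAbove_image hB.continuousOn
  rw [Subtype.isCompact_iff]
  refine (hK.prod (isCompact_closedBall (0 : ℂ) M)).of_isClosed_subset ?_ ?_
  · have : (Subtype.val '' ((fun z : fib P c => z.1.1) ⁻¹' K)) = fib P c ∩ Prod.fst ⁻¹' K := by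
      ext z; simp [and_comm]
    rw [this]
    exact isClosed_fib.inter (hK.isClosed.preimage continuous_fst)
  · rintro _ ⟨⟨z, hz⟩, hzK, rfl⟩
    refine ⟨hzK, ?_⟩
    rw [mem_closedBall_zero_iff]
    exact (hb z hz).trans (hM ⟨_, hzK, rfl⟩)

lemma finite_fib_over (hm : (P - Polynomial.C (Polynomial.C c)).Monic) (x : ℂ) :
    {z | z ∈ fib P c ∧ z.1 = x}.Finite := by
  refine ((spec P c x).roots.toFinset.finite_toSet.image (fun y => (x, y))).subset ?_
  rintro ⟨x', y⟩ ⟨hz, rfl⟩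
  refine ⟨y, ?_, rfl⟩
  simpa [(monic_spec hm x').ne_zero] using isRoot_spec_iff.2 hz

lemma exists_local_branch {p : ℂ × ℂ} (hp : p ∈ fib P c) (hy : ev (dy P) p ≠ 0) :
    ∃ γ : ℂ → ℂ × ℂ, γ p.1 = p ∧ (∀ᶠ z in 𝓝[fib P c] p, γ z.1 = z) ∧
      ∀ᶠ x in 𝓝 p.1, γ x ∈ fib P c ∧ (γ x).1 = x ∧
        HasDerivAt γ (1, -ev (dx P) (γ x) / ev (dy P) (γ x)) x := by
  have hdy : dy (Polynomial.C Polynomial.X : ℂ[X][Y]) = 0 := by rw [dy_apply, derivative_C]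
  have hj : jac P (Polynomial.C Polynomial.X) = - dy P := by
    rw [jac, dx_C, hdy]; simp
  have hneg : ∀ z, ev (- dy P) z = - ev (dy P) z := fun z => by simp [ev]
  have hX : ∀ z, ev (Polynomial.C Polynomial.X) z = z.1 := fun z => by simp
  obtain ⟨γ, h1, h2, h3⟩ := exists_local_curve P (Polynomial.C Polynomial.X) p
    (by rw [hj, hneg]; simpa using hy)
  simp only [hX, hj, hneg] at h1 h2 h3
  have hp' : ev P p = c := hp
  refine ⟨γ, h1, ?_, ?_⟩
  · rw [eventually_nhdsWithin_iff]
    filter_upwards [h2] with z hz hzc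
    exact hz (by rw [hp']; exact hzc)
  · have hγ : ContinuousAt γ p.1 := h3.self_of_nhds.2.2.continuousAt
    have h4 : ∀ᶠ x in 𝓝 p.1, ev (dy P) (γ x) ≠ 0 :=
      ((continuous_ev (dy P)).continuousAt.comp hγ).eventually_ne (by simpa [h1] using hy)
    filter_upwards [h3, h4] with v hv hv4
    refine ⟨hv.1.trans hp', hv.2.1, ?_⟩
    refine hv.2.2.congr_deriv ?_
    rw [neg_div_neg_eq, div_self hv4, div_neg, neg_div]

lemma isCoveringMapOn_fib_fst (hm : (P - Polynomial.C (Polynomial.C c)).Monic) {V : Set ℂ}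
    (hVy : ∀ z ∈ fib P c, z.1 ∈ V → ev (dy P) z ≠ 0) :
    IsCoveringMapOn (fun z : fib P c => z.1.1) V := by
  refine (isProperMap_fib_fst hm).isClosedMap.isCoveringMapOn_of_isLocalHomeomorphOn ?_ ?_
  · intro x _
    have := (finite_fib_over hm x).preimage (f := fun z : fib P c => z.1)
      (Subtype.val_injective.injOn)
    refine this.subset fun z hz => ⟨z.2, hz⟩
  · rw [isLocalHomeomorphOn_iff_isOpenEmbedding_restrict]
    intro p hpV
    have hloc : ∀ p : fib P c, ev (dy P) p.1 ≠ 0 → ∃ γ : ℂ → ℂ × ℂ, γ p.1.1 = p ∧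
      (∀ᶠ z : fib P c in 𝓝 p, γ z.1.1 = z) ∧
      ∀ᶠ x in 𝓝 p.1.1, γ x ∈ fib P c ∧ (γ x).1 = x ∧
        HasDerivAt γ (1, -ev (dx P) (γ x) / ev (dy P) (γ x)) x := by
      intro p hp
      obtain ⟨γ, h1, h2, h3⟩ := exists_local_branch p.2 hp
      refine ⟨γ, h1, ?_, h3⟩
      have := map_nhds_subtype_val p
      rw [← this, eventually_map] at h2
      exact h2
    obtain ⟨γ, -, h2, -⟩ := hloc p (hVy p.1 p.2 hpV)
    have hy : ∀ᶠ z : fib P c in 𝓝 p, ev (dy P) z.1 ≠ 0 :=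
      ((continuous_ev (dy P)).comp continuous_subtype_val).continuousAt.eventually_ne
        (hVy p.1 p.2 hpV)
    obtain ⟨U, hU, hUo, hpU⟩ := eventually_nhds_iff.1 (h2.and hy)
    refine ⟨U, hUo.mem_nhds hpU, ?_⟩
    refine Topology.IsOpenEmbedding.of_continuous_injective_isOpenMap ?_ ?_ ?_
    · exact (by fun_prop : Continuous fun z : fib P c => z.1.1).comp continuous_subtype_val
    · rintro ⟨a, ha⟩ ⟨b, hb⟩ hab
      have hab' : a.1.1 = b.1.1 := hab
      have : a.1 = b.1 := by rw [← (hU a ha).1, ← (hU b hb).1, hab']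
      exact Subtype.ext (Subtype.ext this)
    · have : U.domRestrict (fun z : fib P c => z.1.1) =
        fun z : U => (fun z : fib P c => z.1.1) z.1 := rfl
      rw [isOpenMap_iff_nhds_le]
      rintro ⟨a, ha⟩
      obtain ⟨γ, h1, -, h3⟩ := hloc a (hU a ha).2
      have hmap : map (U.domRestrict (fun z : fib P c => z.1.1)) (𝓝 ⟨a, ha⟩) =
          map (fun z : fib P c => z.1.1) (𝓝 a) := by
        rw [this, ← Function.comp_def (fun z : fib P c => z.1.1) Subtype.val, ← Filter.map_map,
          map_nhds_subtype_coe_eq_nhds ha (hUo.mem_nhds ha)]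
      rw [hmap]
      have hmap2 : map (fun z : fib P c => z.1.1) (𝓝 a) = map Prod.fst (𝓝[fib P c] a.1) := by
        rw [← map_nhds_subtype_val, Filter.map_map]; rfl
      rw [hmap2]
      have hγ : Tendsto γ (𝓝 a.1.1) (𝓝[fib P c] a.1) := by
        refine tendsto_nhdsWithin_iff.2 ⟨?_, h3.mono fun _ h => h.1⟩
        have := h3.self_of_nhds.2.2.continuousAt.tendsto
        rwa [h1] at this
      change 𝓝 a.1.1 ≤ _
      calc 𝓝 a.1.1 = map (fun x => (γ x).1) (𝓝 a.1.1) := by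
            conv_lhs => rw [← Filter.map_id (f := 𝓝 a.1.1)]
            exact Filter.map_congr (h3.mono fun x h => h.2.1.symm)
        _ = map Prod.fst (map γ (𝓝 a.1.1)) := by rw [Filter.map_map]; rfl
        _ ≤ _ := Filter.map_mono hγ

lemma exists_branch (hm : (P - Polynomial.C (Polynomial.C c)).Monic) {V : Set ℂ}
    (hVo : IsOpen V) (hVc : Convex ℝ V) (hVy : ∀ z ∈ fib P c, z.1 ∈ V → ev (dy P) z ≠ 0)
    {p : ℂ × ℂ} (hp : p ∈ fib P c) (hpV : p.1 ∈ V) :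
    ∃ β : ℂ → ℂ × ℂ, β p.1 = p ∧ ContinuousOn β V ∧
      ∀ x ∈ V, β x ∈ fib P c ∧ (β x).1 = x := by
  have : ContractibleSpace V := hVc.contractibleSpace ⟨p.1, hpV⟩
  have : LocallyPathConnectedSpace V := hVo.locallyPathConnectedSpace
  obtain ⟨F, ⟨hF1, hF2⟩, -⟩ :=
    (isCoveringMapOn_fib_fst hm hVy).existsUnique_continuousMap_lifts
    (⟨Subtype.val, continuous_subtype_val⟩ : C(V, ℂ)) (a₀ := ⟨p.1, hpV⟩) (e₀ := ⟨p, hp⟩) rfl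
    (fun a => a.2)
  classical
  refine ⟨fun x => if h : x ∈ V then (F ⟨x, h⟩).1 else 0, ?_, ?_, ?_⟩
  · simp [hpV, hF1]
  · rw [continuousOn_iff_continuous_domRestrict]
    have : Continuous (fun x : V => (F x).1) := by fun_prop
    refine this.congr fun x => ?_
    simp
  · intro x hx
    simp only [hx, dite_true]
    exact ⟨(F ⟨x, hx⟩).2, congrFun hF2 ⟨x, hx⟩⟩

lemma hasDerivAt_of_branch {β : ℂ → ℂ × ℂ} {x : ℂ} (hc : ContinuousAt β x)
    (hb : ∀ᶠ x' in 𝓝 x, β x' ∈ fib P c ∧ (β x').1 = x') (hy : ev (dy P) (β x) ≠ 0) :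
    HasDerivAt β (1, -ev (dx P) (β x) / ev (dy P) (β x)) x := by
  obtain ⟨γ, h1, h2, h3⟩ := exists_local_branch hb.self_of_nhds.1 hy
  have hx := hb.self_of_nhds.2
  rw [hx] at h1 h3
  have ht : Tendsto β (𝓝 x) (𝓝[fib P c] (β x)) :=
    tendsto_nhdsWithin_iff.2 ⟨hc, hb.mono fun _ h => h.1⟩
  have := h3.self_of_nhds.2.2
  rw [h1] at this
  refine this.congr_of_eventuallyEq ?_
  filter_upwards [ht.eventually h2, hb] with x' h hb'
  rw [← h, hb'.2]

lemma eq_of_branch {V : Set ℂ} (hV : IsPreconnected V) {β₁ β₂ : ℂ → ℂ × ℂ}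
    (hVo : IsOpen V) (hVy : ∀ z ∈ fib P c, z.1 ∈ V → ev (dy P) z ≠ 0)
    (h₁ : ContinuousOn β₁ V) (h₂ : ContinuousOn β₂ V)
    (hb₁ : ∀ x ∈ V, β₁ x ∈ fib P c ∧ (β₁ x).1 = x) (hb₂ : ∀ x ∈ V, β₂ x ∈ fib P c ∧ (β₂ x).1 = x)
    {x₀ : ℂ} (hx₀ : x₀ ∈ V) (he : β₁ x₀ = β₂ x₀) : Set.EqOn β₁ β₂ V := by
  have key : ∀ x ∈ V, (∀ᶠ x' in 𝓝[V] x, β₁ x' = β₂ x') ∨ (∀ᶠ x' in 𝓝[V] x, β₁ x' ≠ β₂ x') := by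
    intro x hx
    by_cases hxe : β₁ x = β₂ x
    · left
      obtain ⟨γ, h1, h2, h3⟩ := exists_local_branch (hb₁ x hx).1
        (hVy _ (hb₁ x hx).1 ((hb₁ x hx).2.symm ▸ hx))
      have t1 : Tendsto β₁ (𝓝[V] x) (𝓝[fib P c] (β₁ x)) :=
        tendsto_nhdsWithin_iff.2 ⟨h₁ x hx, eventually_nhdsWithin_of_forall fun y hy => (hb₁ y hy).1⟩
      have t2 : Tendsto β₂ (𝓝[V] x) (𝓝[fib P c] (β₁ x)) :=
        tendsto_nhdsWithin_iff.2 ⟨hxe ▸ h₂ x hx,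
          eventually_nhdsWithin_of_forall fun y hy => (hb₂ y hy).1⟩
      filter_upwards [t1.eventually h2, t2.eventually h2, self_mem_nhdsWithin] with y e1 e2 hy
      rw [← e1, ← e2, (hb₁ y hy).2, (hb₂ y hy).2]
    · right
      exact ((h₁ x hx).prodMk (h₂ x hx)).eventually
        ((isClosed_diagonal (X := ℂ × ℂ)).isOpen_compl.mem_nhds (by simpa using hxe))
        |>.mono fun y hy => by simpa using hy
  have hcl := hV.subset_of_closure_inter_subset (u := interior {x | β₁ x = β₂ x})
  intro x hx
  suffices h : x ∈ interior {x | β₁ x = β₂ x} from interior_subset (s := {x | β₁ x = β₂ x}) h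
  refine hcl isOpen_interior ⟨x₀, hx₀, ?_⟩ ?_ hx
  · rcases key x₀ hx₀ with h | h
    · rw [hVo.nhdsWithin_eq hx₀] at h
      exact mem_interior_iff_mem_nhds.2 h
    · exact absurd he (h.self_of_nhdsWithin hx₀)
  · rintro y ⟨hyc, hyV⟩
    rcases key y hyV with h | h
    · rw [hVo.nhdsWithin_eq hyV] at h
      exact mem_interior_iff_mem_nhds.2 h
    · rw [hVo.nhdsWithin_eq hyV] at h
      obtain ⟨w, hw1, hw2⟩ := mem_closure_iff_nhds.1 hyc _ h
      exact absurd (interior_subset (s := {x | β₁ x = β₂ x}) hw2) hw1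

end

end Razar

namespace Razar
set_option autoImplicit false
open Polynomial Topology
open scoped Polynomial.Bivariate

section
variable {P Q g : ℂ[X][Y]} {c : ℂ}

lemma branch_eventually_eq {β : ℂ → ℂ × ℂ} {p : ℂ × ℂ} (hp : p ∈ fib P c)
    (hy : ev (dy P) p ≠ 0) (hβp : β p.1 = p) (hβ : ContinuousAt β p.1)
    (hb : ∀ᶠ x in 𝓝 p.1, β x ∈ fib P c ∧ (β x).1 = x) :
    ∀ᶠ z in 𝓝[fib P c] p, β z.1 = z := by
  obtain ⟨γ, -, h2, -⟩ := exists_local_branch hp hy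
  have ht : Tendsto β (𝓝 p.1) (𝓝[fib P c] p) :=
    tendsto_nhdsWithin_iff.2 ⟨by simpa only [ContinuousAt, hβp] using hβ, hb.mono fun _ h => h.1⟩
  have h3 : ∀ᶠ x in 𝓝 p.1, γ x = β x := by
    filter_upwards [ht.eventually h2, hb] with x h h'
    rw [← h, h'.2]
  have hfst : Tendsto Prod.fst (𝓝[fib P c] p) (𝓝 p.1) :=
    continuous_fst.continuousAt.tendsto.mono_left nhdsWithin_le_nhds
  filter_upwards [hfst.eventually h3, h2] with z hz hz2
  rw [← hz, hz2]

variable {R C δ : ℝ}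

lemma exists_ray_primitive (hm : (P - Polynomial.C (Polynomial.C c)).Monic)
    (hR : 0 < R) (hδ : 0 < δ)
    (hb : ∀ z ∈ fib P c, R < ‖z.1‖ → ev (dy P) z ≠ 0 ∧
      ‖ev g z‖ ≤ C * ‖ev (dy P) z‖ * ‖z.1‖ ^ (-1 - δ)) {p : ℂ × ℂ} (hp : p ∈ fib P c)
    (hpR : R < ‖p.1‖) :
    ∃ (β : ℂ → ℂ × ℂ) (H : ℂ → ℂ), β p.1 = p ∧ ContinuousOn β (halfPlane (p.1 / ‖p.1‖) R) ∧
      ∀ x ∈ halfPlane (p.1 / ‖p.1‖) R, β x ∈ fib P c ∧ (β x).1 = x ∧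
        HasDerivAt H (-ev g (β x) / ev (dy P) (β x)) x ∧
        Tendsto (fun s : ℝ => H (s * x)) atTop (𝓝 0) ∧ ‖H x‖ ≤ C / δ * ‖x‖ ^ (-δ) := by
  obtain ⟨hζ, hpV⟩ := mem_halfPlane_self hR hpR
  set V := halfPlane (p.1 / ‖p.1‖) R
  have hVo : IsOpen V := isOpen_halfPlane _ _
  obtain ⟨β, h1, h2, h3⟩ := exists_branch hm hVo (convex_halfPlane _ _)
    (fun z hz hzV => (hb z hz (norm_lt_of_mem_halfPlane hζ hzV)).1) hp hpV
  have hx : ∀ x ∈ V, ev (dy P) (β x) ≠ 0 ∧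
      ‖ev g (β x)‖ ≤ C * ‖ev (dy P) (β x)‖ * ‖x‖ ^ (-1 - δ) := by
    intro x hx
    have := hb _ (h3 x hx).1
    rw [(h3 x hx).2] at this
    exact this (norm_lt_of_mem_halfPlane hζ hx)
  have hβ : ∀ x ∈ V, HasDerivAt β (1, -ev (dx P) (β x) / ev (dy P) (β x)) x := fun x hxV =>
    hasDerivAt_of_branch (h2.continuousAt (hVo.mem_nhds hxV))
      (eventually_of_mem (hVo.mem_nhds hxV) h3) (hx x hxV).1
  have hd : ∀ U : ℂ[X][Y], DifferentiableOn ℂ (fun x => ev U (β x)) V := fun U x hxV =>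
    ((hasStrictFDerivAt_ev U _).hasFDerivAt.comp_hasDerivAt x
      (hβ x hxV)).differentiableAt.differentiableWithinAt
  obtain ⟨H, hH1, hH2, hH3⟩ := exists_primitive_decay (C := C) (convex_halfPlane _ _) hVo hR hδ
    (fun x hx => norm_lt_of_mem_halfPlane hζ hx) (fun x hx s hs => ray_mem_halfPlane hR hx s hs)
    (f := fun x => -ev g (β x) / ev (dy P) (β x))
    ((hd g).neg.div (hd (dy P)) fun x hxV => (hx x hxV).1) (fun x hxV => by
      rw [norm_div, norm_neg, div_le_iff₀ (norm_pos_iff.2 (hx x hxV).1)]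
      exact (hx x hxV).2.trans_eq (by ring))
  exact ⟨β, H, h1, h2, fun x hxV => ⟨(h3 x hxV).1, (h3 x hxV).2, hH1 x hxV, hH2 x hxV, hH3 x hxV⟩⟩

lemma exists_isPrim_near_infinity (hJ : jac P Q = 1)
    (hm : (P - Polynomial.C (Polynomial.C c)).Monic) (hR : 0 < R) (hδ : 0 < δ) (hC : 0 ≤ C)
    (hb : ∀ z ∈ fib P c, R < ‖z.1‖ → ev (dy P) z ≠ 0 ∧
      ‖ev g z‖ ≤ C * ‖ev (dy P) z‖ * ‖z.1‖ ^ (-1 - δ)) :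
    ∃ h : ℂ × ℂ → ℂ, ∀ p ∈ fib P c, R < ‖p.1‖ →
      IsPrim P Q g c h p ∧ ‖h p‖ ≤ C / δ * R ^ (-δ) := by
  classical
  choose! β H hβ using fun (p : ℂ × ℂ) (h : p ∈ fib P c ∧ R < ‖p.1‖) =>
    exists_ray_primitive hm hR hδ hb h.1 h.2
  refine ⟨fun p => H p p.1, fun p hp hpR => ⟨?_, ?_⟩⟩
  · have hpV := mem_halfPlane_self hR hpR
    obtain ⟨h1, h2, h3⟩ := hβ p ⟨hp, hpR⟩
    have hVo : IsOpen (halfPlane (p.1 / ‖p.1‖) R) := isOpen_halfPlane _ _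
    have hVn := hVo.mem_nhds hpV.2
    refine IsPrim.of_branch hJ hp (hb p hp hpR).1 (H := H p) ?_
    have hfst : Tendsto Prod.fst (𝓝[fib P c] p) (𝓝 p.1) :=
      continuous_fst.continuousAt.tendsto.mono_left nhdsWithin_le_nhds
    have he := branch_eventually_eq hp (hb p hp hpR).1 h1 (h2.continuousAt hVn)
      (eventually_of_mem hVn fun x hx => ⟨(h3 x hx).1, (h3 x hx).2.1⟩)
    filter_upwards [he, self_mem_nhdsWithin, hfst.eventually hVn] with z hz hzf hzV
    have hzR : R < ‖z.1‖ := norm_lt_of_mem_halfPlane hpV.1 hzV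
    obtain ⟨k1, k2, k3⟩ := hβ z ⟨hzf, hzR⟩
    have hzV' := mem_halfPlane_self hR hzR
    have hd := (h3 _ hzV).2.2.1
    rw [hz] at hd
    refine ⟨?_, hd⟩
    set W := halfPlane (p.1 / ‖p.1‖) R ∩ halfPlane (z.1 / ‖z.1‖) R with hW
    have hWc : Convex ℝ W := (convex_halfPlane _ _).inter (convex_halfPlane _ _)
    have hWo : IsOpen W := hVo.inter (isOpen_halfPlane _ _)
    have hzW : z.1 ∈ W := ⟨hzV, hzV'.2⟩
    have heq : Set.EqOn (β p) (β z) W := eq_of_branch (P := P) (c := c) hWc.isPreconnected hWo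
      (fun w hw hwW => (hb w hw (norm_lt_of_mem_halfPlane hpV.1 hwW.1)).1)
      (h2.mono Set.inter_subset_left) (k2.mono Set.inter_subset_right)
      (fun x hx => ⟨(h3 x hx.1).1, (h3 x hx.1).2.1⟩) (fun x hx => ⟨(k3 x hx.2).1, (k3 x hx.2).2.1⟩)
      hzW (by rw [hz, k1])
    have hder : ∀ x ∈ W, HasDerivAt (fun x => H z x - H p x) 0 x := by
      intro x hx
      refine ((k3 x hx.2).2.2.1.fun_sub (h3 x hx.1).2.2.1).congr_deriv ?_
      rw [heq hx, sub_self]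
    have hconst : ∀ x ∈ W, H z x - H p x = H z z.1 - H p z.1 := fun x hx =>
      hWo.is_const_of_deriv_eq_zero hWc.isPreconnected
        (fun x hx => (hder x hx).differentiableAt.differentiableWithinAt)
        (fun x hx => (hder x hx).deriv) hx hzW
    have hlim : Tendsto (fun s : ℝ => H z (s * z.1) - H p (s * z.1)) atTop (𝓝 (0 - 0)) :=
      ((k3 _ hzV'.2).2.2.2.1).sub ((h3 _ hzV).2.2.2.1)
    have hlim2 : Tendsto (fun s : ℝ => H z (s * z.1) - H p (s * z.1)) atTop
        (𝓝 (H z z.1 - H p z.1)) := by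
      refine tendsto_const_nhds.congr' ?_
      filter_upwards [eventually_ge_atTop 1] with s hs
      exact (hconst _ ⟨ray_mem_halfPlane hR hzV s hs, ray_mem_halfPlane hR hzV'.2 s hs⟩).symm
    have := tendsto_nhds_unique hlim hlim2
    rw [sub_zero] at this
    exact sub_eq_zero.1 this.symm
  · obtain ⟨-, -, h3⟩ := hβ p ⟨hp, hpR⟩
    refine (h3 _ (mem_halfPlane_self hR hpR).2).2.2.2.2.trans ?_
    gcongr ?_ * ?_
    exact Real.rpow_le_rpow_of_nonpos hR hpR.le (by linarith)

end

end Razar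

namespace Razar
set_option autoImplicit false
open Polynomial Topology
open scoped Polynomial.Bivariate

lemma isPreconnected_lt_norm {M : ℝ} (hM : 0 < M) : IsPreconnected {z : ℂ | M < ‖z‖} := by
  have h : {z : ℂ | M < ‖z‖} = Complex.exp '' {w | Real.log M < w.re} := by
    ext z
    constructor
    · intro hz
      have hz' : M < ‖z‖ := hz
      have hz0 : z ≠ 0 := by rintro rfl; simp at hz'; linarith
      refine ⟨Complex.log z, ?_, Complex.exp_log hz0⟩
      change Real.log M < (Complex.log z).re
      rw [Complex.log_re]
      exact Real.log_lt_log hM hz'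
    · rintro ⟨w, hw, rfl⟩
      change M < _
      rw [Complex.norm_exp]
      exact (Real.log_lt_iff_lt_exp hM).1 hw
  rw [h]
  refine IsPreconnected.image ?_ _ Complex.continuous_exp.continuousOn
  exact (convex_halfSpace_re_gt _).isPreconnected

lemma eq_of_eventually_eq {α γ : Type*} [TopologicalSpace α] {S : Set α}
    (hS : IsPreconnected S) {f : α → γ} (hf : ∀ x ∈ S, ∀ᶠ x' in 𝓝 x, f x' = f x) {a b : α}
    (ha : a ∈ S) (hb : b ∈ S) : f a = f b := by
  refine hS.induction₂ (fun x y => f x = f y) (fun x hx => ?_) (fun _ _ _ _ _ _ => Eq.trans)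
    (fun _ _ _ _ => Eq.symm) ha hb
  exact ((hf x hx).mono fun _ h => h.symm).filter_mono nhdsWithin_le_nhds

section
variable {P Q g : ℂ[X][Y]} {c : ℂ}

lemma IsPrim.eventually_norm_le {h : ℂ × ℂ → ℂ} {p : ℂ × ℂ} (hp : p ∈ fib P c)
    (H : IsPrim P Q g c h p) : ∃ M : ℝ, ∀ᶠ z in 𝓝[fib P c] p, ‖h z‖ ≤ M := by
  obtain ⟨K, hK⟩ := H
  have hd := (hK.self_of_nhdsWithin hp).2.continuousAt
  have hQ : Tendsto (ev Q) (𝓝[fib P c] p) (𝓝 (ev Q p)) :=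
    (continuous_ev Q).continuousAt.tendsto.mono_left nhdsWithin_le_nhds
  have := (hd.tendsto.comp hQ).norm.eventually (ge_mem_nhds (lt_add_one ‖K (ev Q p)‖))
  refine ⟨‖K (ev Q p)‖ + 1, ?_⟩
  filter_upwards [this, hK] with z hz hz2
  rw [hz2.1]; exact hz

lemma exists_isPrim_glue (hJ : jac P Q = 1) {T : Finset ℂ}
    (φ : fib P c ≃ₜ {z : ℂ // z ∉ T}) (K : Set (fib P c)) (hK : IsCompact K)
    {h₀ : ℂ × ℂ → ℂ} (h₀p : ∀ p : fib P c, p ∉ K → IsPrim P Q g c h₀ p) {M₀ : ℝ}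
    (h₀b : ∀ p : fib P c, p ∉ K → ‖h₀ p‖ ≤ M₀) :
    ∃ h : ℂ × ℂ → ℂ, (∀ p ∈ fib P c, IsPrim P Q g c h p) ∧ ∃ M, ∀ p ∈ fib P c, ‖h p‖ ≤ M := by
  classical
  set ψ : ℂ → ℂ × ℂ := fun z => if hz : z ∈ T then 0 else (φ.symm ⟨z, hz⟩).1 with hψ
  have hψf : ∀ z, z ∉ T → ψ z ∈ fib P c := by
    intro z hz; simp only [hψ, hz, dite_false]; exact (φ.symm ⟨z, hz⟩).2
  have hTo : IsOpen {z : ℂ | z ∉ T} := T.finite_toSet.isClosed.isOpen_compl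
  have hψc : ∀ z, z ∉ T → Tendsto ψ (𝓝 z) (𝓝[fib P c] (ψ z)) := by
    intro z hz
    refine tendsto_nhdsWithin_iff.2 ⟨?_, eventually_of_mem (hTo.mem_nhds hz) hψf⟩
    have : ContinuousOn ψ {z : ℂ | z ∉ T} := by
      rw [continuousOn_iff_continuous_domRestrict]
      have : Continuous fun z : {z : ℂ // z ∉ T} => (φ.symm z).1 := by fun_prop
      refine this.congr fun x => ?_
      have := x.2
      simp only [hψ, Set.domRestrict_apply]
      rw [dif_neg this]
    exact this.continuousAt (hTo.mem_nhds hz)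
  set K' : Set ℂ := (fun p : fib P c => (φ p).1) '' K with hK'
  have hK'c : IsCompact K' := hK.image (by fun_prop)
  have hψK : ∀ z (hz : z ∉ T), z ∉ K' → φ.symm ⟨z, hz⟩ ∉ K := by
    intro z hz hzK hm
    exact hzK ⟨_, hm, by simp⟩
  have hψp : ∀ z, z ∉ T → z ∉ K' → IsPrim P Q g c h₀ (ψ z) := by
    intro z hz hzK
    have := h₀p _ (hψK z hz hzK)
    simpa only [hψ, hz, dite_false] using this
  have hψb : ∀ z, z ∉ T → z ∉ K' → ‖h₀ (ψ z)‖ ≤ M₀ := by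
    intro z hz hzK
    have := h₀b _ (hψK z hz hzK)
    simpa only [hψ, hz, dite_false] using this
  have hφψ : ∀ p : fib P c, ψ (φ p).1 = p := by
    intro p
    have := (φ p).2
    simp only [hψ]
    rw [dif_neg this]
    simp
  have hTK : ∀ i ∈ T, i ∉ K' := by
    rintro i hi ⟨p, -, rfl⟩
    exact (φ p).2 hi
  have hloc : ∀ i : ℂ, ∃ (U : Set ℂ) (hh : ℂ × ℂ → ℂ), IsOpen U ∧ i ∈ U ∧
      (∀ b ∈ U, b ∈ T → b = i) ∧ (∀ b ∈ U, b ∉ T → IsPrim P Q g c hh (ψ b)) ∧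
      (i ∈ T → hh = h₀ ∧ ∀ b ∈ U, b ∉ K') := by
    intro i
    by_cases hi : i ∈ T
    · refine ⟨((T.erase i : Finset ℂ) : Set ℂ)ᶜ ∩ K'ᶜ, h₀,
        (T.erase i).finite_toSet.isClosed.isOpen_compl.inter hK'c.isClosed.isOpen_compl,
        ⟨by simp, hTK i hi⟩, ?_, fun b hb hbT => hψp b hbT hb.2, fun _ => ⟨rfl, fun b hb => hb.2⟩⟩
      intro b hb hbT
      by_contra hne
      exact hb.1 (by simp [hne, hbT])
    · obtain ⟨hh, hhp⟩ := exists_isPrim hJ g (hψf i hi)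
      have h1 := (hψc i hi).eventually hhp.eventually
      obtain ⟨U, hU, hUo, hiU⟩ := eventually_nhds_iff.1 (h1.and (hTo.mem_nhds hi))
      exact ⟨U, hh, hUo, hiU, fun b hb hbT => absurd hbT (hU b hb).2,
        fun b hb _ => (hU b hb).1, fun h => absurd h hi⟩
  choose U hh hUo hiU hUT hUp hUK using hloc
  obtain ⟨h, hh'⟩ := @exists_glue ℂ ℂ ℂ _ _ _ _ ⊥ (@DiscreteTopology.mk _ ⊥ rfl) U hUo id hiU
    (fun i b => hh i (ψ b)) (by
      intro i j b hbi hbj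
      rcases eq_or_ne i j with rfl | hij
      · simp
      have hbT : b ∉ T := fun hbT => hij ((hUT i b hbi hbT).symm.trans (hUT j b hbj hbT))
      exact (hψc b hbT).eventually
        ((hUp i b hbi hbT).sub_eventually_eq hJ (hψf b hbT) (hUp j b hbj hbT)))
  set hG : ℂ × ℂ → ℂ := fun p => if hp : p ∈ fib P c then h (φ ⟨p, hp⟩).1 else 0 with hGd
  have hGψ : ∀ p : fib P c, hG p = h (φ p).1 := fun p => by simp [hGd]
  have hprim : ∀ p ∈ fib P c, IsPrim P Q g c hG p := by
    intro p hp
    have hb := (φ ⟨p, hp⟩).2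
    set b := (φ ⟨p, hp⟩).1 with hbd
    have hp1 := hUp b b (hiU b) hb
    rw [hφψ ⟨p, hp⟩] at hp1
    refine hp1.congr ?_
    have h2 := hh' b b (hiU b)
    have h3 : Tendsto (fun q : fib P c => (φ q).1) (𝓝 ⟨p, hp⟩) (𝓝 b) :=
      (by fun_prop : Continuous fun q : fib P c => (φ q).1).continuousAt
    have h4 := h3.eventually h2
    rw [← map_nhds_subtype_val ⟨p, hp⟩, eventually_map]
    filter_upwards [h4] with q hq
    rw [hφψ] at hq
    rw [hGψ, hGψ ⟨p, hp⟩, hq]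
    change h b - hh b (ψ b) = _
    rw [hbd, hφψ]
  refine ⟨hG, hprim, ?_⟩
  have hGh : ∀ z, z ∉ T → hG (ψ z) = h z := by
    intro z hz
    rw [show ψ z = (φ.symm ⟨z, hz⟩).1 by simp only [hψ, hz, dite_false], hGψ]
    simp
  obtain ⟨M₁, hM₁⟩ := (T.finite_toSet.isBounded.union hK'c.isBounded).exists_norm_le
  have hout : ∀ z : ℂ, max M₁ 1 < ‖z‖ → z ∉ T ∧ z ∉ K' := fun z hz =>
    ⟨fun h => absurd (hM₁ z (Or.inl h)) (not_le.2 ((le_max_left _ _).trans_lt hz)),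
      fun h => absurd (hM₁ z (Or.inr h)) (not_le.2 ((le_max_left _ _).trans_lt hz))⟩
  have hfar : ∃ M, ∀ z : ℂ, max M₁ 1 < ‖z‖ → ‖h z‖ ≤ M := by
    obtain ⟨w, hw⟩ : ∃ w : ℂ, max M₁ 1 < ‖w‖ := NormedField.exists_lt_norm ℂ _
    refine ⟨M₀ + ‖h w - h₀ (ψ w)‖, fun z hz => ?_⟩
    have : h z - h₀ (ψ z) = h w - h₀ (ψ w) := by
      refine eq_of_eventually_eq (f := fun z => h z - h₀ (ψ z))
        (isPreconnected_lt_norm (M := max M₁ 1) (by positivity)) ?_ hz hw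
      intro x hx
      obtain ⟨hxT, hxK⟩ := hout x hx
      have e1 := hh' x x (hiU x)
      have e2 := (hψc x hxT).eventually ((hUp x x (hiU x) hxT).sub_eventually_eq hJ (hψf x hxT)
        (hψp x hxT hxK))
      filter_upwards [e1, e2] with y h1 h2
      linear_combination h1 + h2
    calc ‖h z‖ = ‖h₀ (ψ z) + (h w - h₀ (ψ w))‖ := by rw [← this]; ring_nf
      _ ≤ _ := (norm_add_le _ _).trans (by
        gcongr
        exact hψb z (hout z hz).1 (hout z hz).2)
  have hnear : ∃ M, ∀ z ∈ Metric.closedBall (0 : ℂ) (max M₁ 1), z ∉ T → ‖h z‖ ≤ M := by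
    refine (isCompact_closedBall (0 : ℂ) (max M₁ 1)).induction_on
      (p := fun s => ∃ M, ∀ z ∈ s, z ∉ T → ‖h z‖ ≤ M) ⟨0, by simp⟩
      (fun s t hst ⟨M, hM⟩ => ⟨M, fun z hz => hM z (hst hz)⟩)
      (fun s t ⟨M, hM⟩ ⟨N, hN⟩ => ⟨max M N, fun z hz hzT => ?_⟩) (fun x _ => ?_)
    · rcases hz with hz | hz
      · exact (hM z hz hzT).trans (le_max_left _ _)
      · exact (hN z hz hzT).trans (le_max_right _ _)
    by_cases hx : x ∈ T
    · obtain ⟨e1, e2⟩ := hUK x hx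
      refine ⟨_, nhdsWithin_le_nhds ((hh' x x (hiU x)).and ((hUo x).mem_nhds (hiU x))),
        M₀ + ‖h x - hh x (ψ x)‖, ?_⟩
      rintro z ⟨hz, hzU⟩ hzT
      calc ‖h z‖ = ‖hh x (ψ z) + (h x - hh x (ψ x))‖ := by rw [← hz]; ring_nf
        _ ≤ _ := (norm_add_le _ _).trans (by
          gcongr
          rw [e1]
          exact hψb z hzT (e2 z hzU))
    · obtain ⟨M, hM⟩ := (hprim _ (hψf x hx)).eventually_norm_le (hψf x hx)
      refine ⟨_, nhdsWithin_le_nhds ((hψc x hx).eventually hM), M, fun z hz hzT => ?_⟩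
      rw [← hGh z hzT]
      exact hz
  obtain ⟨M, hM⟩ := hfar
  obtain ⟨N, hN⟩ := hnear
  refine ⟨max M N, fun p hp => ?_⟩
  rw [hGψ ⟨p, hp⟩]
  by_cases hfp : max M₁ 1 < ‖(φ ⟨p, hp⟩).1‖
  · exact (hM _ hfp).trans (le_max_left _ _)
  · exact (hN _ (by simpa using not_lt.1 hfp) (φ ⟨p, hp⟩).2).trans (le_max_right _ _)

lemma exists_bounded_isPrim (hJ : jac P Q = 1)
    (hm : (P - Polynomial.C (Polynomial.C c)).Monic) {T : Finset ℂ}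
    (φ : fib P c ≃ₜ {z : ℂ // z ∉ T}) {R C δ : ℝ} (hR : 0 < R) (hδ : 0 < δ) (hC : 0 ≤ C)
    (hb : ∀ z ∈ fib P c, R < ‖z.1‖ → ev (dy P) z ≠ 0 ∧
      ‖ev g z‖ ≤ C * ‖ev (dy P) z‖ * ‖z.1‖ ^ (-1 - δ)) :
    ∃ h : ℂ × ℂ → ℂ, (∀ p ∈ fib P c, IsPrim P Q g c h p) ∧ ∃ M, ∀ p ∈ fib P c, ‖h p‖ ≤ M := by
  obtain ⟨h₀, hh₀⟩ := exists_isPrim_near_infinity hJ hm hR hδ hC hb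
  have hK := (isProperMap_fib_fst hm).isCompact_preimage (isCompact_closedBall (0 : ℂ) R)
  refine exists_isPrim_glue hJ φ _ hK (h₀ := h₀) (M₀ := C / δ * R ^ (-δ)) ?_ ?_
  · intro p hp
    exact (hh₀ p p.2 (by simpa using hp)).1
  · intro p hp
    exact (hh₀ p p.2 (by simpa using hp)).2

end

end Razar

namespace Razar
set_option autoImplicit false
open Polynomial Topology
open scoped Polynomial.Bivariate

lemma eq_of_bounded_of_differentiable_off_finset {f : ℂ → ℂ} {B : Finset ℂ}
    (hf : ∀ x, x ∉ B → DifferentiableAt ℂ f x) {M : ℝ} (hM : ∀ x, x ∉ B → ‖f x‖ ≤ M)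
    {x y : ℂ} (hx : x ∉ B) (hy : y ∉ B) : f x = f y := by
  classical
  set F : ℂ → ℂ := fun x => limUnder (𝓝[≠] x) f with hF
  have hFf : ∀ x, x ∉ B → F x = f x := fun x hx =>
    ((hf x hx).continuousAt.tendsto.mono_left nhdsWithin_le_nhds).limUnder_eq
  have hBo : ∀ x, x ∉ B → ∀ᶠ x' in 𝓝 x, x' ∉ B := fun x hx =>
    B.finite_toSet.isClosed.isOpen_compl.mem_nhds hx
  have hFd : Differentiable ℂ F := by
    intro x
    by_cases hx : x ∈ B
    · set s : Set ℂ := ((B.erase x : Finset ℂ) : Set ℂ)ᶜ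
      have hs : s ∈ 𝓝 x := (B.erase x).finite_toSet.isClosed.isOpen_compl.mem_nhds (by simp)
      have hsB : ∀ y ∈ s \ {x}, y ∉ B := fun y hy hyB => hy.1 (by
        have : y ≠ x := hy.2
        simp [this, hyB])
      have := Complex.differentiableOn_update_limUnder_of_bddAbove hs
        (f := f) (fun y hy => (hf y (hsB y hy)).differentiableWithinAt)
        ⟨M, by rintro _ ⟨y, hy, rfl⟩; exact hM y (hsB y hy)⟩
      refine (this.differentiableAt hs).congr_of_eventuallyEq ?_
      filter_upwards [hs] with y hy
      by_cases hyx : y = x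
      · subst hyx; simp [hF]
      · rw [Function.update_of_ne hyx, hFf y (hsB y ⟨hy, hyx⟩)]
    · exact (hf x hx).congr_of_eventuallyEq ((hBo x hx).mono hFf)
  have hb : Bornology.IsBounded (Set.range F) := by
    have h1 : Set.range F ⊆ F '' (B : Set ℂ) ∪ Metric.closedBall 0 M := by
      rintro _ ⟨x, rfl⟩
      by_cases hx : x ∈ B
      · exact Or.inl ⟨x, hx, rfl⟩
      · right
        rw [mem_closedBall_zero_iff, hFf x hx]
        exact hM x hx
    exact ((B.finite_toSet.image F).isBounded.union Metric.isBounded_closedBall).subset h1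
  rw [← hFf x hx, ← hFf y hy]
  exact hFd.apply_eq_apply_of_bounded hb x y

section
variable {P Q g : ℂ[X][Y]} {c : ℂ}

lemma nodup_roots_spec {x : ℂ} (hx : ∀ z ∈ fib P c, z.1 = x → ev (dy P) z ≠ 0)
    (h0 : spec P c x ≠ 0) : (spec P c x).roots.Nodup := by
  classical
  rw [Multiset.nodup_iff_count_le_one]
  intro y
  rw [count_roots]
  by_contra! h
  rw [one_lt_rootMultiplicity_iff_isRoot h0] at h
  have h2 := h.2
  rw [IsRoot, eval_derivative_spec] at h2
  exact hx (x, y) (isRoot_spec_iff.1 h.1) rfl h2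

lemma exists_roots_eq_branches (hm : (P - Polynomial.C (Polynomial.C c)).Monic) {V : Set ℂ}
    (hVo : IsOpen V) (hVc : Convex ℝ V) (hVy : ∀ z ∈ fib P c, z.1 ∈ V → ev (dy P) z ≠ 0)
    {x₀ : ℂ} (hx₀ : x₀ ∈ V) :
    ∃ β : ℂ → ℂ → ℂ × ℂ, ∀ x ∈ V,
      (spec P c x).roots = (spec P c x₀).roots.map (fun y => (β y x).2) ∧
      ∀ y ∈ (spec P c x₀).roots, ContinuousAt (β y) x ∧ β y x₀ = (x₀, y) ∧
        β y x ∈ fib P c ∧ (β y x).1 = x := by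
  have hne := fun x => (monic_spec hm x).ne_zero
  have hroot : ∀ x y, y ∈ (spec P c x).roots ↔ (x, y) ∈ fib P c := fun x y => by
    rw [mem_roots (hne x), isRoot_spec_iff]
  choose! β hβ using fun (y : ℂ) (hy : y ∈ (spec P c x₀).roots) =>
    exists_branch hm hVo hVc hVy ((hroot _ _).1 hy) hx₀
  refine ⟨β, fun x hx => ⟨?_, fun y hy => ⟨(hβ y hy).2.1.continuousAt (hVo.mem_nhds hx),
    (hβ y hy).1, (hβ y hy).2.2 x hx⟩⟩⟩
  have hn : ∀ x ∈ V, (spec P c x).roots.Nodup := fun x hx =>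
    nodup_roots_spec (fun z hz hzx => hVy z hz (hzx ▸ hx)) (hne x)
  have hcard : ∀ x, (spec P c x).roots.card = (P - Polynomial.C (Polynomial.C c)).natDegree :=
    fun x => by rw [← natDegree_spec hm x]; exact splits_iff_card_roots.1 (IsAlgClosed.splits _)
  have hmn : ((spec P c x₀).roots.map (fun y => (β y x).2)).Nodup := by
    refine Multiset.Nodup.map_on ?_ (hn x₀ hx₀)
    intro y hy y' hy' h
    have he : β y x = β y' x := Prod.ext
      (((hβ y hy).2.2 x hx).2.trans ((hβ y' hy').2.2 x hx).2.symm) h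
    have := eq_of_branch hVc.isPreconnected hVo hVy (hβ y hy).2.1 (hβ y' hy').2.1
      (hβ y hy).2.2 (hβ y' hy').2.2 hx he hx₀
    rw [(hβ y hy).1, (hβ y' hy').1] at this
    exact (Prod.ext_iff.1 this).2
  symm
  refine Multiset.eq_of_le_of_card_le ?_ (by rw [Multiset.card_map, hcard, hcard])
  rw [Multiset.le_iff_subset hmn]
  intro w hw
  obtain ⟨y, hy, rfl⟩ := Multiset.mem_map.1 hw
  rw [hroot]
  have := (hβ y hy).2.2 x hx
  rw [show (x, (β y x).2) = β y x from Prod.ext this.2.symm rfl]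
  exact this.1

lemma ev_eq_zero_of_isPrim_bounded (hJ : jac P Q = 1)
    (hm : (P - Polynomial.C (Polynomial.C c)).Monic) {B : Finset ℂ}
    (hB : ∀ z ∈ fib P c, z.1 ∉ B → ev (dy P) z ≠ 0) {h : ℂ × ℂ → ℂ}
    (hp : ∀ p ∈ fib P c, IsPrim P Q g c h p) {M : ℝ} (hM : ∀ p ∈ fib P c, ‖h p‖ ≤ M)
    {z : ℂ × ℂ} (hz : z ∈ fib P c) (hzB : z.1 ∉ B) : ev g z = 0 := by
  classical
  have hne := fun x => (monic_spec hm x).ne_zero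
  have hroot : ∀ x y, y ∈ (spec P c x).roots ↔ (x, y) ∈ fib P c := fun x y => by
    rw [mem_roots (hne x), isRoot_spec_iff]
  have hcard : ∀ x, (spec P c x).roots.card = (P - Polynomial.C (Polynomial.C c)).natDegree :=
    fun x => by rw [← natDegree_spec hm x]; exact splits_iff_card_roots.1 (IsAlgClosed.splits _)
  have hball : ∀ x, x ∉ B → ∃ r > 0, ∀ x' ∈ Metric.ball x r, x' ∉ B := fun x hx =>
    Metric.eventually_nhds_iff_ball.1 (B.finite_toSet.isClosed.isOpen_compl.mem_nhds hx)
  have hder : ∀ β : ℂ → ℂ × ℂ, ∀ x, x ∉ B → ContinuousAt β x →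
      (∀ᶠ x' in 𝓝 x, β x' ∈ fib P c ∧ (β x').1 = x') →
      HasDerivAt (fun x => h (β x)) (-ev g (β x) / ev (dy P) (β x)) x := by
    intro β x hxB hβ hb
    have hy := hB _ hb.self_of_nhds.1 (hb.self_of_nhds.2.symm ▸ hxB)
    have := (hp _ hb.self_of_nhds.1).hasDerivAt (hasDerivAt_of_branch hβ hb hy)
      (hb.mono fun _ h => h.1)
    refine this.congr_deriv ?_
    have hJe : ev (dx P) (β x) * ev (dy Q) (β x) - ev (dy P) (β x) * ev (dx Q) (β x) = 1 := by
      have := congrArg (fun U => ev U (β x)) hJ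
      simpa [jac] using this
    field_simp
    linear_combination (-ev g (β x)) * hJe
  set N : ℂ → ℂ → ℂ := fun Z x => ((spec P c x).roots.map fun y => Z - h (x, y)).prod with hN
  have hNd : ∀ Z x, x ∉ B → DifferentiableAt ℂ (N Z) x := by
    intro Z x hx
    obtain ⟨r, hr, hrB⟩ := hball x hx
    obtain ⟨β, hβ⟩ := exists_roots_eq_branches hm Metric.isOpen_ball (convex_ball x r)
      (fun z hz hzV => hB z hz (hrB _ hzV)) (Metric.mem_ball_self hr)
    have hbn := Metric.ball_mem_nhds x hr
    have hN' : ∀ᶠ x' in 𝓝 x, N Z x' = ∏ y ∈ (spec P c x).roots.toFinset, (Z - h (β y x')) := by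
      filter_upwards [hbn] with x' hx'
      rw [Finset.prod_eq_multiset_prod, Multiset.toFinset_val]
      simp only [hN]
      rw [(hβ x' hx').1, Multiset.map_map, Multiset.dedup_eq_self.2]
      · refine congrArg _ (Multiset.map_congr rfl fun y hy => ?_)
        have := ((hβ x' hx').2 y hy).2.2.2
        simp only [Function.comp]
        congr 2
        exact Prod.ext this.symm rfl
      · exact nodup_roots_spec (fun z hz hzx => hB z hz (hzx ▸ hx)) (hne x)
    refine DifferentiableAt.congr_of_eventuallyEq ?_ hN'
    refine DifferentiableAt.fun_finsetProd fun y hy => ?_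
    have hy' : y ∈ (spec P c x).roots := Multiset.mem_toFinset.1 hy
    exact ((hder (β y) x hx ((hβ x (Metric.mem_ball_self hr)).2 y hy').1
      (eventually_of_mem hbn fun x' hx' =>
        ((hβ x' hx').2 y hy').2.2)).differentiableAt).const_sub Z
  have hNb : ∀ Z x, ‖N Z x‖ ≤ (‖Z‖ + M) ^ (P - Polynomial.C (Polynomial.C c)).natDegree := by
    intro Z x
    have : ∀ s : Multiset ℂ, (∀ y ∈ s, (x, y) ∈ fib P c) →
        ‖(s.map fun y => Z - h (x, y)).prod‖ ≤ (‖Z‖ + M) ^ s.card := by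
      intro s
      induction s using Multiset.induction_on with
      | empty => simp
      | cons a s ih =>
        intro hs
        rw [Multiset.map_cons, Multiset.prod_cons, Multiset.card_cons, pow_succ', norm_mul]
        have h1 : ‖Z - h (x, a)‖ ≤ ‖Z‖ + M := (norm_sub_le _ _).trans
          (by gcongr; exact hM _ (hs a (Multiset.mem_cons_self a s)))
        exact mul_le_mul h1 (ih fun y hy => hs y (Multiset.mem_cons_of_mem hy)) (norm_nonneg _)
          ((norm_nonneg _).trans h1)
    rw [← hcard x]
    exact this _ fun y hy => (hroot x y).1 hy
  obtain ⟨r, hr, hrB⟩ := hball z.1 hzB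
  obtain ⟨β, hβz, hβc, hβ⟩ := exists_branch hm Metric.isOpen_ball (convex_ball z.1 r)
    (fun z hz hzV => hB z hz (hrB _ hzV)) hz (Metric.mem_ball_self hr)
  have hbn := Metric.ball_mem_nhds z.1 hr
  have hd := hder β z.1 hzB (hβc.continuousAt hbn) (eventually_of_mem hbn hβ)
  rw [hβz] at hd
  set S : Finset ℂ := (spec P c z.1).roots.toFinset.image fun y => h (z.1, y)
  have hS : ∀ x ∈ Metric.ball z.1 r, h (β x) ∈ S := by
    intro x hx
    have h1 : N (h (β x)) x = 0 := by
      refine Multiset.prod_eq_zero (Multiset.mem_map.2 ⟨(β x).2, ?_, ?_⟩)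
      · rw [hroot, show (x, (β x).2) = β x from Prod.ext (hβ x hx).2.symm rfl]
        exact (hβ x hx).1
      · rw [show (x, (β x).2) = β x from Prod.ext (hβ x hx).2.symm rfl, sub_self]
    rw [eq_of_bounded_of_differentiable_off_finset (hNd _) (fun x _ => hNb _ x) (hrB x hx)
      hzB] at h1
    obtain ⟨y, hy, hy2⟩ := Multiset.mem_map.1 (Multiset.prod_eq_zero_iff.1 h1)
    exact Finset.mem_image.2 ⟨y, Multiset.mem_toFinset.2 hy, (sub_eq_zero.1 hy2).symm⟩
  have hconst : ∀ᶠ x in 𝓝 z.1, h (β x) = h z := by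
    have ht := hd.continuousAt.tendsto
    simp only [hβz] at ht
    have : ∀ᶠ w in 𝓝 (h z), w ∉ S.erase (h z) :=
      (S.erase (h z)).finite_toSet.isClosed.isOpen_compl.mem_nhds (by simp)
    filter_upwards [ht.eventually this, hbn] with x hx hxb
    by_contra hne
    exact hx (Finset.mem_erase.2 ⟨hne, hS x hxb⟩)
  have h0 := hd.unique ((hasDerivAt_const z.1 (h z)).congr_of_eventuallyEq hconst)
  have := hB z hz hzB
  simpa [this] using h0

/-- On a fiber homeomorphic to a finitely punctured plane, `g` vanishes generically as soon as the
form `g dx / P_y` decays fast enough at infinity. -/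
lemma ev_eq_zero_of_decay (hJ : jac P Q = 1)
    (hm : (P - Polynomial.C (Polynomial.C c)).Monic) {T : Finset ℂ}
    (φ : fib P c ≃ₜ {z : ℂ // z ∉ T}) {R C δ : ℝ} (hR : 0 < R) (hδ : 0 < δ) (hC : 0 ≤ C)
    (hb : ∀ z ∈ fib P c, R < ‖z.1‖ → ev (dy P) z ≠ 0 ∧
      ‖ev g z‖ ≤ C * ‖ev (dy P) z‖ * ‖z.1‖ ^ (-1 - δ)) {B : Finset ℂ}
    (hB : ∀ z ∈ fib P c, z.1 ∉ B → ev (dy P) z ≠ 0)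
    {z : ℂ × ℂ} (hz : z ∈ fib P c) (hzB : z.1 ∉ B) : ev g z = 0 := by
  obtain ⟨h, hp, M, hM⟩ := exists_bounded_isPrim hJ hm φ hR hδ hC hb
  exact ev_eq_zero_of_isPrim_bounded hJ hm hB hp hM hz hzB

end

end Razar

namespace Razar
set_option autoImplicit false
open Polynomial Topology
open scoped Polynomial.Bivariate

/-- The substitution `T ↦ P`, sending a polynomial in `x` over `ℂ[T]` to a bivariate polynomial. -/
noncomputable def subst (P : ℂ[X][Y]) : ℂ[X][X] →+* ℂ[X][Y] :=
  eval₂RingHom (aeval (R := ℂ) P).toRingHom (Polynomial.C Polynomial.X)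

lemma subst_C (P : ℂ[X][Y]) (s : ℂ[X]) : subst P (Polynomial.C s) = aeval P s := by
  simp [subst]

lemma subst_X (P : ℂ[X][Y]) : subst P Polynomial.X = Polynomial.C Polynomial.X := by
  simp [subst]

lemma subst_apply (P : ℂ[X][Y]) (s : ℂ[X][X]) : subst P s = (Bivariate.swap s).comp P := by
  suffices h : subst P = (compRingHom P).comp (Bivariate.swap (R := ℂ)).toRingEquiv.toRingHom from
    RingHom.congr_fun h s
  refine Polynomial.ringHom_ext' (Polynomial.ringHom_ext (fun a => ?_) ?_) ?_
  · have := Bivariate.swap_C_C (R := ℂ) a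
    simp [subst_C, Polynomial.algebraMap_apply, this]
  · have := Bivariate.swap_X (R := ℂ)
    simp [subst_C, this]
  · have := Bivariate.swap_Y (R := ℂ)
    simp [subst_X, this]

lemma natDegree_subst (P : ℂ[X][Y]) (s : ℂ[X][X]) :
    (subst P s).natDegree = (Bivariate.swap s).natDegree * P.natDegree := by
  rw [subst_apply, natDegree_comp]

lemma subst_ne_zero {P : ℂ[X][Y]} (hn : P.natDegree ≠ 0) {s : ℂ[X][X]} (hs : s ≠ 0) : subst P s ≠ 0 := by
  rw [subst_apply]
  intro h
  rcases Polynomial.comp_eq_zero_iff.1 h with h | ⟨-, h⟩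
  · exact hs ((map_eq_zero_iff _ (Bivariate.swap (R := ℂ)).injective).1 h)
  · rw [h] at hn; simp at hn

lemma subst_injective {P : ℂ[X][Y]} (hn : P.natDegree ≠ 0) : Function.Injective (subst P) :=
  (injective_iff_map_eq_zero _).2 fun s h => by
    by_contra hs
    exact subst_ne_zero hn hs h

lemma sum_subst_mul_Y_pow_ne_zero {P : ℂ[X][Y]} (hn : P.natDegree ≠ 0) {d : ℕ} (hd : d < P.natDegree)
    (a : ℕ → ℂ[X][X]) (ha : a d ≠ 0) : ∑ i ∈ Finset.range (d + 1), subst P (a i) * Y ^ i ≠ 0 := by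
  intro h
  have hdis := Polynomial.degree_sum_eq_of_disjoint (fun i => subst P (a i) * Y ^ i) (Finset.range (d + 1)) (by
    rintro i ⟨hi, hi0⟩ j ⟨hj, hj0⟩ hij
    simp only [Function.onFun, Function.comp_apply]
    intro he
    have he := natDegree_eq_of_degree_eq he
    have hi' : subst P (a i) ≠ 0 := left_ne_zero_of_mul hi0
    have hj' : subst P (a j) ≠ 0 := left_ne_zero_of_mul hj0
    rw [natDegree_mul hi' (pow_ne_zero _ Polynomial.X_ne_zero),
      natDegree_mul hj' (pow_ne_zero _ Polynomial.X_ne_zero), natDegree_subst, natDegree_subst,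
      natDegree_X_pow, natDegree_X_pow] at he
    have h2 := congrArg (· % P.natDegree) he
    rw [Finset.mem_range] at hi hj
    rw [Nat.mul_add_mod_self_right, Nat.mul_add_mod_self_right,
      Nat.mod_eq_of_lt (by omega), Nat.mod_eq_of_lt (by omega)] at h2
    exact hij h2)
  rw [h, degree_zero, eq_comm, Finset.sup_eq_bot_iff] at hdis
  have := hdis d (by simp)
  rw [degree_eq_bot] at this
  exact mul_ne_zero (subst_ne_zero hn ha) (pow_ne_zero _ Polynomial.X_ne_zero) this

lemma subst_map_C (P : ℂ[X][Y]) (s : ℂ[X]) : subst P (s.map Polynomial.C) = Polynomial.C s := by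
  suffices h : (subst P).comp (mapRingHom Polynomial.C) = Polynomial.C from RingHom.congr_fun h s
  refine Polynomial.ringHom_ext (fun a => ?_) ?_
  · simp [subst_C, Polynomial.algebraMap_apply]
  · simp [subst_X]

lemma isIntegralElem_subst {P : ℂ[X][Y]} (hm : P.Monic) (hn : P.natDegree ≠ 0) (r : ℂ[X][Y]) :
    (subst P).IsIntegralElem r := by
  have hY : (subst P).IsIntegralElem Y := by
    refine ⟨P.map (mapRingHom Polynomial.C) - Polynomial.C (Polynomial.C Polynomial.X), ?_, ?_⟩
    · apply Monic.sub_of_left (hm.map _)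
      refine lt_of_le_of_lt degree_C_le ?_
      rw [degree_eq_natDegree (hm.map _).ne_zero, hm.natDegree_map]
      exact_mod_cast Nat.pos_of_ne_zero hn
    · rw [Polynomial.eval₂_sub, Polynomial.eval₂_map, Polynomial.eval₂_C, subst_C, Polynomial.aeval_X]
      have : (subst P).comp (mapRingHom Polynomial.C) = Polynomial.C := by
        ext1
        · ext1; simp [subst_C, Polynomial.algebraMap_apply]
        · simp [subst_X]
      rw [this, eval₂_C_X, sub_self]
  induction r using Polynomial.induction_on' with
  | add p q hp hq => exact hp.add _ hq
  | monomial m a =>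
    rw [← Polynomial.C_mul_X_pow_eq_monomial]
    refine RingHom.IsIntegralElem.mul _ ?_ ?_
    · rw [← subst_map_C P]
      exact RingHom.isIntegralElem_map _
    · induction m with
      | zero => rw [pow_zero]; exact RingHom.isIntegralElem_one _
      | succ m ih => rw [pow_succ]; exact ih.mul _ hY

lemma exists_dvd_map_of_isIntegralElem {S R : Type*} [CommRing S] [Nontrivial S] [CommRing R] [IsDomain R] {f : S →+* R}
    (hf : Function.Injective f) {r : R} (h : f.IsIntegralElem r) (hr : r ≠ 0) : ∃ a ≠ 0, r ∣ f a := by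
  let _ := f.toAlgebra
  have h : IsIntegral S r := h
  have : FaithfulSMul S R := (faithfulSMul_iff_algebraMap_injective _ _).2 hf
  exact h.isAlgebraic.exists_nonzero_dvd (mem_nonZeroDivisors_of_ne_zero hr)

lemma exists_dvd_subst {P : ℂ[X][Y]} (hm : P.Monic) (hn : P.natDegree ≠ 0) {r : ℂ[X][Y]} (hr : r ≠ 0) :
    ∃ a ≠ 0, r ∣ subst P a := by
  exact exists_dvd_map_of_isIntegralElem (subst_injective hn) (isIntegralElem_subst hm hn r) hr

lemma ev_subst {P : ℂ[X][Y]} {c : ℂ} {z : ℂ × ℂ} (hz : z ∈ fib P c) (s : ℂ[X][X]) :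
    ev (subst P s) z = (s.map (evalRingHom c)).eval z.1 := by
  induction s using Polynomial.induction_on' with
  | add p q hp hq => simp [hp, hq]
  | monomial m a =>
    rw [← Polynomial.C_mul_X_pow_eq_monomial, map_mul, map_pow, subst_C, subst_X]
    have : ev (aeval P a) z = a.eval c := by
      induction a using Polynomial.induction_on' with
      | add p q hp hq => simp [hp, hq]
      | monomial m a => simp [Polynomial.aeval_monomial, Polynomial.algebraMap_apply, show ev P z = c from hz]
    simp [this]
end Razar

namespace Razar
set_option autoImplicit false
set_option linter.unusedSectionVars false
open Polynomial

section
variable {k F : Type*} [Field k] [CharZero k] [Algebra ℂ[X] k] [IsFractionRing ℂ[X] k] [Field F] [Algebra k[X] F]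
  [IsFractionRing k[X] F] [Algebra k F] [IsScalarTower k k[X] F]
local notation "u" => algebraMap k[X] F Polynomial.X

variable (k F) in
/-- The embedding of `ℂ[T][x]` into `k(u)` sending `x` to `u⁻¹`. -/
noncomputable def psi : ℂ[X][X] →+* F :=
  (aeval (R := k) (u)⁻¹).toRingHom.comp (mapRingHom (algebraMap ℂ[X] k))

lemma psi_apply (s : ℂ[X][X]) : psi k F s = aeval (R := k) (u)⁻¹ (s.map (algebraMap ℂ[X] k)) := rfl

lemma psi_C (s : ℂ[X]) : psi k F (Polynomial.C s) = algebraMap k F (algebraMap ℂ[X] k s) := by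
  rw [psi_apply, Polynomial.map_C, Polynomial.aeval_C]

lemma psi_X : psi k F Polynomial.X = (u)⁻¹ := by
  rw [psi_apply, Polynomial.map_X, Polynomial.aeval_X]

lemma psi_injective : Function.Injective (psi k F) :=
  (aeval_inv_injective (k := k) (F := F)).comp (Polynomial.map_injective _ (IsFractionRing.injective _ _))

lemma exists_psi_eq_C_mul_map (f : k[X]) :
    ∃ (b : ℂ[X]) (s : ℂ[X][X]), b ≠ 0 ∧
      s.map (algebraMap ℂ[X] k) = Polynomial.C (algebraMap ℂ[X] k b) * f := by
  obtain ⟨b, hb0, hb⟩ := IsLocalization.integerNormalization_spec (nonZeroDivisors ℂ[X]) f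
  refine ⟨b, _, nonZeroDivisors.ne_zero hb0, hb.trans ?_⟩
  rw [← algebraMap_smul k b f, Polynomial.smul_eq_C_mul]

lemma exists_eq_psi_div_psi (z : F) : ∃ a b : ℂ[X][X], z = psi k F a / psi k F b := by
  obtain ⟨f, g, rfl⟩ := exists_eq_aeval_inv_div (k := k) z
  obtain ⟨b, s, hb, hs⟩ := exists_psi_eq_C_mul_map f
  obtain ⟨b', s', hb', hs'⟩ := exists_psi_eq_C_mul_map g
  have h (b : ℂ[X]) (hb : b ≠ 0) : algebraMap k F (algebraMap ℂ[X] k b) ≠ 0 := by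
    simpa using hb
  have := h b hb
  have := h b' hb'
  refine ⟨Polynomial.C b' * s, Polynomial.C b * s', ?_⟩
  rw [map_mul, map_mul, psi_C, psi_C, psi_apply, psi_apply, hs, hs', map_mul, map_mul, Polynomial.aeval_C,
    Polynomial.aeval_C]
  generalize algebraMap k F (algebraMap ℂ[X] k b) = β at *
  generalize algebraMap k F (algebraMap ℂ[X] k b') = β' at *
  rw [mul_left_comm, mul_div_mul_left _ _ ‹β ≠ 0›, mul_div_mul_left _ _ ‹β' ≠ 0›]
end

lemma inv_mem_of_isIntegral {F K : Type*} [Field F] [Field K] [Algebra F K] (A : Subalgebra F K) {z : K}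
    (hz : z ∈ A) (h : IsIntegral F z) : z⁻¹ ∈ A :=
  A.inv_mem_of_algebraic (x := ⟨z, hz⟩) h.isAlgebraic

section
variable {P : ℂ[X][X]} (hm : P.Monic) (hn : P.natDegree ≠ 0)
variable {k F K : Type*} [Field k] [CharZero k] [Algebra ℂ[X] k] [IsFractionRing ℂ[X] k] [Field F] [Algebra k[X] F]
  [IsFractionRing k[X] F] [Algebra k F] [IsScalarTower k k[X] F] [Field K] [Algebra F K] [Algebra k K]
  [IsScalarTower k F K] [Algebra ℂ[X][X] K] [IsFractionRing ℂ[X][X] K]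
  (hk : ∀ s : ℂ[X], algebraMap k K (algebraMap ℂ[X] k s) = algebraMap ℂ[X][X] K (aeval P s))
  (hu : algebraMap F K (algebraMap k[X] F Polynomial.X) =
    (algebraMap ℂ[X][X] K (Polynomial.C Polynomial.X))⁻¹)
local notation "u" => algebraMap k[X] F Polynomial.X
local notation "U" => algebraMap F K u
local notation "ι" => algebraMap ℂ[X][X] K

include hk hu in
lemma algebraMap_psi (s : ℂ[X][X]) : algebraMap F K (psi k F s) = ι (subst P s) := by
  suffices h : (algebraMap F K).comp (psi k F) = (ι).comp (subst P) from RingHom.congr_fun h s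
  refine Polynomial.ringHom_ext (fun a => ?_) ?_
  · rw [RingHom.comp_apply, RingHom.comp_apply, psi_C, subst_C, ← hk, ← IsScalarTower.algebraMap_apply]
  · rw [RingHom.comp_apply, RingHom.comp_apply, psi_X, subst_X, map_inv₀, hu, inv_inv]

include hm hn hk hu in
lemma isIntegralElem_psi (r : ℂ[X][X]) : ((algebraMap F K).comp (psi k F)).IsIntegralElem (ι r) := by
  have h : (algebraMap F K).comp (psi k F) = (ι).comp (subst P) :=
    RingHom.ext (algebraMap_psi hk hu)
  rw [h]
  obtain ⟨p, hp, h0⟩ := isIntegralElem_subst hm hn r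
  refine ⟨p, hp, ?_⟩
  rw [← Polynomial.hom_eval₂, h0, map_zero]

include hm hn hk hu in
lemma exists_coeff_minpoly_eq_psi (r : ℂ[X][X]) (i : ℕ) :
    ∃ a, (minpoly F (ι r)).coeff i = psi k F a :=
  exists_coeff_minpoly_eq (psi k F) psi_injective exists_eq_psi_div_psi
    (isIntegralElem_psi hm hn hk hu r) i

include hm hn hk hu in
lemma isIntegral_algebraMap (r : ℂ[X][X]) : IsIntegral F (ι r) := by
  obtain ⟨p, hp, h0⟩ := isIntegralElem_psi (F := F) hm hn hk hu r
  refine ⟨p.map (psi k F), hp.map _, ?_⟩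
  rw [Polynomial.eval₂_map, h0]

include hm hn hk hu in
lemma minpoly_Y : minpoly F (ι Polynomial.X) =
    P.map ((psi k F).comp (mapRingHom Polynomial.C)) - Polynomial.C (psi k F (Polynomial.C Polynomial.X)) := by
  have hcomp : (algebraMap F K).comp ((psi k F).comp (mapRingHom Polynomial.C)) = (ι).comp Polynomial.C := by
    refine RingHom.ext fun a => ?_
    rw [RingHom.comp_apply, RingHom.comp_apply, algebraMap_psi hk hu, coe_mapRingHom, subst_map_C,
      RingHom.comp_apply]
  have hdeg : (Polynomial.C (psi k F (Polynomial.C Polynomial.X))).degree <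
      (P.map ((psi k F).comp (mapRingHom Polynomial.C))).degree := by
    refine lt_of_le_of_lt degree_C_le ?_
    rw [degree_eq_natDegree (hm.map _).ne_zero, hm.natDegree_map]
    exact_mod_cast Nat.pos_of_ne_zero hn
  have hInt := isIntegral_algebraMap (F := F) hm hn hk hu Polynomial.X
  refine (Polynomial.eq_of_monic_of_dvd_of_natDegree_le (minpoly.monic hInt) ((hm.map _).sub_of_left hdeg)
    (minpoly.dvd _ _ ?_) ?_).symm
  · rw [map_sub, Polynomial.aeval_C, Polynomial.aeval_def, Polynomial.eval₂_map, hcomp,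
      algebraMap_psi hk hu, subst_C, Polynomial.aeval_X, ← Polynomial.hom_eval₂, Polynomial.eval₂_C_X, sub_self]
  · rw [natDegree_eq_natDegree (degree_sub_eq_left_of_degree_lt hdeg), hm.natDegree_map]
    by_contra! hlt
    choose a ha using exists_coeff_minpoly_eq_psi (F := F) hm hn hk hu Polynomial.X
    refine sum_subst_mul_Y_pow_ne_zero hn hlt a ?_ ?_
    · intro h0
      have := ha (minpoly F (ι Polynomial.X)).natDegree
      rw [h0, map_zero, coeff_natDegree, minpoly.monic hInt] at this
      exact one_ne_zero this
    · apply IsFractionRing.injective ℂ[X][X] K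
      rw [map_zero, map_sum, ← minpoly.aeval F (ι Polynomial.X), Polynomial.aeval_eq_sum_range]
      refine Finset.sum_congr rfl fun i _ => ?_
      rw [map_mul, map_pow, ← algebraMap_psi hk hu, ← ha, Algebra.smul_def]

include hm hn hk hu in
lemma aeval_derivative_minpoly_Y : aeval (ι Polynomial.X) (derivative (minpoly F (ι Polynomial.X))) =
    ι (derivative P) := by
  have hcomp : (algebraMap F K).comp ((psi k F).comp (mapRingHom Polynomial.C)) = (ι).comp Polynomial.C := by
    refine RingHom.ext fun a => ?_
    rw [RingHom.comp_apply, RingHom.comp_apply, algebraMap_psi hk hu, coe_mapRingHom, subst_map_C,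
      RingHom.comp_apply]
  rw [minpoly_Y hm hn hk hu, derivative_sub, derivative_C, sub_zero, derivative_map, Polynomial.aeval_def,
    Polynomial.eval₂_map, hcomp, ← Polynomial.hom_eval₂, Polynomial.eval₂_C_X]

include hm hn hk hu in
lemma algebraMap_mem_adjoin_Y (r : ℂ[X][X]) : ι r ∈ Algebra.adjoin F {ι Polynomial.X} := by
  induction r using Polynomial.induction_on' with
  | add p q hp hq => rw [map_add]; exact add_mem hp hq
  | monomial m a =>
    rw [← Polynomial.C_mul_X_pow_eq_monomial, map_mul, map_pow, ← subst_map_C P a, ← algebraMap_psi hk hu]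
    have hY : ι Polynomial.X ∈ Algebra.adjoin F {ι Polynomial.X} := Algebra.self_mem_adjoin_singleton F (ι Polynomial.X)
    exact mul_mem (Subalgebra.algebraMap_mem _ _) (pow_mem hY _)

include hm hn hk hu in
lemma adjoin_Y_eq_top : Algebra.adjoin F {ι Polynomial.X} = ⊤ := by
  rw [eq_top_iff]
  rintro z -
  obtain ⟨a, b, -, rfl⟩ := IsFractionRing.div_surjective (A := ℂ[X][X]) z
  rw [div_eq_mul_inv]
  refine mul_mem (algebraMap_mem_adjoin_Y hm hn hk hu a) ?_
  exact inv_mem_of_isIntegral _ (algebraMap_mem_adjoin_Y (F := F) hm hn hk hu b)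
    (isIntegral_algebraMap (F := F) hm hn hk hu b)
end
end Razar

namespace Razar
set_option autoImplicit false
set_option linter.unusedSectionVars false
open Polynomial

lemma exists_derivation_fractionRing {R K : Type*} [CommRing R] [IsDomain R] [Field K] [Algebra R K]
    [IsFractionRing R K] (d : Derivation ℤ R R) :
    ∃ D : Derivation ℤ K K, ∀ r, D (algebraMap R K r) = algebraMap R K (d r) := by
  let f : R →+* TrivSqZeroExt K K :=
    { toFun r := TrivSqZeroExt.inl (algebraMap R K r) + TrivSqZeroExt.inr (algebraMap R K (d r))
      map_one' := by ext <;> simp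
      map_zero' := by ext <;> simp
      map_add' a b := by
        rw [map_add, map_add, map_add, TrivSqZeroExt.inl_add, TrivSqZeroExt.inr_add]; abel
      map_mul' a b := by
        refine TrivSqZeroExt.ext ?_ ?_
        · simp
        · rw [Derivation.leibniz, TrivSqZeroExt.snd_mul]
          simp only [TrivSqZeroExt.fst_add, TrivSqZeroExt.snd_add, TrivSqZeroExt.fst_inl, TrivSqZeroExt.snd_inl,
            TrivSqZeroExt.fst_inr, TrivSqZeroExt.snd_inr, add_zero, zero_add, smul_eq_mul,
            MulOpposite.smul_eq_mul_unop, MulOpposite.unop_op, map_add, map_mul]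
          rw [mul_comm (algebraMap R K b)] }
  have hf (r) : f r = TrivSqZeroExt.inl (algebraMap R K r) + TrivSqZeroExt.inr (algebraMap R K (d r)) := rfl
  have hunit (y : nonZeroDivisors R) : IsUnit (f y) := by
    rw [TrivSqZeroExt.isUnit_iff_isUnit_fst, hf]
    simp
  let L : K →+* TrivSqZeroExt K K := IsLocalization.lift hunit
  have hL (r) : L (algebraMap R K r) = f r := IsLocalization.lift_eq hunit r
  have hfst (z : K) : (L z).fst = z := by
    suffices h : (TrivSqZeroExt.fstHom K K K).toRingHom.comp L = RingHom.id K from RingHom.congr_fun h z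
    refine IsLocalization.ringHom_ext (nonZeroDivisors R) (RingHom.ext fun r => ?_)
    simp [hL, hf]
  refine ⟨Derivation.mk' (AddMonoidHom.toIntLinearMap
    { toFun z := (L z).snd, map_zero' := by simp, map_add' := by simp }) fun a b => ?_, fun r => ?_⟩
  · change (L (a * b)).snd = a • (L b).snd + b • (L a).snd
    rw [map_mul, TrivSqZeroExt.snd_mul, hfst, hfst, op_smul_eq_smul]
  · change (L _).snd = _
    rw [hL, hf, TrivSqZeroExt.snd_add, TrivSqZeroExt.snd_inl, TrivSqZeroExt.snd_inr, zero_add]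

lemma isUnit_eq_C_C {r : ℂ[X][X]} (h : IsUnit r) : ∃ a : ℂ, r = Polynomial.C (Polynomial.C a) := by
  obtain ⟨s, hs, rfl⟩ := Polynomial.isUnit_iff.1 h
  obtain ⟨a, -, rfl⟩ := Polynomial.isUnit_iff.1 hs
  exact ⟨a, rfl⟩

lemma exists_eq_aeval_of_dvd {P : ℂ[X][X]} (hirr : ∀ c : ℂ, Irreducible (P - Polynomial.C (Polynomial.C c)))
    {r : ℂ[X][X]} {q : ℂ[X]} (hq : q ≠ 0) (h : r ∣ aeval P q) : ∃ q' : ℂ[X], r = aeval P q' := by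
  induction hd : q.natDegree generalizing q r with
  | zero =>
    rw [eq_C_of_natDegree_eq_zero hd, Polynomial.aeval_C] at h
    have h0 : q.coeff 0 ≠ 0 := fun h0 => hq (by rw [eq_C_of_natDegree_eq_zero hd, h0, Polynomial.C_0])
    obtain ⟨a, rfl⟩ := isUnit_eq_C_C (isUnit_of_dvd_unit h ((isUnit_iff_ne_zero.2 h0).map _))
    exact ⟨Polynomial.C a, by rw [Polynomial.aeval_C]; rfl⟩
  | succ d ih =>
    obtain ⟨c, hc⟩ := IsAlgClosed.exists_root q (by
      intro h0; rw [natDegree_eq_of_degree_eq_some h0] at hd; simp at hd)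
    obtain ⟨q1, rfl⟩ := dvd_iff_isRoot.2 hc
    have hq1 : q1 ≠ 0 := right_ne_zero_of_mul hq
    rw [natDegree_mul (X_sub_C_ne_zero c) hq1, natDegree_X_sub_C] at hd
    have hp : Prime (P - Polynomial.C (Polynomial.C c)) := (hirr c).prime
    have hev : aeval P (Polynomial.X - Polynomial.C c) = P - Polynomial.C (Polynomial.C c) := by
      rw [map_sub, Polynomial.aeval_X, Polynomial.aeval_C]; rfl
    rw [map_mul, hev] at h
    by_cases hpr : (P - Polynomial.C (Polynomial.C c)) ∣ r
    · obtain ⟨r1, rfl⟩ := hpr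
      obtain ⟨q', rfl⟩ := ih hq1 ((mul_dvd_mul_iff_left hp.ne_zero).1 h) (by omega)
      exact ⟨(Polynomial.X - Polynomial.C c) * q', by rw [map_mul, hev]⟩
    · obtain ⟨t, ht⟩ := h
      obtain ⟨t1, rfl⟩ := (hp.dvd_or_dvd (⟨_, ht.symm⟩ : _ ∣ r * t)).resolve_left hpr
      refine ih hq1 ⟨t1, ?_⟩ (by omega)
      apply mul_left_cancel₀ hp.ne_zero
      rw [ht]; ring

lemma derivation_aeval_eq_zero {P : ℂ[X][X]} {d : Derivation ℂ ℂ[X][X] ℂ[X][X]} (hP : d P = 0) (s : ℂ[X]) :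
    d (aeval P s) = 0 := by
  rw [Derivation.map_aeval, hP, smul_zero]

section
variable {P : ℂ[X][X]} (hm : P.Monic) (hn : P.natDegree ≠ 0)
variable {k F K : Type*} [Field k] [CharZero k] [Algebra ℂ[X] k] [IsFractionRing ℂ[X] k] [Field F] [Algebra k[X] F]
  [IsFractionRing k[X] F] [Algebra k F] [IsScalarTower k k[X] F] [Field K] [Algebra F K] [Algebra k K]
  [IsScalarTower k F K] [Algebra ℂ[X][X] K] [IsFractionRing ℂ[X][X] K]
  (hk : ∀ s : ℂ[X], algebraMap k K (algebraMap ℂ[X] k s) = algebraMap ℂ[X][X] K (aeval P s))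
  (hu : algebraMap F K (algebraMap k[X] F Polynomial.X) =
    (algebraMap ℂ[X][X] K (Polynomial.C Polynomial.X))⁻¹)
local notation "u" => algebraMap k[X] F Polynomial.X
local notation "U" => algebraMap F K u
local notation "ι" => algebraMap ℂ[X][X] K
local notation "𝒪" => integralClosure (regAtZero k F) K

include hk in
lemma exists_derivation_extension {d : Derivation ℂ ℂ[X][X] ℂ[X][X]} (hP : d P = 0) :
    ∃ D : Derivation k K K, ∀ r, D (ι r) = ι (d r) := by
  obtain ⟨D, hD⟩ := exists_derivation_fractionRing (K := K) (d.restrictScalars ℤ)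
  have hD (r) : D (ι r) = ι (d r) := hD r
  have h0 (s : ℂ[X]) : D (algebraMap k K (algebraMap ℂ[X] k s)) = 0 := by
    rw [hk, hD, derivation_aeval_eq_zero hP, map_zero]
  have h1 (c : k) : D (algebraMap k K c) = 0 := by
    obtain ⟨a, b, hb, rfl⟩ := IsFractionRing.div_surjective (A := ℂ[X]) c
    have hb0 : algebraMap k K (algebraMap ℂ[X] k b) ≠ 0 := by simpa using nonZeroDivisors.ne_zero hb
    rw [map_div₀]
    have := h0 a
    rw [← div_mul_cancel₀ (algebraMap k K (algebraMap ℂ[X] k a)) hb0, Derivation.leibniz, h0, smul_zero,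
      zero_add, smul_eq_mul] at this
    exact (mul_eq_zero.1 this).resolve_left hb0
  let L : K →ₗ[k] K := IsLinearMap.mk' D ⟨map_add D, fun c z => by simp [Algebra.smul_def, h1]⟩
  exact ⟨Derivation.mk' L fun a b => Derivation.leibniz D a b, fun r => hD r⟩

variable (K) in
/-- The localization of `ℂ[x,y]` at the nonzero polynomials in `P`, inside its fraction field. -/
noncomputable def genericRing : Subalgebra k K where
  carrier := {z | ∃ (r : ℂ[X][X]) (s : ℂ[X]), s ≠ 0 ∧ z * algebraMap k K (algebraMap ℂ[X] k s) = ι r}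
  mul_mem' := by
    rintro z z' ⟨r, s, hs, h⟩ ⟨r', s', hs', h'⟩
    refine ⟨r * r', s * s', mul_ne_zero hs hs', ?_⟩
    rw [map_mul, map_mul, map_mul, ← h, ← h']; ring
  add_mem' := by
    rintro z z' ⟨r, s, hs, h⟩ ⟨r', s', hs', h'⟩
    refine ⟨r * aeval P s' + r' * aeval P s, s * s', mul_ne_zero hs hs', ?_⟩
    rw [map_mul, map_mul, map_add, map_mul, map_mul, ← h, ← h', ← hk, ← hk]; ring
  algebraMap_mem' c := by
    obtain ⟨a, b, hb, rfl⟩ := IsFractionRing.div_surjective (A := ℂ[X]) c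
    refine ⟨aeval P a, b, nonZeroDivisors.ne_zero hb, ?_⟩
    have hb0 : algebraMap ℂ[X] k b ≠ 0 := by simpa using nonZeroDivisors.ne_zero hb
    rw [← hk, ← map_mul, div_mul_cancel₀ _ hb0]

lemma algebraMap_mem_genericRing (r : ℂ[X][X]) : ι r ∈ genericRing (k := k) K hk :=
  ⟨r, 1, one_ne_zero, by simp⟩

include hm hn hu in
lemma isIntegralElem_of_mem_genericRing {a : K} (ha : a ∈ genericRing (k := k) K hk) :
    (aeval (R := k) (U)⁻¹).toRingHom.IsIntegralElem a := by
  obtain ⟨r, s, hs, h⟩ := ha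
  have hs0 : algebraMap k K (algebraMap ℂ[X] k s) ≠ 0 := by simpa using hs
  have h1 : a = ι r * (aeval (R := k) (U)⁻¹).toRingHom (Polynomial.C (algebraMap ℂ[X] k s)⁻¹) := by
    rw [← h]
    change a = _ * Polynomial.aeval (U)⁻¹ _
    rw [Polynomial.aeval_C, map_inv₀, mul_inv_cancel_right₀ hs0]
  rw [h1]
  refine RingHom.IsIntegralElem.mul _ ?_ (RingHom.isIntegralElem_map _)
  obtain ⟨p, hp, h0⟩ := isIntegralElem_psi (F := F) hm hn hk hu r
  refine ⟨p.map (mapRingHom (algebraMap ℂ[X] k)), hp.map _, ?_⟩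
  rw [Polynomial.eval₂_map, ← h0]
  congr 1
  refine RingHom.ext fun s => ?_
  simp only [RingHom.comp_apply, psi_apply, coe_mapRingHom]
  change Polynomial.aeval (U)⁻¹ (Polynomial.map _ s) = _
  rw [← map_inv₀, Polynomial.aeval_algebraMap_apply]

lemma exists_eq_algebraMap_of_inv_mem (hirr : ∀ c : ℂ, Irreducible (P - Polynomial.C (Polynomial.C c)))
    {a : K} (ha : a ∈ genericRing (k := k) K hk) (ha' : a⁻¹ ∈ genericRing (k := k) K hk) :
    ∃ c : k, a = algebraMap k K c := by
  by_cases ha0 : a = 0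
  · exact ⟨0, by rw [ha0, map_zero]⟩
  obtain ⟨r, s, hs, h⟩ := ha
  obtain ⟨r', s', hs', h'⟩ := ha'
  have hs0 : algebraMap k K (algebraMap ℂ[X] k s) ≠ 0 := by simpa using hs
  obtain ⟨q, rfl⟩ := exists_eq_aeval_of_dvd hirr (mul_ne_zero hs hs') (r := r) ⟨r', by
    apply IsFractionRing.injective ℂ[X][X] K
    rw [map_mul (ι) r, ← h, ← h', ← hk, map_mul, map_mul]
    field_simp⟩
  refine ⟨algebraMap ℂ[X] k q / algebraMap ℂ[X] k s, ?_⟩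
  rw [map_div₀, hk q, ← h, mul_div_cancel_right₀ _ hs0]

include hm hn hk hu in
theorem exists_integral_or_nilpotent (hirr : ∀ c : ℂ, Irreducible (P - Polynomial.C (Polynomial.C c)))
    {d : Derivation ℂ ℂ[X][X] ℂ[X][X]} (hP : d P = 0) {Q : ℂ[X][X]} (hQ : d Q = 1) :
    (∃ g : ℂ[X][X], g ≠ 0 ∧ ∃ m ≠ 0, ∃ w ∈ 𝒪, (U⁻¹ * ι g / ι (derivative P)) ^ m = U * w) ∨
    ∀ r, ∃ N : ℕ, d^[N] r = 0 := by
  obtain ⟨D, hD⟩ := exists_derivation_extension hk hP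
  let pb : PowerBasis F K := PowerBasis.ofAdjoinEqTop (isIntegral_algebraMap hm hn hk hu _)
    (adjoin_Y_eq_top hm hn hk hu)
  have hgen : pb.gen = ι Polynomial.X := PowerBasis.ofAdjoinEqTop_gen _ _
  have : FiniteDimensional F K := pb.finite
  have : CharZero F := charZero_of_injective_algebraMap (algebraMap k F).injective
  have key := exists_differential_or_nilpotent pb (A := genericRing (k := k) K hk) (by
      rw [hu, inv_inv]; exact algebraMap_mem_genericRing hk _) (by
      rw [hgen]; exact algebraMap_mem_genericRing hk _) (by
      intro i
      obtain ⟨a, ha⟩ := exists_coeff_minpoly_eq_psi (F := F) hm hn hk hu Polynomial.X i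
      rw [hgen, ha, algebraMap_psi hk hu]
      exact algebraMap_mem_genericRing hk _)
    (fun a ha => isIntegralElem_of_mem_genericRing hm hn hk hu ha)
    (fun a ha ha' => exists_eq_algebraMap_of_inv_mem hk hirr ha ha') D (by
      rintro a ⟨r, s, hs, h⟩
      refine ⟨d r, s, hs, ?_⟩
      rw [← hD, ← h, Derivation.leibniz, Derivation.map_algebraMap, smul_zero, zero_add, smul_eq_mul,
        mul_comm]) (algebraMap_mem_genericRing hk Q) (by rw [hD, hQ, map_one])
  rcases key with ⟨g, ⟨r, s, hs, h⟩, hg0, w, hw, hgw⟩ | h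
  · left
    have hs0 : algebraMap k K (algebraMap ℂ[X] k s) ≠ 0 := by simpa using hs
    refine ⟨r, ?_, Module.finrank F K, Module.finrank_pos.ne',
      algebraMap k K (algebraMap ℂ[X] k s) ^ Module.finrank F K * w, ?_, ?_⟩
    · rintro rfl
      rw [map_zero] at h
      exact (mul_ne_zero hg0 hs0) h
    · refine mul_mem (pow_mem ?_ _) hw
      rw [IsScalarTower.algebraMap_apply k F K]
      exact (𝒪).algebraMap_mem ⟨algebraMap k F (algebraMap ℂ[X] k s), Subalgebra.algebraMap_mem _ _⟩
    · rw [hgen, aeval_derivative_minpoly_Y hm hn hk hu] at hgw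
      rw [mul_left_comm, ← hgw, ← h, ← mul_pow]
      congr 1
      ring
  · right
    intro r
    obtain ⟨N, hN⟩ := h (ι r) (algebraMap_mem_genericRing hk r)
    refine ⟨N, IsFractionRing.injective ℂ[X][X] K ?_⟩
    rw [map_zero, ← hN]
    clear hN
    induction N generalizing r with
    | zero => rfl
    | succ N ih => rw [Function.iterate_succ_apply, ih, Function.iterate_succ_apply, hD]
end
end Razar

namespace Razar
set_option autoImplicit false
set_option linter.unusedSectionVars false
open Polynomial

section
variable {k F : Type*} [Field k] [CharZero k] [Algebra ℂ[X] k] [IsFractionRing ℂ[X] k] [Field F] [Algebra k[X] F]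
  [IsFractionRing k[X] F] [Algebra k F] [IsScalarTower k k[X] F]
local notation "u" => algebraMap k[X] F Polynomial.X

lemma aeval_inv_reflect_mul_pow (N : ℕ) (p : k[X]) (hp : p.natDegree ≤ N) :
    aeval (u)⁻¹ (p.reflect N) * u ^ N = algebraMap k[X] F p := by
  have hu := uniformizer_ne_zero (k := k) (F := F)
  let _ : Invertible (u) := invertibleOfNonzero hu
  have h := Polynomial.eval₂_reflect_mul_pow (algebraMap k F) (u) N p hp
  rwa [invOf_eq_inv, ← Polynomial.aeval_def, ← Polynomial.aeval_def,
    Polynomial.aeval_algebraMap_apply, Polynomial.aeval_X_left_apply] at h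

lemma exists_psi_mul_eq_psi {f : F} (hf : f ∈ regAtZero k F) :
    ∃ a s : ℂ[X][X], a ≠ 0 ∧ s.natDegree ≤ a.natDegree ∧ psi k F a * f = psi k F s := by
  have hu := uniformizer_ne_zero (k := k) (F := F)
  obtain ⟨p, q, hq, h⟩ := mem_regAtZero.1 hf
  let N := max p.natDegree q.natDegree
  have hp' := aeval_inv_reflect_mul_pow (F := F) N p (le_max_left _ _)
  have hq' := aeval_inv_reflect_mul_pow (F := F) N q (le_max_right _ _)
  rw [← hp', ← hq', ← mul_assoc] at h
  have h := mul_right_cancel₀ (pow_ne_zero _ hu) h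
  obtain ⟨b, s, hb, hs⟩ := exists_psi_eq_C_mul_map (p.reflect N)
  obtain ⟨c, t, hc, ht⟩ := exists_psi_eq_C_mul_map (q.reflect N)
  have hinj := IsFractionRing.injective ℂ[X] k
  have hb0 : algebraMap ℂ[X] k b ≠ 0 := by simpa using hb
  have hc0 : algebraMap ℂ[X] k c ≠ 0 := by simpa using hc
  have hNq : (q.reflect N).coeff N ≠ 0 := by
    rw [coeff_reflect, revAt_le le_rfl, Nat.sub_self]; exact hq
  have hcoef : t.coeff N ≠ 0 := by
    intro h0
    have := congrArg (Polynomial.coeff · N) ht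
    rw [Polynomial.coeff_map, h0, map_zero, Polynomial.coeff_C_mul] at this
    exact mul_ne_zero hc0 hNq this.symm
  have hs' : s.natDegree ≤ N := by
    rw [← natDegree_map_eq_of_injective hinj s, hs, natDegree_C_mul hb0]
    exact (natDegree_reflect_le).trans (max_le le_rfl (le_max_left _ _))
  refine ⟨Polynomial.C b * t, Polynomial.C c * s, mul_ne_zero (Polynomial.C_ne_zero.2 hb) ?_, ?_, ?_⟩
  · rintro rfl; simp at hcoef
  · rw [natDegree_C_mul hb, natDegree_C_mul hc]
    exact hs'.trans (le_natDegree_of_ne_zero hcoef)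
  · rw [map_mul, map_mul, psi_C, psi_C, psi_apply, psi_apply, hs, ht, map_mul, map_mul, ← h, Polynomial.aeval_C,
      Polynomial.aeval_C]
    ring

lemma exists_common_psi_mul_eq_psi (f : ℕ → F) (hf : ∀ i, f i ∈ regAtZero k F) (n : ℕ) :
    ∃ a : ℂ[X][X], a ≠ 0 ∧ ∀ i < n, ∃ s : ℂ[X][X], s.natDegree ≤ a.natDegree ∧ psi k F a * f i = psi k F s := by
  induction n with
  | zero => exact ⟨1, one_ne_zero, fun i hi => absurd hi (Nat.not_lt_zero i)⟩
  | succ n ih =>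
    obtain ⟨a, ha, h⟩ := ih
    obtain ⟨b, t, hb, ht, hbt⟩ := exists_psi_mul_eq_psi (hf n)
    refine ⟨a * b, mul_ne_zero ha hb, fun i hi => ?_⟩
    rw [natDegree_mul ha hb, map_mul]
    rcases Nat.lt_succ_iff_lt_or_eq.1 hi with hi | rfl
    · obtain ⟨s, hs, has⟩ := h i hi
      exact ⟨s * b, natDegree_mul_le.trans (by gcongr), by rw [map_mul, ← has]; ring⟩
    · exact ⟨a * t, natDegree_mul_le.trans (by gcongr), by rw [map_mul, ← hbt]; ring⟩
end

section
variable {P : ℂ[X][X]}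
variable {k F K : Type*} [Field k] [CharZero k] [Algebra ℂ[X] k] [IsFractionRing ℂ[X] k] [Field F] [Algebra k[X] F]
  [IsFractionRing k[X] F] [Algebra k F] [IsScalarTower k k[X] F] [Field K] [Algebra F K] [Algebra k K]
  [IsScalarTower k F K] [Algebra ℂ[X][X] K] [IsFractionRing ℂ[X][X] K]
  (hk : ∀ s : ℂ[X], algebraMap k K (algebraMap ℂ[X] k s) = algebraMap ℂ[X][X] K (aeval P s))
  (hu : algebraMap F K (algebraMap k[X] F Polynomial.X) =
    (algebraMap ℂ[X][X] K (Polynomial.C Polynomial.X))⁻¹)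
local notation "u" => algebraMap k[X] F Polynomial.X
local notation "U" => algebraMap F K u
local notation "ι" => algebraMap ℂ[X][X] K
local notation "𝒪" => integralClosure (regAtZero k F) K

include hk hu in
lemma exists_sum_subst_mul_pow_eq_zero {w : K} (hw : w ∈ 𝒪) :
    ∃ (d : ℕ) (b : ℕ → ℂ[X][X]), b d ≠ 0 ∧ (∀ i ≤ d, (b i).natDegree ≤ (b d).natDegree) ∧
      ∑ i ∈ Finset.range (d + 1), ι (subst P (b i)) * w ^ i = 0 := by
  obtain ⟨p, hp, h0⟩ := hw
  obtain ⟨a, ha, h⟩ := exists_common_psi_mul_eq_psi (fun i => (p.coeff i : F)) (fun i => (p.coeff i).2)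
    (p.natDegree + 1)
  choose! b hb hab using h
  have hbd : b p.natDegree = a := by
    apply psi_injective (k := k) (F := F)
    rw [← hab _ (Nat.lt_succ_self _), coeff_natDegree, hp.leadingCoeff, OneMemClass.coe_one, mul_one]
  refine ⟨p.natDegree, b, hbd ▸ ha, fun i hi => hbd ▸ hb i (Nat.lt_succ_of_le hi), ?_⟩
  rw [Polynomial.eval₂_eq_sum_range] at h0
  rw [← mul_zero (algebraMap F K (psi k F a)), ← h0, Finset.mul_sum]
  refine Finset.sum_congr rfl fun i hi => ?_
  rw [← algebraMap_psi hk hu, ← hab i (Finset.mem_range.1 hi), map_mul, mul_assoc]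
  rfl

include hk hu in
theorem exists_relation {g h : ℂ[X][X]} (hh : h ≠ 0) {m : ℕ} {w : K} (hw : w ∈ 𝒪)
    (hgw : (U⁻¹ * ι g / ι h) ^ m = U * w) :
    ∃ (d : ℕ) (b : ℕ → ℂ[X][X]), b d ≠ 0 ∧ (∀ i ≤ d, (b i).natDegree ≤ (b d).natDegree) ∧
      ∑ i ∈ Finset.range (d + 1), subst P (b i) * (Polynomial.C Polynomial.X ^ (m + 1) * g ^ m) ^ i *
        (h ^ m) ^ (d - i) = 0 := by
  obtain ⟨d, b, hb, hbd, h0⟩ := exists_sum_subst_mul_pow_eq_zero hk hu hw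
  refine ⟨d, b, hb, hbd, ?_⟩
  have hh0 : ι h ≠ 0 := by simpa using hh
  have hx0 : ι (Polynomial.C Polynomial.X) ≠ 0 := by simp [Polynomial.X_ne_zero]
  have hw' : w * ι h ^ m = ι (Polynomial.C Polynomial.X ^ (m + 1) * g ^ m) := by
    rw [hu] at hgw
    rw [map_mul, map_pow, map_pow]
    generalize ι (Polynomial.C Polynomial.X) = x at *
    have : w = x * (x⁻¹⁻¹ * ι g / ι h) ^ m := by rw [hgw, mul_inv_cancel_left₀ hx0]
    rw [this, inv_inv, div_pow, mul_pow, pow_succ]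
    field_simp
  apply IsFractionRing.injective ℂ[X][X] K
  rw [map_zero, ← zero_mul ((ι h ^ m) ^ d), ← h0, map_sum, Finset.sum_mul]
  refine Finset.sum_congr rfl fun i hi => ?_
  have hi : d = i + (d - i) := by have := Finset.mem_range.1 hi; omega
  rw [map_mul, map_mul, map_pow _ _ i, ← hw', map_pow _ _ (d - i), map_pow, mul_pow]
  conv_rhs => rw [hi, pow_add]
  ring
end
end Razar

namespace Razar
set_option autoImplicit false
set_option linter.unusedSectionVars false
open Polynomial

theorem relation_or_nilpotent_aux {P : ℂ[X][X]} (hm : P.Monic) (hn : P.natDegree ≠ 0)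
    (hirr : ∀ c : ℂ, Irreducible (P - Polynomial.C (Polynomial.C c)))
    {δ : Derivation ℂ ℂ[X][X] ℂ[X][X]} (hP : δ P = 0) {Q : ℂ[X][X]} (hQ : δ Q = 1)
    (k F K : Type*) [Field k] [Algebra ℂ[X] k] [IsFractionRing ℂ[X] k] [Field F] [Algebra k[X] F]
    [IsFractionRing k[X] F] [Algebra k F] [IsScalarTower k k[X] F] [Field K] [Algebra ℂ[X][X] K]
    [IsFractionRing ℂ[X][X] K] :
    (∃ g : ℂ[X][X], g ≠ 0 ∧ ∃ m ≠ 0, ∃ (d : ℕ) (b : ℕ → ℂ[X][X]), b d ≠ 0 ∧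
      (∀ i ≤ d, (b i).natDegree ≤ (b d).natDegree) ∧
      ∑ i ∈ Finset.range (d + 1), subst P (b i) * (Polynomial.C Polynomial.X ^ (m + 1) * g ^ m) ^ i *
        (derivative P ^ m) ^ (d - i) = 0) ∨
    ∀ r, ∃ N : ℕ, δ^[N] r = 0 := by
  have : CharZero k := charZero_of_injective_algebraMap (IsFractionRing.injective ℂ[X] k)
  have hinj : Function.Injective
      ((algebraMap ℂ[X][X] K).comp ((subst P).comp Polynomial.C)) :=
    (IsFractionRing.injective ℂ[X][X] K).comp ((subst_injective hn).comp Polynomial.C_injective)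
  let _ : Algebra k K := (IsFractionRing.lift hinj).toAlgebra
  have hk (s : ℂ[X]) : algebraMap k K (algebraMap ℂ[X] k s) = algebraMap ℂ[X][X] K (aeval P s) := by
    rw [← subst_C]
    exact IsFractionRing.lift_algebraMap hinj s
  have htr : Transcendental k (algebraMap ℂ[X][X] K (Polynomial.C Polynomial.X))⁻¹ := by
    intro halg
    have halg := halg.inv
    rw [inv_inv] at halg
    obtain ⟨p, hp, h0⟩ := halg
    obtain ⟨b, s, hb, hs⟩ := exists_psi_eq_C_mul_map p
    have h1 (s : ℂ[X][X]) : aeval (algebraMap ℂ[X][X] K (Polynomial.C Polynomial.X))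
        (s.map (algebraMap ℂ[X] k)) = algebraMap ℂ[X][X] K (subst P s) := by
      induction s using Polynomial.induction_on' with
      | add p q hp hq => rw [Polynomial.map_add, map_add, hp, hq, map_add, map_add]
      | monomial m a =>
        rw [← Polynomial.C_mul_X_pow_eq_monomial, Polynomial.map_mul, Polynomial.map_pow, Polynomial.map_C,
          Polynomial.map_X, map_mul, map_mul, map_mul, map_pow, map_pow, map_pow, Polynomial.aeval_C,
          Polynomial.aeval_X, subst_C, subst_X, hk]
    have h2 := h1 s
    rw [hs, map_mul, h0, mul_zero, eq_comm, map_eq_zero_iff _ (IsFractionRing.injective ℂ[X][X] K),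
      map_eq_zero_iff _ (subst_injective hn)] at h2
    rw [h2, Polynomial.map_zero] at hs
    refine mul_ne_zero (Polynomial.C_ne_zero.2 ?_) hp hs.symm
    simpa using hb
  have hinj2 := transcendental_iff_injective.1 htr
  let _ : Algebra F K := (IsFractionRing.lift (g := (aeval (R := k)
    (algebraMap ℂ[X][X] K (Polynomial.C Polynomial.X))⁻¹).toRingHom) hinj2).toAlgebra
  have hF (p : k[X]) : algebraMap F K (algebraMap k[X] F p) =
      aeval (algebraMap ℂ[X][X] K (Polynomial.C Polynomial.X))⁻¹ p :=
    IsFractionRing.lift_algebraMap (g := (aeval (R := k)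
      (algebraMap ℂ[X][X] K (Polynomial.C Polynomial.X))⁻¹).toRingHom) hinj2 p
  have : IsScalarTower k F K := IsScalarTower.of_algebraMap_eq fun c => by
    rw [IsScalarTower.algebraMap_apply k k[X] F, hF]
    exact (Polynomial.aeval_C _ _).symm
  have hu : algebraMap F K (algebraMap k[X] F Polynomial.X) =
      (algebraMap ℂ[X][X] K (Polynomial.C Polynomial.X))⁻¹ := by rw [hF, Polynomial.aeval_X]
  rcases exists_integral_or_nilpotent hm hn hk hu hirr hP hQ with ⟨g, hg, m, hm0, w, hw, hgw⟩ | h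
  · refine Or.inl ⟨g, hg, m, hm0, exists_relation hk hu ?_ hw hgw⟩
    intro h0
    exact hn (derivative_eq_zero.1 h0)
  · exact Or.inr h

theorem relation_or_nilpotent {P : ℂ[X][X]} (hm : P.Monic) (hn : P.natDegree ≠ 0)
    (hirr : ∀ c : ℂ, Irreducible (P - Polynomial.C (Polynomial.C c)))
    {δ : Derivation ℂ ℂ[X][X] ℂ[X][X]} (hP : δ P = 0) {Q : ℂ[X][X]} (hQ : δ Q = 1) :
    (∃ g : ℂ[X][X], g ≠ 0 ∧ ∃ m ≠ 0, ∃ (d : ℕ) (b : ℕ → ℂ[X][X]), b d ≠ 0 ∧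
      (∀ i ≤ d, (b i).natDegree ≤ (b d).natDegree) ∧
      ∑ i ∈ Finset.range (d + 1), subst P (b i) * (Polynomial.C Polynomial.X ^ (m + 1) * g ^ m) ^ i *
        (derivative P ^ m) ^ (d - i) = 0) ∨
    ∀ r, ∃ N : ℕ, δ^[N] r = 0 :=
  relation_or_nilpotent_aux hm hn hirr hP hQ (FractionRing ℂ[X]) (FractionRing (FractionRing ℂ[X])[X])
    (FractionRing ℂ[X][X])
end Razar

namespace Razar
set_option autoImplicit false
open Polynomial Topology Bornology

lemma exists_norm_eval_le (p q : ℂ[X]) (hq : q ≠ 0) (h : p.natDegree ≤ q.natDegree) :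
    ∃ M, ∀ᶠ x in cobounded ℂ, ‖p.eval x‖ ≤ M * ‖q.eval x‖ := by
  have hdeg : p.degree ≤ q.degree := by
    rw [degree_eq_natDegree hq]; exact degree_le_of_natDegree_le h
  exact (isBigO_cobounded_of_degree_le hdeg).bound

lemma eventually_eval_ne_zero {q : ℂ[X]} (hq : q ≠ 0) : ∀ᶠ x in cobounded ℂ, q.eval x ≠ 0 := by
  have : {x | q.eval x = 0}.Finite := by
    refine q.roots.toFinset.finite_toSet.subset fun x hx => ?_
    simpa [hq] using hx
  exact (isBounded_def.1 this.isBounded)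

lemma norm_le_of_relation {d : ℕ} (β : ℕ → ℂ) {s t : ℂ} {M : ℝ} (hM : 0 ≤ M) (hβ : ∀ i ≤ d, ‖β i‖ ≤ M * ‖β d‖)
    (hd : β d ≠ 0) (h : ∑ i ∈ Finset.range (d + 1), β i * s ^ i * t ^ (d - i) = 0) :
    ‖s‖ ≤ (d * M + 1) * ‖t‖ := by
  by_contra! hlt
  have hC : (1 : ℝ) ≤ d * M + 1 := by have : 0 ≤ d * M := by positivity
                                      linarith
  have hs : 0 < ‖s‖ := lt_of_le_of_lt (by positivity) hlt
  have hst : ‖t‖ ≤ ‖s‖ := by nlinarith [norm_nonneg t]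
  have hβd : 0 < ‖β d‖ := norm_pos_iff.2 hd
  rw [Finset.sum_range_succ, Nat.sub_self, pow_zero, mul_one] at h
  have hterm (i : ℕ) (hi : i ∈ Finset.range d) :
      (d * M + 1) * ‖β i * s ^ i * t ^ (d - i)‖ ≤ M * ‖β d‖ * ‖s‖ ^ d := by
    have hi := Finset.mem_range.1 hi
    obtain ⟨j, hj⟩ : ∃ j, d - i = j + 1 := ⟨d - i - 1, by omega⟩
    have hd' : d = i + (j + 1) := by omega
    have h1 : (d * M + 1) * ‖t‖ ^ (j + 1) ≤ ‖s‖ ^ (j + 1) := by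
      rw [pow_succ', pow_succ', ← mul_assoc]
      gcongr
    rw [hj, norm_mul, norm_mul, norm_pow, norm_pow]
    calc (d * M + 1) * (‖β i‖ * ‖s‖ ^ i * ‖t‖ ^ (j + 1))
        = ‖β i‖ * ‖s‖ ^ i * ((d * M + 1) * ‖t‖ ^ (j + 1)) := by ring
      _ ≤ (M * ‖β d‖) * ‖s‖ ^ i * ‖s‖ ^ (j + 1) := by
          gcongr
          exact hβ i hi.le
      _ = _ := by rw [mul_assoc, ← pow_add, ← hd']
  have h2 : ‖β d‖ * ‖s‖ ^ d ≤ ∑ i ∈ Finset.range d, ‖β i * s ^ i * t ^ (d - i)‖ := by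
    rw [← norm_pow, ← norm_mul, eq_neg_of_add_eq_zero_right h, norm_neg]
    exact norm_sum_le _ _
  have h3 : (d * M + 1) * (‖β d‖ * ‖s‖ ^ d) ≤ d * (M * ‖β d‖ * ‖s‖ ^ d) := by
    refine (mul_le_mul_of_nonneg_left h2 (by positivity)).trans ?_
    rw [Finset.mul_sum]
    refine (Finset.sum_le_sum hterm).trans (le_of_eq ?_)
    rw [Finset.sum_const, Finset.card_range, nsmul_eq_mul]
  have : 0 < ‖β d‖ * ‖s‖ ^ d := by positivity
  nlinarith

lemma norm_le_mul_rpow {x g p : ℝ} {m : ℕ} (hm : m ≠ 0) {C : ℝ} (hC : 1 ≤ C) (hx : 0 < x) (hp : 0 ≤ p)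
    (h : x ^ (m + 1) * g ^ m ≤ C * p ^ m) : g ≤ C * p * x ^ (-1 - (1 / m : ℝ)) := by
  refine le_of_pow_le_pow_left₀ hm (by positivity) ?_
  have hm' : (m : ℝ) ≠ 0 := by exact_mod_cast hm
  have h1 : (x ^ (-1 - (1 / m : ℝ))) ^ m = (x ^ (m + 1))⁻¹ := by
    rw [← Real.rpow_natCast, ← Real.rpow_mul hx.le, ← Real.rpow_natCast, ← Real.rpow_neg hx.le]
    congr 1
    push_cast
    field_simp
    ring
  rw [mul_pow, mul_pow, h1]
  have h2 : C * p ^ m ≤ C ^ m * p ^ m := by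
    gcongr
    exact le_self_pow₀ hC hm
  rw [← div_eq_mul_inv, le_div_iff₀ (by positivity), mul_comm]
  exact h.trans h2

lemma exists_mem_fib {P : ℂ[X][X]} (hm : P.Monic) (hn : P.natDegree ≠ 0) (c x : ℂ) :
    (P - Polynomial.C (Polynomial.C c)).Monic ∧ ∃ y, (x, y) ∈ fib P c := by
  have hlt : (Polynomial.C (Polynomial.C c)).degree < P.degree := by
    refine lt_of_le_of_lt degree_C_le ?_
    rw [degree_eq_natDegree hm.ne_zero]
    exact_mod_cast Nat.pos_of_ne_zero hn
  have hm' := hm.sub_of_left hlt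
  refine ⟨hm', ?_⟩
  have h1 := natDegree_spec hm' x
  rw [natDegree_eq_natDegree (degree_sub_eq_left_of_degree_lt hlt)] at h1
  obtain ⟨y, hy⟩ := IsAlgClosed.exists_root (spec P c x) (by
    intro h0
    rw [natDegree_eq_of_degree_eq_some h0] at h1
    exact hn h1.symm)
  exact ⟨y, isRoot_spec_iff.1 hy⟩

theorem no_relation {P Q : ℂ[X][X]} (hm : P.Monic) (hn : P.natDegree ≠ 0) (hJ : jac P Q = 1) {S : Finset ℂ}
    (hS : ∀ c ∉ S, ∃ T : Finset ℂ, Nonempty (fib P c ≃ₜ {z : ℂ // z ∉ T}))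
    {g : ℂ[X][X]} (hg : g ≠ 0) {m : ℕ} (hm0 : m ≠ 0) {d : ℕ} {b : ℕ → ℂ[X][X]} (hb : b d ≠ 0)
    (hbd : ∀ i ≤ d, (b i).natDegree ≤ (b d).natDegree)
    (h : ∑ i ∈ Finset.range (d + 1), subst P (b i) * (Polynomial.C Polynomial.X ^ (m + 1) * g ^ m) ^ i *
        (derivative P ^ m) ^ (d - i) = 0) : False := by
  have hPy : derivative P ≠ 0 := fun h0 => hn (derivative_eq_zero.1 h0)
  obtain ⟨a, ha, t, hat⟩ := exists_dvd_subst hm hn hg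
  obtain ⟨e, he, v, hev⟩ := exists_dvd_subst hm hn hPy
  have hπ : (b d).leadingCoeff * a.leadingCoeff * e.leadingCoeff ≠ 0 := by
    simp [hb, ha, he]
  obtain ⟨c, hc⟩ := Infinite.exists_notMem_finset
    (S ∪ ((b d).leadingCoeff * a.leadingCoeff * e.leadingCoeff).roots.toFinset)
  rw [Finset.mem_union, not_or, Multiset.mem_toFinset, mem_roots hπ, IsRoot, Polynomial.eval_mul,
    Polynomial.eval_mul] at hc
  obtain ⟨hcS, hc⟩ := hc
  have hcb : (evalRingHom c) (b d).leadingCoeff ≠ 0 := fun h0 => hc (by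
    rw [← coe_evalRingHom, h0, zero_mul, zero_mul])
  have hca : (evalRingHom c) a.leadingCoeff ≠ 0 := fun h0 => hc (by
    rw [← coe_evalRingHom, h0, mul_zero, zero_mul])
  have hce : (evalRingHom c) e.leadingCoeff ≠ 0 := fun h0 => hc (by
    rw [← coe_evalRingHom, h0, mul_zero])
  have hne {s : ℂ[X][X]} (hs : (evalRingHom c) s.leadingCoeff ≠ 0) : s.map (evalRingHom c) ≠ 0 := fun h0 => by
    have := leadingCoeff_map_of_leadingCoeff_ne_zero (evalRingHom c) hs
    rw [h0, leadingCoeff_zero] at this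
    exact hs this.symm
  obtain ⟨T, ⟨φ⟩⟩ := hS c hcS
  have hM (i : ℕ) (hi : i ≤ d) := exists_norm_eval_le ((b i).map (evalRingHom c)) ((b d).map (evalRingHom c))
    (hne hcb) (by
      rw [natDegree_map_of_leadingCoeff_ne_zero _ hcb]
      exact natDegree_map_le.trans (hbd i hi))
  choose! M hM using hM
  let M' : ℝ := ∑ i ∈ Finset.range (d + 1), |M i|
  have hM'0 : 0 ≤ M' := Finset.sum_nonneg fun _ _ => abs_nonneg _
  have hMM' (i : ℕ) (hi : i ≤ d) : M i ≤ M' := (le_abs_self _).trans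
    (Finset.single_le_sum (f := fun i => |M i|) (fun _ _ => abs_nonneg _) (Finset.mem_range.2 (by omega)))
  have hMall : ∀ᶠ x in cobounded ℂ, ∀ i ∈ Finset.range (d + 1),
      ‖((b i).map (evalRingHom c)).eval x‖ ≤ M i * ‖((b d).map (evalRingHom c)).eval x‖ :=
    (Finset.eventually_all _).2 fun i hi => hM i (Nat.lt_succ_iff.1 (Finset.mem_range.1 hi))
  have hlarge := (hMall.and (eventually_eval_ne_zero (hne hcb))).and (eventually_eval_ne_zero (hne hce))
  rw [← comap_norm_atTop, eventually_comap] at hlarge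
  obtain ⟨R, hR⟩ := eventually_atTop.1 hlarge
  have hPyz {z : ℂ × ℂ} (hz : z ∈ fib P c) (h0 : (e.map (evalRingHom c)).eval z.1 ≠ 0) : ev (dy P) z ≠ 0 := by
    rw [← ev_subst hz, hev, ev_mul] at h0
    exact left_ne_zero_of_mul h0
  have hzero {z : ℂ × ℂ} (hz : z ∈ fib P c) (hzB : z.1 ∉ (e.map (evalRingHom c)).roots.toFinset) : ev g z = 0 := by
    refine ev_eq_zero_of_decay hJ (exists_mem_fib hm hn c 0).1 φ (R := max R 1) (C := d * M' + 1) (δ := 1 / m)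
      (by positivity) (by positivity) (by positivity) (fun z hz hRz => ?_)
      (B := (e.map (evalRingHom c)).roots.toFinset) (fun z hz hzB => hPyz hz ?_) hz hzB
    · obtain ⟨⟨h1, h2⟩, h3⟩ := hR ‖z.1‖ ((le_max_left _ _).trans hRz.le) z.1 rfl
      refine ⟨hPyz hz h3, norm_le_mul_rpow hm0 (le_add_of_nonneg_left (by positivity))
        (lt_trans (by positivity) hRz) (norm_nonneg _) ?_⟩
      have hrel := congrArg (fun f => ev f z) h
      have hsum (s : Finset ℕ) (f : ℕ → ℂ[X][X]) : ev (∑ i ∈ s, f i) z = ∑ i ∈ s, ev (f i) z := by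
        simp only [ev, evalEval, eval_finsetSum]
      simp only [hsum, ev_mul, ev_pow, ev_subst hz, ev_zero] at hrel
      have := norm_le_of_relation (fun i => ((b i).map (evalRingHom c)).eval z.1) hM'0 (fun i hi =>
        (h1 i (Finset.mem_range.2 (by omega))).trans (by gcongr; exact hMM' i hi)) h2 hrel
      simpa [dy_apply] using this
    · intro h0
      rw [Multiset.mem_toFinset, mem_roots (hne hce)] at hzB
      exact hzB h0
  refine hne hca ((Polynomial.eq_zero_of_infinite_isRoot _ ?_))
  refine (Finset.finite_toSet (e.map (evalRingHom c)).roots.toFinset).infinite_compl.mono fun x hx => ?_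
  obtain ⟨y, hy⟩ := (exists_mem_fib hm hn c x).2
  have h0 := hzero hy hx
  rw [Set.mem_ofPred_eq, IsRoot, ← ev_subst (z := (x, y)) hy, hat, ev_mul, h0, zero_mul]

theorem locally_nilpotent {P Q : ℂ[X][X]} (hm : P.Monic) (hn : P.natDegree ≠ 0)
    (hirr : ∀ c : ℂ, Irreducible (P - Polynomial.C (Polynomial.C c))) (hJ : jac P Q = 1) {S : Finset ℂ}
    (hS : ∀ c ∉ S, ∃ T : Finset ℂ, Nonempty (fib P c ≃ₜ {z : ℂ // z ∉ T}))
    {δ : Derivation ℂ ℂ[X][X] ℂ[X][X]} (hδ : ∀ r, δ r = jac P r) (r : ℂ[X][X]) : ∃ N : ℕ, δ^[N] r = 0 := by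
  have hP : δ P = 0 := by rw [hδ, jac]; ring
  rcases relation_or_nilpotent hm hn hirr hP ((hδ Q).trans hJ) with
    ⟨g, hg, m, hm0, d, b, hb, hbd, h⟩ | h
  · exact (no_relation hm hn hJ hS hg hm0 hb hbd h).elim
  · exact h r
end Razar

namespace Razar
set_option autoImplicit false
open Polynomial
open scoped Polynomial.Bivariate

lemma dx_dy_comm (f : ℂ[X][Y]) : dx (dy f) = dy (dx f) := by
  induction f using Polynomial.induction_on' with
  | add p q hp hq => simp only [map_add, hp, hq]
  | monomial m a =>
    rw [← Polynomial.C_mul_X_pow_eq_monomial]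
    simp only [Derivation.leibniz, Derivation.leibniz_pow, dx_C, dx_Y, dy_apply, derivative_C, derivative_X]
    simp [dx_C, dx_Y]
    rw [derivative_X_pow, map_natCast]
    ring

lemma exists_eq_C_C_of_dx_dy_eq_zero {f : ℂ[X][Y]} (hx : dx f = 0) (hy : dy f = 0) :
    ∃ a : ℂ, f = Polynomial.C (Polynomial.C a) := by
  rw [dy_apply, derivative_eq_zero] at hy
  rw [eq_C_of_natDegree_eq_zero hy, dx_C, Polynomial.C_eq_zero, derivative_eq_zero] at hx
  rw [eq_C_of_natDegree_eq_zero hy, eq_C_of_natDegree_eq_zero hx]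
  exact ⟨_, rfl⟩

lemma exists_derivative_eq (s : ℂ[X]) : ∃ t : ℂ[X], derivative t = s := by
  induction s using Polynomial.induction_on' with
  | add p q hp hq =>
    obtain ⟨p, rfl⟩ := hp
    obtain ⟨q, rfl⟩ := hq
    exact ⟨p + q, derivative_add⟩
  | monomial m a =>
    refine ⟨Polynomial.monomial (m + 1) (a / (m + 1)), ?_⟩
    have : (m + 1 : ℂ) ≠ 0 := by exact_mod_cast Nat.succ_ne_zero m
    rw [derivative_monomial, Nat.add_sub_cancel]
    push_cast
    rw [div_mul_cancel₀ _ this]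

variable {P Q : ℂ[X][Y]}

lemma exists_eq_aeval_of_jac_eq_zero (hn : P.natDegree ≠ 0) (hJ : jac P Q = 1) {r : ℂ[X][Y]}
    (hr : jac P r = 0) : ∃ s : ℂ[X], r = aeval P s := by
  have hPy : dy P ≠ 0 := fun h0 => hn (derivative_eq_zero.1 h0)
  induction hd : r.natDegree using Nat.strong_induction_on generalizing r with
  | _ d ih =>
    let r' := jac r Q
    have hx : dx r = r' * dx P := by
      simp only [r', jac] at hJ hr ⊢
      linear_combination (-(dx r)) * hJ - (-dx Q) * hr
    have hy : dy r = r' * dy P := by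
      simp only [r', jac] at hJ hr ⊢
      linear_combination (-(dy r)) * hJ - (-dy Q) * hr
    have hr' : jac P r' = 0 := by
      have h := dx_dy_comm r
      have h2 := dx_dy_comm P
      rw [hx, hy, Derivation.leibniz, Derivation.leibniz, smul_eq_mul, smul_eq_mul, smul_eq_mul, smul_eq_mul,
        h2] at h
      rw [jac]
      linear_combination -h
    have hconst {f : ℂ[X][Y]} (hfx : dx f = 0) (hfy : dy f = 0) : ∃ s : ℂ[X], f = aeval P s := by
      obtain ⟨a, rfl⟩ := exists_eq_C_C_of_dx_dy_eq_zero hfx hfy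
      exact ⟨Polynomial.C a, by rw [Polynomial.aeval_C]; rfl⟩
    by_cases h0 : r' = 0
    · exact hconst (by rw [hx, h0, zero_mul]) (by rw [hy, h0, zero_mul])
    have hlt : r'.natDegree < d := by
      have h1 := congrArg natDegree hy
      rw [natDegree_mul h0 hPy, dy_apply, dy_apply, natDegree_derivative, natDegree_derivative, hd] at h1
      have : d ≠ 0 := by
        rintro rfl
        rw [← derivative_eq_zero, ← dy_apply, hy] at hd
        exact mul_ne_zero h0 hPy hd
      omega
    obtain ⟨s, hs⟩ := ih _ hlt hr' rfl
    obtain ⟨t, rfl⟩ := exists_derivative_eq s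
    obtain ⟨q, hq⟩ := hconst (f := r - aeval P t)
      (by rw [map_sub, Derivation.map_aeval, hx, hs, smul_eq_mul, sub_self])
      (by rw [map_sub, Derivation.map_aeval, hy, hs, smul_eq_mul, sub_self])
    exact ⟨q + t, by rw [map_add, ← hq, sub_add_cancel]⟩

variable (P Q) in
/-- The substitution `x ↦ P`, `y ↦ Q`. -/
noncomputable def subst₂ : ℂ[X][Y] →+* ℂ[X][Y] := eval₂RingHom (aeval (R := ℂ) P).toRingHom Q

lemma subst₂_C_mul_X_pow (s : ℂ[X]) (m : ℕ) : subst₂ P Q (Polynomial.C s * Y ^ m) = aeval P s * Q ^ m := by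
  simp [subst₂]

lemma exists_derivation_subst₂_eq {δ : Derivation ℂ ℂ[X][Y] ℂ[X][Y]} (hP : δ P = 0) (hQ : δ Q = 1)
    (s : ℂ[X][Y]) : ∃ t, δ (subst₂ P Q t) = subst₂ P Q s := by
  induction s using Polynomial.induction_on' with
  | add p q hp hq =>
    obtain ⟨p', hp⟩ := hp
    obtain ⟨q', hq⟩ := hq
    exact ⟨p' + q', by rw [map_add, map_add, hp, hq, map_add]⟩
  | monomial m a =>
    have : (m + 1 : ℂ) ≠ 0 := by exact_mod_cast Nat.succ_ne_zero m
    refine ⟨Polynomial.C (Polynomial.C ((m + 1 : ℂ)⁻¹) * a) * Y ^ (m + 1), ?_⟩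
    rw [← Polynomial.C_mul_X_pow_eq_monomial, subst₂_C_mul_X_pow, subst₂_C_mul_X_pow, Derivation.leibniz,
      derivation_aeval_eq_zero hP, smul_zero, add_zero, Derivation.leibniz_pow, hQ, Nat.add_sub_cancel, map_mul,
      Polynomial.aeval_C]
    simp only [nsmul_eq_mul, smul_eq_mul, mul_one]
    have h1 : algebraMap ℂ ℂ[X][Y] (m + 1 : ℂ)⁻¹ * ((m + 1 : ℕ) : ℂ[X][Y]) = 1 := by
      rw [← map_natCast (algebraMap ℂ ℂ[X][Y]), ← map_mul, Nat.cast_succ, inv_mul_cancel₀ this, map_one]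
    linear_combination (aeval P a * Q ^ m) * h1

theorem subst₂_surjective (hn : P.natDegree ≠ 0) (hJ : jac P Q = 1)
    {δ : Derivation ℂ ℂ[X][Y] ℂ[X][Y]} (hδ : ∀ r, δ r = jac P r) (hnil : ∀ r, ∃ N : ℕ, δ^[N] r = 0) :
    Function.Surjective (subst₂ P Q) := by
  have hP : δ P = 0 := by rw [hδ, jac]; ring
  intro r
  obtain ⟨N, hN⟩ := hnil r
  induction N generalizing r with
  | zero => exact ⟨0, by rw [map_zero]; exact hN.symm⟩
  | succ N ih =>
    obtain ⟨s, hs⟩ := ih (δ r) hN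
    obtain ⟨t, ht⟩ := exists_derivation_subst₂_eq hP ((hδ Q).trans hJ) s
    obtain ⟨q, hq⟩ := exists_eq_aeval_of_jac_eq_zero hn hJ (r := r - subst₂ P Q t) (by
      rw [← hδ, map_sub, ht, hs, sub_self])
    refine ⟨Polynomial.C q + t, ?_⟩
    have h2 := subst₂_C_mul_X_pow (P := P) (Q := Q) q 0
    rw [pow_zero, pow_zero, mul_one, mul_one] at h2
    rw [map_add, h2, ← hq, sub_add_cancel]

variable (P) in
/-- The Hamiltonian derivation `r ↦ J(P, r)`. -/
noncomputable def jacDer : Derivation ℂ ℂ[X][Y] ℂ[X][Y] := dx P • dy - dy P • dx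

lemma jacDer_apply (r : ℂ[X][Y]) : jacDer P r = jac P r := by
  simp [jacDer, jac]

theorem subst₂_surjective_of_rational (hm : P.Monic) (hn : P.natDegree ≠ 0)
    (hirr : ∀ c : ℂ, Irreducible (P - Polynomial.C (Polynomial.C c))) (hJ : jac P Q = 1) {S : Finset ℂ}
    (hS : ∀ c ∉ S, ∃ T : Finset ℂ, Nonempty (fib P c ≃ₜ {z : ℂ // z ∉ T})) :
    Function.Surjective (subst₂ P Q) :=
  subst₂_surjective hn hJ jacDer_apply (locally_nilpotent hm hn hirr hJ hS jacDer_apply)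
end Razar

namespace Razar
set_option autoImplicit false
open Polynomial
open scoped Polynomial.Bivariate

/-- The triangular coordinate change `x ↦ x + y ^ N`, `y ↦ y`. -/
noncomputable def shear (N : ℕ) : MvPolynomial (Fin 2) ℂ ≃ₐ[ℂ] ℂ[X][Y] :=
  AlgEquiv.ofAlgHom (MvPolynomial.aeval ![Polynomial.C Polynomial.X + Y ^ N, Y])
    (aevalAeval (MvPolynomial.X 0 - MvPolynomial.X 1 ^ N) (MvPolynomial.X 1))
    (by ext <;> simp)
    (by
      ext i : 1
      fin_cases i <;> simp)

lemma shear_X_zero (N : ℕ) : shear N (MvPolynomial.X 0) = Polynomial.C Polynomial.X + Y ^ N := by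
  simp [shear]

lemma shear_X_one (N : ℕ) : shear N (MvPolynomial.X 1) = Y := by
  simp [shear]

lemma shear_C (N : ℕ) (a : ℂ) : shear N (MvPolynomial.C a) = Polynomial.C (Polynomial.C a) :=
  (shear N).commutes a

lemma ev_shear (N : ℕ) (f : MvPolynomial (Fin 2) ℂ) (z : ℂ × ℂ) :
    ev (shear N f) z = evalPoly f (z.1 + z.2 ^ N, z.2) := by
  induction f using MvPolynomial.induction_on with
  | C a => simp [shear_C, evalPoly]
  | add p q hp hq => rw [map_add, ev_add, hp, hq]; simp [evalPoly]
  | mul_X p i hp =>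
    rw [map_mul, ev_mul, hp]
    fin_cases i
    · simp [evalPoly, shear_X_zero]
    · simp [evalPoly, shear_X_one]

lemma dx_shear (N : ℕ) (f : MvPolynomial (Fin 2) ℂ) : dx (shear N f) = shear N (pderiv 0 f) := by
  induction f using MvPolynomial.induction_on with
  | C a => simp [shear_C, dx_C]
  | add p q hp hq => simp only [map_add, hp, hq]
  | mul_X p i hp =>
    rw [map_mul, Derivation.leibniz, hp]
    fin_cases i
    · simp [shear_X_zero, dx_C, dx_Y, Derivation.leibniz_pow]
    · simp [shear_X_one, dx_Y, pderiv_X]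

lemma dy_shear (N : ℕ) (f : MvPolynomial (Fin 2) ℂ) :
    dy (shear N f) = (N : ℂ[X][Y]) * Y ^ (N - 1) * shear N (pderiv 0 f) + shear N (pderiv 1 f) := by
  induction f using MvPolynomial.induction_on with
  | C a => simp [shear_C, dy_apply]
  | add p q hp hq => simp only [map_add, hp, hq]; ring
  | mul_X p i hp =>
    rw [map_mul, Derivation.leibniz, hp]
    fin_cases i
    · simp [shear_X_zero, dy_apply, derivative_X_pow, pderiv_X]
      ring
    · simp [shear_X_one, dy_apply, pderiv_X]
      ring

lemma jac_shear (N : ℕ) (f g : MvPolynomial (Fin 2) ℂ) :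
    jac (shear N f) (shear N g) = shear N (pderiv 0 f * pderiv 1 g - pderiv 1 f * pderiv 0 g) := by
  rw [jac, dx_shear, dx_shear, dy_shear, dy_shear, map_sub, map_mul, map_mul]
  ring

lemma shear_monomial (N : ℕ) (s : Fin 2 →₀ ℕ) (a : ℂ) :
    shear N (MvPolynomial.monomial s a) =
      Polynomial.C (Polynomial.C a) * ((Y ^ N + Polynomial.C Polynomial.X) ^ s 0 * Y ^ s 1) := by
  rw [MvPolynomial.monomial_eq, map_mul, shear_C, Finsupp.prod_fintype _ _ (fun _ => pow_zero _), Fin.prod_univ_two,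
    map_mul, map_pow, map_pow, shear_X_zero, shear_X_one, add_comm]

lemma monic_shear_aux {N : ℕ} (hN : N ≠ 0) (i j : ℕ) :
    ((Y ^ N + Polynomial.C Polynomial.X) ^ i * Y ^ j : ℂ[X][Y]).Monic ∧
      ((Y ^ N + Polynomial.C Polynomial.X) ^ i * Y ^ j : ℂ[X][Y]).natDegree = N * i + j := by
  have h := monic_X_pow_add_C (Polynomial.X : ℂ[X]) hN
  refine ⟨(h.pow i).mul (monic_X_pow j), ?_⟩
  rw [(h.pow i).natDegree_mul (monic_X_pow j), h.natDegree_pow, natDegree_X_pow_add_C, natDegree_X_pow, mul_comm]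

lemma exists_shear_leadingCoeff {f : MvPolynomial (Fin 2) ℂ} (hf : f ≠ 0) :
    ∃ (N : ℕ) (κ : ℂ), κ ≠ 0 ∧ (shear N f).leadingCoeff = Polynomial.C κ := by
  let N := f.support.sup (fun s => s 1) + 1
  have hN : N ≠ 0 := Nat.succ_ne_zero _
  have hlt {s} (hs : s ∈ f.support) : s 1 < N :=
    Nat.lt_succ_of_le (Finset.le_sup (f := fun s : Fin 2 →₀ ℕ => s 1) hs)
  obtain ⟨t, ht, hmax⟩ := f.support.exists_max_image (fun s => N * s 0 + s 1)
    (MvPolynomial.support_nonempty.2 hf)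
  have hsum : shear N f = ∑ s ∈ f.support, Polynomial.C (Polynomial.C (MvPolynomial.coeff s f)) *
      ((Y ^ N + Polynomial.C Polynomial.X) ^ s 0 * Y ^ s 1) := by
    conv_lhs => rw [f.as_sum, map_sum]
    exact Finset.sum_congr rfl fun s _ => shear_monomial _ _ _
  have hκ : MvPolynomial.coeff t f ≠ 0 := MvPolynomial.mem_support_iff.1 ht
  have hcoeff : (shear N f).coeff (N * t 0 + t 1) = Polynomial.C (MvPolynomial.coeff t f) := by
    rw [hsum, finsetSum_coeff, Finset.sum_eq_single_of_mem t ht]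
    · rw [Polynomial.coeff_C_mul, ← (monic_shear_aux hN _ _).2, (monic_shear_aux hN _ _).1.coeff_natDegree, mul_one]
    · intro s hs hst
      rw [Polynomial.coeff_C_mul, coeff_eq_zero_of_natDegree_lt, mul_zero]
      rw [(monic_shear_aux hN _ _).2]
      refine lt_of_le_of_ne (hmax s hs) fun heq => hst ?_
      have h1 : s 1 = t 1 := by
        have := congrArg (· % N) heq
        simpa [Nat.mul_add_mod, Nat.mod_eq_of_lt (hlt hs), Nat.mod_eq_of_lt (hlt ht)] using this
      have h0 : s 0 = t 0 := by
        rw [h1] at heq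
        exact Nat.eq_of_mul_eq_mul_left (Nat.pos_of_ne_zero hN) (Nat.add_right_cancel heq)
      ext i
      fin_cases i
      exacts [h0, h1]
  have hdeg : (shear N f).natDegree ≤ N * t 0 + t 1 := by
    rw [hsum]
    refine natDegree_sum_le_of_forall_le _ _ fun s hs => (natDegree_C_mul_le _ _).trans ?_
    rw [(monic_shear_aux hN _ _).2]
    exact hmax s hs
  refine ⟨N, MvPolynomial.coeff t f, hκ, ?_⟩
  rw [leadingCoeff, natDegree_eq_of_le_of_coeff_ne_zero hdeg (by rw [hcoeff]; exact Polynomial.C_ne_zero.2 hκ),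
    hcoeff]

/-- The triangular automorphism `(x, y) ↦ (x + y ^ N, y)` of `ℂ × ℂ`. -/
def shearHomeo (N : ℕ) : ℂ × ℂ ≃ₜ ℂ × ℂ where
  toFun z := (z.1 + z.2 ^ N, z.2)
  invFun z := (z.1 - z.2 ^ N, z.2)
  left_inv z := by simp
  right_inv z := by simp
  continuous_toFun := by fun_prop
  continuous_invFun := by fun_prop

lemma injective_of_surjective_of_noetherian {R : Type*} [CommRing R] [IsNoetherianRing R] (f : R →+* R)
    (hf : Function.Surjective f) : Function.Injective f := by
  have hmono : Monotone fun n : ℕ => RingHom.ker (f ^ n) := by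
    refine monotone_nat_of_le_succ fun n x hx => ?_
    rw [RingHom.mem_ker] at hx ⊢
    rw [pow_succ', RingHom.mul_def, RingHom.comp_apply, hx, map_zero]
  obtain ⟨n, hn⟩ := monotone_stabilizes_iff_noetherian.2 ‹IsNoetherianRing R› ⟨_, hmono⟩
  rw [injective_iff_map_eq_zero]
  intro x hx
  have hsurj : Function.Surjective (f ^ n) := by
    rw [RingHom.coe_pow]
    exact hf.iterate n
  obtain ⟨y, rfl⟩ := hsurj x
  have hy : y ∈ RingHom.ker (f ^ (n + 1)) := by
    rw [RingHom.mem_ker, pow_succ', RingHom.mul_def, RingHom.comp_apply, hx]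
  have : RingHom.ker (f ^ n) = RingHom.ker (f ^ (n + 1)) := hn (n + 1) n.le_succ
  rw [← this] at hy
  exact hy

lemma evalPoly_aeval (A P Q : MvPolynomial (Fin 2) ℂ) (p : ℂ × ℂ) :
    evalPoly (MvPolynomial.aeval ![P, Q] A) p = evalPoly A (polyMap P Q p) := by
  induction A using MvPolynomial.induction_on with
  | C a => simp [evalPoly]
  | add A B hA hB =>
    simp only [evalPoly, map_add] at hA hB ⊢
    rw [hA, hB]
  | mul_X A i hA =>
    simp only [evalPoly, map_mul] at hA ⊢
    rw [hA]
    fin_cases i <;> simp [polyMap, evalPoly]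

theorem isInvertible_of_surjective {P Q : MvPolynomial (Fin 2) ℂ}
    (h : Function.Surjective (MvPolynomial.aeval (R := ℂ) ![P, Q])) : IsInvertible P Q := by
  have hinj : Function.Injective (MvPolynomial.aeval (R := ℂ) ![P, Q]) :=
    injective_of_surjective_of_noetherian (MvPolynomial.aeval (R := ℂ) ![P, Q]).toRingHom h
  obtain ⟨A, hA⟩ := h (MvPolynomial.X 0)
  obtain ⟨B, hB⟩ := h (MvPolynomial.X 1)
  have hcomp (f : MvPolynomial (Fin 2) ℂ) :
      MvPolynomial.aeval ![P, Q] (MvPolynomial.aeval ![A, B] f) = f := by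
    have : (MvPolynomial.aeval (R := ℂ) ![P, Q]).comp (MvPolynomial.aeval ![A, B]) = AlgHom.id ℂ _ := by
      ext i : 1
      fin_cases i
      · simpa using hA
      · simpa using hB
    exact DFunLike.congr_fun this f
  have hP : MvPolynomial.aeval ![A, B] P = MvPolynomial.X 0 := hinj (by rw [hcomp, MvPolynomial.aeval_X]; rfl)
  have hQ : MvPolynomial.aeval ![A, B] Q = MvPolynomial.X 1 := hinj (by rw [hcomp, MvPolynomial.aeval_X]; rfl)
  refine ⟨A, B, ?_, ?_⟩ <;> ext p
  · change evalPoly A (polyMap P Q p) = _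
    rw [← evalPoly_aeval, hA]; simp [evalPoly]
  · change evalPoly B (polyMap P Q p) = _
    rw [← evalPoly_aeval, hB]; simp [evalPoly]
  · change evalPoly P (polyMap A B p) = _
    rw [← evalPoly_aeval, hP]; simp [evalPoly]
  · change evalPoly Q (polyMap A B p) = _
    rw [← evalPoly_aeval, hQ]; simp [evalPoly]

open Polynomial Polynomial.Bivariate in
lemma exists_shear_aeval_eq_subst₂ {P Q : MvPolynomial (Fin 2) ℂ} {N : ℕ} {a b : ℂ} (s : ℂ[X][Y]) :
    ∃ g : MvPolynomial (Fin 2) ℂ,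
      shear N (MvPolynomial.aeval ![P, Q] g) =
        subst₂ (Polynomial.C (Polynomial.C a) * shear N P) (Polynomial.C (Polynomial.C b) * shear N Q) s := by
  let φ : ℂ[X][Y] →+* ℂ[X][Y] := ((shear N).toAlgHom.comp ((MvPolynomial.aeval ![P, Q]).comp
    (aevalAeval (MvPolynomial.C a * MvPolynomial.X 0) (MvPolynomial.C b * MvPolynomial.X 1)))).toRingHom
  have h : φ = subst₂ (Polynomial.C (Polynomial.C a) * shear N P) (Polynomial.C (Polynomial.C b) * shear N Q) := by
    ext <;> simp [φ, subst₂, shear_C]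
  rw [← h]
  exact ⟨_, rfl⟩

theorem isInvertible_of_isRationalPoly {P Q : MvPolynomial (Fin 2) ℂ} (hK : IsKeller P Q)
    (hP : IsRationalPoly P) (hirr : ∀ c : ℂ, Irreducible (P - MvPolynomial.C c)) : IsInvertible P Q := by
  obtain ⟨k, hk, hJ⟩ := hK
  obtain ⟨S, hS⟩ := hP
  have hP0 : P ≠ 0 := by
    rintro rfl
    simpa using (hirr 0).ne_zero
  obtain ⟨N, κ, hκ, hlead⟩ := exists_shear_leadingCoeff hP0
  have hCC {a b : ℂ} (hab : a * b = 1) :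
      (Polynomial.C (Polynomial.C a) * Polynomial.C (Polynomial.C b) : ℂ[X][Y]) = 1 := by
    rw [← Polynomial.C_mul, ← Polynomial.C_mul, hab, Polynomial.C_1, Polynomial.C_1]
  let P' : ℂ[X][Y] := Polynomial.C (Polynomial.C κ⁻¹) * shear N P
  let Q' : ℂ[X][Y] := Polynomial.C (Polynomial.C (κ / k)) * shear N Q
  have hm : P'.Monic := by
    rw [Monic, leadingCoeff_mul, hlead, leadingCoeff_C, ← Polynomial.C_mul, inv_mul_cancel₀ hκ, Polynomial.C_1]
  have hJ' : jac P' Q' = 1 := by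
    have h := jac_shear N P Q
    rw [hJ, shear_C] at h
    have h2 : jac P' Q' = Polynomial.C (Polynomial.C κ⁻¹) * Polynomial.C (Polynomial.C (κ / k)) *
        jac (shear N P) (shear N Q) := by
      simp only [P', Q', jac, Derivation.leibniz, dx_C, dy_apply, derivative_C, smul_eq_mul, map_zero, mul_zero, add_zero]
      ring
    rw [h2, h, ← Polynomial.C_mul, ← Polynomial.C_mul, ← Polynomial.C_mul, ← Polynomial.C_mul,
      show κ⁻¹ * (κ / k) * k = 1 by field_simp, Polynomial.C_1, Polynomial.C_1]
  have hsub (c : ℂ) : P' - Polynomial.C (Polynomial.C c) =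
      Polynomial.C (Polynomial.C κ⁻¹) * shear N (P - MvPolynomial.C (κ * c)) := by
    rw [map_sub, shear_C, Polynomial.C_mul, Polynomial.C_mul, mul_sub, ← mul_assoc, hCC (inv_mul_cancel₀ hκ), one_mul]
  have hirr' (c : ℂ) : Irreducible (P' - Polynomial.C (Polynomial.C c)) := by
    rw [hsub, irreducible_isUnit_mul (IsUnit.of_mul_eq_one _ (hCC (inv_mul_cancel₀ hκ))),
      MulEquiv.irreducible_iff (shear N)]
    exact hirr _
  have hn : P'.natDegree ≠ 0 := by
    intro h0
    refine (hirr' 1).ne_zero ?_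
    rw [hm.natDegree_eq_zero.1 h0, Polynomial.C_1, Polynomial.C_1, sub_self]
  have hS' : ∀ c ∉ S.image (κ⁻¹ * ·), ∃ T : Finset ℂ, Nonempty (fib P' c ≃ₜ {z : ℂ // z ∉ T}) := by
    intro c hc
    have hc' : κ * c ∉ S := fun h => hc (Finset.mem_image.2 ⟨_, h, inv_mul_cancel_left₀ hκ c⟩)
    obtain ⟨T, ⟨e⟩⟩ := hS _ hc'
    refine ⟨T, ⟨((shearHomeo N).subtype fun z => ?_).trans e⟩⟩
    change ev P' z = c ↔ evalPoly P (z.1 + z.2 ^ N, z.2) = κ * c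
    rw [← ev_shear, ev_mul, ev_C, Polynomial.eval_C, inv_mul_eq_iff_eq_mul₀ hκ]
  refine isInvertible_of_surjective fun f => ?_
  obtain ⟨s, hs⟩ := subst₂_surjective_of_rational hm hn hirr' hJ' hS' (shear N f)
  obtain ⟨g, hg⟩ := exists_shear_aeval_eq_subst₂ (P := P) (Q := Q) (N := N) (a := κ⁻¹) (b := κ / k) s
  exact ⟨g, (shear N).injective (hg.trans hs)⟩
end Razar

/-- Razar's Theorem: a Keller map whose first component is a
rational polynomial with all fibers irreducible is invertible. -/
theorem razar_theorem
    (P Q : MvPolynomial (Fin 2) ℂ) (hK : IsKeller P Q)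
    (hP : IsRationalPoly P)
    (hirr : ∀ c : ℂ, Irreducible (P - MvPolynomial.C c)) :
    IsInvertible P Q :=
  Razar.isInvertible_of_isRationalPoly hK hP hirr
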